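/- arXiv:2411.14268 — 2 statements merged into one kernel-verified Lean document; each statement's English description precedes it below -/
import Mathlib

section
/- There exist a constant a > 0 and a family of monotone Boolean functions f_n : {0,1}^n → {0,1} such that: (i) for all sufficiently large n, f_n is computable by a monotone circuit of size at most n^{a·log n}; and (ii) for every constant c > 0 there exist ε > 0 and n_0 such that for all n ≥ n_0, every monotone circuit of depth at most n^c computing f_n has size at least 2^{n^ε}. -/
namespace Paper


/-! ### Monotone circuits -/

inductive GateD (n s : ℕ) : Type
  | inp (v : Fin n)
  | const (b : Bool)
  | and (j k : Fin s)
  | or (j k : Fin s)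

/-- A monotone circuit: a DAG of fanin-2 AND/OR gates over variables and constants;
each internal gate points to earlier gates.  The last gate is the output. -/
structure MonCircuit (n : ℕ) where
  size : ℕ
  size_pos : 0 < size
  gate : Fin size → GateD n size
  wf : ∀ i : Fin size,
    match gate i with
    | GateD.and j k => j < i ∧ k < i
    | GateD.or j k => j < i ∧ k < i
    | _ => True

def outIdx {n : ℕ} (C : MonCircuit n) : Fin C.size :=
  ⟨C.size - 1, Nat.sub_lt C.size_pos Nat.one_pos⟩

/-- The circuit computes `f` (gate values are forced by the evaluation equations). -/
def Computes {n : ℕ} (C : MonCircuit n) (f : (Fin n → Bool) → Bool) : Prop :=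
  ∃ v : Fin C.size → (Fin n → Bool) → Bool,
    (∀ i x, v i x =
      match C.gate i with
      | GateD.inp a => x a
      | GateD.const b => b
      | GateD.and j k => v j x && v k x
      | GateD.or j k => v j x || v k x) ∧
    ∀ x, f x = v (outIdx C) x

/-- The circuit has depth (longest source-to-output path) at most `d`. -/
def CDepthLE {n : ℕ} (C : MonCircuit n) (d : ℕ) : Prop :=
  ∃ h : Fin C.size → ℕ, (∀ i, h i ≤ d) ∧
    ∀ i : Fin C.size,
      match C.gate i with
      | GateD.and j k => h j < h i ∧ h k < h i
      | GateD.or j k => h j < h i ∧ h k < h i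
      | _ => True

/-- A monotone Boolean function. -/
def MonotoneFun {n : ℕ} (f : (Fin n → Bool) → Bool) : Prop :=
  ∀ x y : Fin n → Bool, (∀ i, x i ≤ y i) → f x ≤ f y

section Counting

open Finset

variable {Q A : Type*} [Fintype Q] [DecidableEq Q] [Fintype A] [DecidableEq A]

lemma card_through_mul_of_functional (S : Finset (Q × A))
    (hS : ∀ e ∈ S, ∀ e' ∈ S, e.1 = e'.1 → e = e') :
    #{h : Q → A | ∀ e ∈ S, h e.1 = e.2} * Fintype.card A ^ #S
      = Fintype.card A ^ Fintype.card Q := by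
  have h1 : ({h : Q → A | ∀ e ∈ S, h e.1 = e.2} : Finset (Q → A))
      = Fintype.piFinset (fun q => ({a : A | ∀ a', (q, a') ∈ S → a = a'} : Finset A)) := by
    ext h
    simp only [mem_filter, mem_univ, true_and, Fintype.mem_piFinset, Prod.forall]
  have h2 : ∀ q, #({a : A | ∀ a', (q, a') ∈ S → a = a'} : Finset A)
      = if q ∈ S.image Prod.fst then 1 else Fintype.card A := by
    intro q
    split_ifs with hq
    · obtain ⟨⟨q', a⟩, he, rfl⟩ := mem_image.1 hq
      rw [card_eq_one]
      refine ⟨a, ?_⟩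
      ext b
      simp only [mem_filter, mem_univ, true_and, mem_singleton]
      constructor
      · intro hb; exact hb a he
      · rintro rfl a' ha'
        have := hS _ he _ ha' rfl
        simpa using this
    · rw [← card_univ]
      congr 1
      ext b
      simp only [mem_filter, mem_univ, true_and, iff_true]
      intro a' ha'
      exact absurd (mem_image.2 ⟨_, ha', rfl⟩) hq
  have h3 : #(S.image Prod.fst) = #S :=
    card_image_of_injOn fun e he e' he' h => hS e he e' he' h
  rw [h1, Fintype.card_piFinset, prod_congr rfl (fun q _ => h2 q), prod_ite]
  simp only [prod_const_one, one_mul, prod_const]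
  rw [← pow_add, ← h3]
  congr 1
  have h4 := card_filter_add_card_filter_not (s := (univ : Finset Q))
    (fun q => q ∈ S.image Prod.fst)
  have h5 : #({q : Q | q ∈ S.image Prod.fst} : Finset Q) = #(S.image Prod.fst) := by
    congr 1; ext; simp
  rw [h5, card_univ] at h4
  omega

lemma card_through_mul_le (S : Finset (Q × A)) :
    #{h : Q → A | ∀ e ∈ S, h e.1 = e.2} * Fintype.card A ^ #S
      ≤ Fintype.card A ^ Fintype.card Q := by
  by_cases hne : ({h : Q → A | ∀ e ∈ S, h e.1 = e.2} : Finset (Q → A)).Nonempty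
  · obtain ⟨h, hh⟩ := hne
    simp only [mem_filter, mem_univ, true_and] at hh
    refine (card_through_mul_of_functional S ?_).le
    intro e he e' he' h1
    ext
    · exact h1
    · rw [← hh e he, ← hh e' he', h1]
  · rw [not_nonempty_iff_eq_empty.1 hne]; simp

lemma one_add_div_pow_le_two {a k : ℝ} {l n : ℕ} (ha : 0 ≤ a) (hk : 0 < k) (h : 2 * l * a ≤ k)
    (hn : n ≤ l) : (1 + a / k) ^ n ≤ 2 := by
  have h0 : 0 ≤ a / k := by positivity
  have h1 : (1 + a / k) ^ n ≤ Real.exp (l * (a / k)) := by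
    calc (1 + a / k) ^ n ≤ (1 + a / k) ^ l := pow_le_pow_right₀ (by linarith) hn
      _ ≤ (Real.exp (a / k)) ^ l := by
          gcongr; rw [add_comm]; exact Real.add_one_le_exp _
      _ = _ := by rw [← Real.exp_nat_mul]
  have h2 : (l : ℝ) * (a / k) ≤ 1 / 2 := by
    rw [← mul_div_assoc, div_le_iff₀ hk]; linarith
  have h3 : Real.exp (1 / 2) ≤ 2 := by
    have h4 : Real.exp (1 / 2) ^ 2 = Real.exp 1 := by
      rw [← Real.exp_nat_mul]; norm_num
    have h5 := Real.exp_one_lt_d9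
    nlinarith [Real.exp_pos (1 / 2 : ℝ)]
  exact h1.trans ((Real.exp_le_exp.2 h2).trans h3)

/-- Second moment bound: a random function passes through some member of a spread family of
partial functions with probability at least one half. -/
lemma half_le_card_exists_through {ξ : Type*} [DecidableEq ξ] (X : Finset ξ) (hX : X.Nonempty)
    (S : ξ → Finset (Q × A))
    (hfun : ∀ x ∈ X, ∀ e ∈ S x, ∀ e' ∈ S x, e.1 = e'.1 → e = e')
    (l k : ℕ) (hl : ∀ x ∈ X, #(S x) ≤ l) (hk : 0 < k) (hlk : 2 * l * Fintype.card A ≤ k)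
    (hspread : ∀ T : Finset (Q × A), #{x ∈ X | T ⊆ S x} * k ^ #T ≤ #X) :
    Fintype.card (Q → A) ≤ 2 * #{h : Q → A | ∃ x ∈ X, ∀ e ∈ S x, h e.1 = e.2} := by
  classical
  set a : ℝ := (Fintype.card A : ℝ) with ha
  set G : Finset (Q → A) := {h : Q → A | ∃ x ∈ X, ∀ e ∈ S x, h e.1 = e.2} with hG
  set M : ℝ := a ^ Fintype.card Q with hM
  have ha0 : 0 ≤ a := Nat.cast_nonneg _
  let Z : (Q → A) → ℝ := fun h => ∑ x ∈ X, if ∀ e ∈ S x, h e.1 = e.2 then a ^ #(S x) else 0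
  have hZ1 : ∑ h, Z h = #X * M := by
    simp only [Z]
    rw [sum_comm]
    have : ∀ x ∈ X, (∑ h : Q → A, if ∀ e ∈ S x, h e.1 = e.2 then a ^ #(S x) else 0) = M := by
      intro x hx
      rw [← sum_filter, sum_const, nsmul_eq_mul]
      have := card_through_mul_of_functional (S x) (hfun x hx)
      rw [hM, ha]
      exact_mod_cast this
    rw [sum_congr rfl this, sum_const, nsmul_eq_mul]
  have hinner : ∀ x ∈ X, ∑ x' ∈ X, a ^ #(S x ∩ S x') ≤ 2 * #X := by
    intro x hx
    calc ∑ x' ∈ X, a ^ #(S x ∩ S x')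
        ≤ ∑ x' ∈ X, ∑ T ∈ (S x).powerset, if T ⊆ S x' then a ^ #T else 0 := by
          refine sum_le_sum fun x' _ => ?_
          have h1 : S x ∩ S x' ∈ (S x).powerset := mem_powerset.2 inter_subset_left
          have h2 := single_le_sum (f := fun T => if T ⊆ S x' then a ^ #T else 0)
            (fun T _ => by split_ifs <;> positivity) h1
          simpa [inter_subset_right] using h2
      _ = ∑ T ∈ (S x).powerset, a ^ #T * #{x' ∈ X | T ⊆ S x'} := by
          rw [sum_comm]
          refine sum_congr rfl fun T _ => ?_
          rw [← sum_filter, sum_const, nsmul_eq_mul, mul_comm]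
      _ ≤ ∑ T ∈ (S x).powerset, (a / k) ^ #T * #X := by
          refine sum_le_sum fun T _ => ?_
          have h1 : (#{x' ∈ X | T ⊆ S x'} : ℝ) * (k : ℝ) ^ #T ≤ #X := by
            exact_mod_cast hspread T
          rw [div_pow, div_mul_eq_mul_div, le_div_iff₀ (by positivity), mul_assoc]
          gcongr
      _ = (1 + a / k) ^ #(S x) * #X := by
          rw [← sum_mul]
          congr 1
          have := Finset.sum_pow_mul_eq_add_pow (a / (k : ℝ)) 1 (S x)
          simpa [add_comm] using this
      _ ≤ 2 * #X := by
          gcongr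
          exact one_add_div_pow_le_two (l := l) ha0 (by exact_mod_cast hk)
            (by rw [ha]; exact_mod_cast hlk) (hl x hx)
  have hZ2 : ∑ h, Z h ^ 2 ≤ 2 * #X ^ 2 * M := by
    have h1 : ∀ h, Z h ^ 2 = ∑ x ∈ X, ∑ x' ∈ X,
        if ∀ e ∈ S x ∪ S x', h e.1 = e.2 then a ^ #(S x ∪ S x') * a ^ #(S x ∩ S x') else 0 := by
      intro h
      simp only [Z]
      rw [sq, sum_mul_sum]
      refine sum_congr rfl fun x _ => sum_congr rfl fun x' _ => ?_
      rw [← pow_add, card_union_add_card_inter, pow_add]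
      have : (∀ e ∈ S x ∪ S x', h e.1 = e.2) ↔
          (∀ e ∈ S x, h e.1 = e.2) ∧ (∀ e ∈ S x', h e.1 = e.2) := by
        simp only [mem_union, or_imp, forall_and]
      rw [if_congr this rfl rfl, ite_and, ite_mul, zero_mul, mul_ite, mul_zero]
    simp only [h1]
    rw [sum_comm]
    have h2 : ∀ x ∈ X, ∀ x' ∈ X, (∑ h : Q → A, if ∀ e ∈ S x ∪ S x', h e.1 = e.2
        then a ^ #(S x ∪ S x') * a ^ #(S x ∩ S x') else 0) ≤ M * a ^ #(S x ∩ S x') := by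
      intro x _ x' _
      rw [← sum_filter, sum_const, nsmul_eq_mul, ← mul_assoc]
      gcongr
      rw [hM, ha]
      exact_mod_cast card_through_mul_le (S x ∪ S x')
    calc ∑ x ∈ X, ∑ h, ∑ x' ∈ X, _
        = ∑ x ∈ X, ∑ x' ∈ X, ∑ h : Q → A, if ∀ e ∈ S x ∪ S x', h e.1 = e.2
            then a ^ #(S x ∪ S x') * a ^ #(S x ∩ S x') else 0 :=
          sum_congr rfl fun x _ => sum_comm
      _ ≤ ∑ x ∈ X, ∑ x' ∈ X, M * a ^ #(S x ∩ S x') :=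
          sum_le_sum fun x hx => sum_le_sum fun x' hx' => h2 x hx x' hx'
      _ = ∑ x ∈ X, M * ∑ x' ∈ X, a ^ #(S x ∩ S x') :=
          sum_congr rfl fun x _ => (mul_sum _ _ _).symm
      _ ≤ ∑ x ∈ X, M * (2 * #X) := by
          refine sum_le_sum fun x hx => ?_
          have := hinner x hx
          gcongr
      _ = 2 * #X ^ 2 * M := by rw [sum_const, nsmul_eq_mul]; ring
  have hZG : ∑ h, Z h = ∑ h ∈ G, Z h := by
    symm
    refine sum_subset (subset_univ _) fun h _ hh => ?_
    simp only [Z]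
    refine sum_eq_zero fun x hx => if_neg fun hx' => hh ?_
    simp only [hG, mem_filter, mem_univ, true_and]
    exact ⟨x, hx, hx'⟩
  have hCS : (∑ h ∈ G, Z h) ^ 2 ≤ #G * ∑ h ∈ G, Z h ^ 2 := sq_sum_le_card_mul_sum_sq
  have hle : ∑ h ∈ G, Z h ^ 2 ≤ ∑ h, Z h ^ 2 :=
    sum_le_sum_of_subset_of_nonneg (subset_univ _) fun _ _ _ => sq_nonneg _
  rw [← hZG, hZ1] at hCS
  have hX0 : (0 : ℝ) < #X := by exact_mod_cast hX.card_pos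
  have hfin : (#X : ℝ) ^ 2 * M * M ≤ (#X : ℝ) ^ 2 * M * (2 * #G) := by
    calc (#X : ℝ) ^ 2 * M * M = (#X * M) ^ 2 := by ring
      _ ≤ #G * ∑ h ∈ G, Z h ^ 2 := hCS
      _ ≤ #G * (2 * #X ^ 2 * M) := by gcongr; exact hle.trans hZ2
      _ = _ := by ring
  have hM0 : 0 ≤ M := by positivity
  have hcard : ((Fintype.card (Q → A) : ℕ) : ℝ) = M := by
    rw [Fintype.card_fun, hM, ha]; push_cast; rfl
  rcases hM0.eq_or_lt with hM1 | hM1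
  · have : ((Fintype.card (Q → A) : ℕ) : ℝ) = 0 := by rw [hcard, ← hM1]
    have : Fintype.card (Q → A) = 0 := by exact_mod_cast this
    omega
  · have h1 : M ≤ 2 * #G := le_of_mul_le_mul_left hfin (by positivity)
    rw [← hcard] at h1
    exact_mod_cast h1

end Counting

section Lifting

open Finset

/-- Fixing the coordinates of any `J` disjoint from `I` cuts `X` down by a factor `κ ^ #J`. -/
def Spread {V C : Type} [Fintype V] [DecidableEq V] [DecidableEq C] (κ : ℕ) (X : Finset (V → C))
    (I : Finset V) : Prop :=
  ∀ J : Finset V, Disjoint J I → ∀ a : V → C,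
    #{x ∈ X | ∀ u ∈ J, x u = a u} * κ ^ #J ≤ #X

lemma card_le_two_mul_card_avoiding {V C : Type} [Fintype V] [DecidableEq V] [DecidableEq C] {k : ℕ}
    (hk : 0 < k) {X : Finset (V → C)} {I : Finset V} (hX : Spread (2 * k) X I)
    (J : (V → C) → Finset V) (hJ : ∀ x ∈ X, Disjoint (J x) I) (F : Finset (V × C))
    (hF : #F ≤ k) : #X ≤ 2 * #{x ∈ X | ∀ u ∈ J x, (u, x u) ∉ F} := by
  have h1 : ({x ∈ X | ¬ ∀ u ∈ J x, (u, x u) ∉ F} : Finset (V → C)) ⊆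
      {e ∈ F | e.1 ∉ I}.biUnion fun e => {x ∈ X | x e.1 = e.2} := by
    intro x hx
    simp only [mem_filter, not_forall, not_not, mem_biUnion] at hx ⊢
    obtain ⟨hxX, u, hu, huF⟩ := hx
    exact ⟨(u, x u), ⟨huF, disjoint_left.1 (hJ x hxX) hu⟩, hxX, rfl⟩
  have h2 : ∀ e ∈ F, e.1 ∉ I → #{x ∈ X | x e.1 = e.2} * (2 * k) ≤ #X := by
    intro e _ he
    have := hX {e.1} (by simpa using he) (fun _ => e.2)
    simpa using this
  have h3 : #{x ∈ X | ¬ ∀ u ∈ J x, (u, x u) ∉ F} * (2 * k) ≤ k * #X := by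
    calc #{x ∈ X | ¬ ∀ u ∈ J x, (u, x u) ∉ F} * (2 * k)
        ≤ (∑ e ∈ F with e.1 ∉ I, #{x ∈ X | x e.1 = e.2}) * (2 * k) := by
          gcongr
          exact (card_le_card h1).trans card_biUnion_le
      _ = ∑ e ∈ F with e.1 ∉ I, #{x ∈ X | x e.1 = e.2} * (2 * k) := sum_mul _ _ _
      _ ≤ ∑ e ∈ F with e.1 ∉ I, #X := sum_le_sum fun e he => by
          rw [mem_filter] at he; exact h2 e he.1 he.2
      _ = #{e ∈ F | e.1 ∉ I} * #X := by rw [sum_const, smul_eq_mul]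
      _ ≤ k * #X := by gcongr; exact (card_filter_le _ _).trans hF
  have h4 := card_filter_add_card_filter_not (s := X) (fun x => ∀ u ∈ J x, (u, x u) ∉ F)
  have h5 : #{x ∈ X | ¬ ∀ u ∈ J x, (u, x u) ∉ F} * 2 ≤ #X := by
    refine le_of_mul_le_mul_left (a := k) ?_ hk
    linarith
  omega

lemma spread_card_through {V μ β Sg : Type} [Fintype V] [DecidableEq V] [DecidableEq μ]
    [DecidableEq β]
    [DecidableEq Sg] {k : ℕ} {X X' : Finset (V → μ × β)} {I : Finset V}
    (hX : Spread (2 * k) X I) (hsub : X' ⊆ X) (hcard : #X ≤ 2 * #X')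
    (J : (V → μ × β) → Finset V) (hJ : ∀ x ∈ X, Disjoint (J x) I)
    (z : (V → μ × β) → V → Sg) (T : Finset ((V × μ) × (β × Sg))) :
    #{x ∈ X' | T ⊆ (J x).image fun u => ((u, (x u).1), ((x u).2, z x u))} * k ^ #T ≤ #X' := by
  rcases eq_empty_or_nonempty
    ({x ∈ X' | T ⊆ (J x).image fun u => ((u, (x u).1), ((x u).2, z x u))} : Finset _) with h0 | h0
  · rw [h0]; simp
  rcases T.eq_empty_or_nonempty with rfl | hT
  · simp
  obtain ⟨x₀, hx₀⟩ := h0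
  rw [mem_filter] at hx₀
  have hform : ∀ x, T ⊆ (J x).image (fun u => ((u, (x u).1), ((x u).2, z x u))) →
      ∀ e ∈ T, e.1.1 ∈ J x ∧ e = ((e.1.1, (x e.1.1).1), ((x e.1.1).2, z x e.1.1)) := by
    intro x hx e he
    obtain ⟨u, hu, rfl⟩ := mem_image.1 (hx he)
    exact ⟨hu, rfl⟩
  have h1 : #(T.image fun e => e.1.1) = #T := by
    refine card_image_of_injOn fun e he e' he' h => ?_
    rw [(hform x₀ hx₀.2 e he).2, (hform x₀ hx₀.2 e' he').2]
    rw [show e.1.1 = e'.1.1 from h]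
  have h2 : Disjoint (T.image fun e => e.1.1) I := by
    refine disjoint_of_subset_left ?_ (hJ x₀ (hsub hx₀.1))
    intro u hu
    obtain ⟨e, he, rfl⟩ := mem_image.1 hu
    exact (hform x₀ hx₀.2 e he).1
  have h3 := hX _ h2 x₀
  rw [h1] at h3
  have h4 : #{x ∈ X' | T ⊆ (J x).image fun u => ((u, (x u).1), ((x u).2, z x u))} ≤
      #{x ∈ X | ∀ u ∈ T.image (fun e => e.1.1), x u = x₀ u} := by
    refine card_le_card fun x hx => ?_
    rw [mem_filter] at hx ⊢
    refine ⟨hsub hx.1, fun u hu => ?_⟩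
    obtain ⟨e, he, rfl⟩ := mem_image.1 hu
    have e1 := (hform x hx.2 e he).2
    rw [(hform x₀ hx₀.2 e he).2] at e1
    simp only [Prod.mk.injEq, true_and] at e1
    exact Prod.ext e1.1.symm e1.2.1.symm
  have h5 : 2 * k ^ #T ≤ (2 * k) ^ #T := by
    rw [mul_pow]
    gcongr
    exact le_self_pow₀ (by norm_num) hT.card_pos.ne'
  refine le_of_mul_le_mul_left (a := 2) ?_ two_pos
  calc 2 * (#{x ∈ X' | T ⊆ (J x).image fun u => ((u, (x u).1), ((x u).2, z x u))} * k ^ #T)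
      = #{x ∈ X' | T ⊆ (J x).image fun u => ((u, (x u).1), ((x u).2, z x u))} * (2 * k ^ #T) := by
        ring
    _ ≤ #{x ∈ X | ∀ u ∈ T.image (fun e => e.1.1), x u = x₀ u} * (2 * k) ^ #T := by gcongr
    _ ≤ #X := h3
    _ ≤ 2 * #X' := hcard

/-- A finite family of tables such that every spread set of pointer vectors meets any prescribed
answers except on a `2 ^ (-t)` fraction of the tables. -/
theorem exists_hitting_tables (V μ β Sg : Type) [Fintype V] [Fintype μ] [Fintype β] [Fintype Sg]
    [DecidableEq V] [DecidableEq μ] [DecidableEq β] [DecidableEq Sg] [Nonempty Sg] [Nonempty β]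
    (k : ℕ) (hk : 2 * Fintype.card V * (Fintype.card β * Fintype.card Sg) ≤ k) (hk0 : 0 < k)
    (t : ℕ) :
    ∃ (Ω : Type) (_ : Fintype Ω) (_ : Nonempty Ω) (y : Ω → V → μ × β → Sg),
      ∀ (F : Finset (V × (μ × β))), #F + t * (Fintype.card V * Fintype.card μ) ≤ k →
      ∀ (X : Finset (V → μ × β)) (I : Finset V), X.Nonempty → Spread (2 * k) X I →
      ∀ (J : (V → μ × β) → Finset V), (∀ x ∈ X, Disjoint (J x) I) →
      ∀ z : (V → μ × β) → V → Sg,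
        #{ω | ∀ x ∈ X, (∀ u ∈ J x, (u, x u) ∉ F) → ¬ ∀ u ∈ J x, y ω u (x u) = z x u} * 2 ^ t
          ≤ Fintype.card Ω := by
  induction t with
  | zero =>
    refine ⟨Unit, inferInstance, inferInstance, fun _ _ _ => Classical.arbitrary Sg, ?_⟩
    intro F _ X I _ _ J _ z
    rw [pow_zero, mul_one]
    exact card_le_univ _
  | succ t ih =>
    obtain ⟨Ω, iF, iN, y, hy⟩ := ih
    refine ⟨(V × μ → β × Sg) × Ω, inferInstance, inferInstance, fun p u c =>
      if (p.1 (u, c.1)).1 = c.2 then (p.1 (u, c.1)).2 else y p.2 u c, ?_⟩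
    intro F hF X I hX hS J hJ z
    have hcard := card_le_two_mul_card_avoiding hk0 hS J hJ F (le_trans (Nat.le_add_right _ _) hF)
    set X' : Finset (V → μ × β) := {x ∈ X | ∀ u ∈ J x, (u, x u) ∉ F} with hX'
    have hsub : X' ⊆ X := filter_subset _ _
    have hX'ne : X'.Nonempty := by
      rw [← card_pos]; have := hX.card_pos; omega
    have hhalf := half_le_card_exists_through X' hX'ne
      (fun x => (J x).image fun u => ((u, (x u).1), ((x u).2, z x u)))
      (by
        intro x _ e he e' he' h
        simp only [mem_image] at he he'
        obtain ⟨u, _, rfl⟩ := he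
        obtain ⟨u', _, rfl⟩ := he'
        simp only [Prod.mk.injEq] at h
        rw [h.1])
      (Fintype.card V) k (fun x _ => card_image_le.trans (card_le_univ _)) hk0
      (by rw [Fintype.card_prod]; exact hk)
      (spread_card_through hS hsub hcard J hJ z)
    set G : Finset (V × μ → β × Sg) := {h | ∃ x ∈ X', ∀ e ∈
      (J x).image (fun u => ((u, (x u).1), ((x u).2, z x u))), h e.1 = e.2} with hG
    have hfib : ∀ h : V × μ → β × Sg, #{ω : Ω | ∀ x ∈ X, (∀ u ∈ J x, (u, x u) ∉ F) →
        ¬ ∀ u ∈ J x, (if (h (u, (x u).1)).1 = (x u).2 then (h (u, (x u).1)).2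
          else y ω u (x u)) = z x u} * 2 ^ t ≤ if h ∈ G then 0 else Fintype.card Ω := by
      intro h
      split_ifs with hh
      · rw [hG, mem_filter] at hh
        obtain ⟨-, x, hx, hxh⟩ := hh
        rw [hX', mem_filter] at hx
        rw [filter_eq_empty_iff.2, card_empty, zero_mul]
        intro ω _ hω
        refine hω x hx.1 hx.2 fun u hu => ?_
        have := hxh _ (mem_image_of_mem _ hu)
        simp only at this
        rw [this]
        simp
      · refine le_trans (Nat.mul_le_mul_right _ (card_le_card ?_))
          (hy (F ∪ univ.image fun q : V × μ => (q.1, (q.2, (h q).1))) ?_ X I hX hS J hJ z)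
        · intro ω hω
          rw [mem_filter] at hω ⊢
          refine ⟨mem_univ _, fun x hx hxF hxz => hω.2 x hx ?_ ?_⟩
          · intro u hu h'; exact hxF u hu (mem_union_left _ h')
          · intro u hu
            rw [if_neg, hxz u hu]
            intro heq
            refine hxF u hu (mem_union_right _ (mem_image.2 ⟨(u, (x u).1), mem_univ _, ?_⟩))
            rw [heq]
        · have h1 := card_union_le F (univ.image fun q : V × μ => (q.1, (q.2, (h q).1)))
          have h2 : #(univ.image fun q : V × μ => (q.1, (q.2, (h q).1))) ≤
              Fintype.card V * Fintype.card μ := by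
            refine card_image_le.trans ?_
            rw [card_univ, Fintype.card_prod]
          rw [Nat.succ_mul] at hF
          omega
    have hsplit : #{p : (V × μ → β × Sg) × Ω | ∀ x ∈ X, (∀ u ∈ J x, (u, x u) ∉ F) →
        ¬ ∀ u ∈ J x, (if (p.1 (u, (x u).1)).1 = (x u).2 then (p.1 (u, (x u).1)).2
          else y p.2 u (x u)) = z x u} = ∑ h : V × μ → β × Sg,
        #{ω : Ω | ∀ x ∈ X, (∀ u ∈ J x, (u, x u) ∉ F) →
        ¬ ∀ u ∈ J x, (if (h (u, (x u).1)).1 = (x u).2 then (h (u, (x u).1)).2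
          else y ω u (x u)) = z x u} := by
      simp only [card_filter]
      rw [← univ_product_univ, sum_product]
    have hsum : ∑ h : V × μ → β × Sg, (if h ∈ G then 0 else Fintype.card Ω)
        = (Fintype.card (V × μ → β × Sg) - #G) * Fintype.card Ω := by
      rw [← card_compl, sum_ite]
      simp only [sum_const_zero, zero_add, sum_const, smul_eq_mul]
      congr 2
      ext; simp
    rw [hsplit, pow_succ, ← mul_assoc, sum_mul]
    calc _ ≤ (∑ h : V × μ → β × Sg, (if h ∈ G then 0 else Fintype.card Ω)) * 2 :=
          Nat.mul_le_mul_right _ (sum_le_sum fun h _ => hfib h)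
      _ = ((Fintype.card (V × μ → β × Sg) - #G) * 2) * Fintype.card Ω := by rw [hsum]; ring
      _ ≤ Fintype.card (V × μ → β × Sg) * Fintype.card Ω := by
          gcongr; omega
      _ = _ := (Fintype.card_prod _ _).symm

/-- Every large set of tables is hit by every set of pointer vectors that is spread outside `I`
and consistent with it on `I`. -/
def Hits {V C Sg Ω : Type} [Fintype V] [DecidableEq V] [DecidableEq C] [Fintype Ω]
    (κ t : ℕ) (y : Ω → V → C → Sg) : Prop :=
  ∀ (X : Finset (V → C)) (I : Finset V) (a : V → C) (z : V → Sg) (Y : Finset Ω),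
    X.Nonempty → Spread κ X I → (∀ x ∈ X, ∀ u ∈ I, x u = a u) →
    (∀ ω ∈ Y, ∀ u ∈ I, y ω u (a u) = z u) → Fintype.card Ω < #Y * 2 ^ t →
    ∀ (J : (V → C) → Finset V) (z' : (V → C) → V → Sg), (∀ x ∈ X, ∀ u ∈ I, z' x u = z u) →
      ∃ x ∈ X, ∃ ω ∈ Y, ∀ u ∈ I ∪ J x, y ω u (x u) = z' x u

theorem exists_hits (V μ β Sg : Type) [Fintype V] [Fintype μ] [Fintype β] [Fintype Sg]
    [DecidableEq V] [DecidableEq μ] [DecidableEq β] [DecidableEq Sg] [Nonempty Sg] [Nonempty β]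
    (k : ℕ) (hk : 2 * Fintype.card V * (Fintype.card β * Fintype.card Sg) ≤ k) (hk0 : 0 < k)
    (t : ℕ) (ht : t * (Fintype.card V * Fintype.card μ) ≤ k) :
    ∃ (Ω : Type) (_ : Fintype Ω) (_ : Nonempty Ω) (y : Ω → V → μ × β → Sg),
      Hits (2 * k) t y := by
  obtain ⟨Ω, iF, iN, y, hy⟩ := exists_hitting_tables V μ β Sg k hk hk0 t
  refine ⟨Ω, iF, iN, y, ?_⟩
  intro X I a z Y hX hS hXa hYz hcard J z' hz'
  by_contra hcon
  push Not at hcon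
  have h1 := hy ∅ (by simpa using ht) X I hX hS (fun x => J x \ I)
    (fun x _ => sdiff_disjoint) z'
  refine absurd (lt_of_lt_of_le hcard (Nat.mul_le_mul_right (2 ^ t)
    (card_le_card (t := ({ω | ∀ x ∈ X, (∀ u ∈ J x \ I, (u, x u) ∉ (∅ : Finset (V × (μ × β)))) →
      ¬ ∀ u ∈ J x \ I, y ω u (x u) = z' x u} : Finset Ω)) ?_))) (not_lt.2 h1)
  intro ω hω
  rw [mem_filter]
  refine ⟨mem_univ _, fun x hx _ hall => ?_⟩
  obtain ⟨u, hu, hne⟩ := hcon x hx ω hω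
  by_cases huI : u ∈ I
  · exact hne (by rw [hXa x hx u huI, hYz ω hω u huI, hz' x hx u huI])
  · rcases mem_union.1 hu with h | h
    · exact huI h
    · exact hne (hall u (mem_sdiff.2 ⟨h, huI⟩))

end Lifting

section Errors

open Finset

variable {V C : Type} [Fintype V] [DecidableEq V] [Fintype C] [DecidableEq C]

lemma card_fixed_mul_le (Z : Finset (V → C)) (I : Finset V) (a : V → C) :
    #{x ∈ Z | ∀ u ∈ I, x u = a u} * Fintype.card C ^ #I
      ≤ Fintype.card C ^ Fintype.card V := by
  have h1 := card_through_mul_le (I.image fun u => (u, a u))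
  rw [card_image_of_injective _ fun u v h => (Prod.mk.inj h).1] at h1
  refine le_trans (Nat.mul_le_mul_right _ (card_le_card ?_)) h1
  intro x hx
  simp only [mem_filter, mem_univ, true_and, mem_image, forall_exists_index, and_imp,
    forall_apply_eq_imp_iff₂] at hx ⊢
  exact hx.2

open scoped Classical in
/-- The members of `X` that lie in no subset of `X` which is fixed on at most `w` coordinates and
spread on the others. -/
noncomputable def unstructured (κ w : ℕ) (X : Finset (V → C)) : Finset (V → C) :=
  {x ∈ X | ¬ ∃ X' ⊆ X, x ∈ X' ∧ ∃ I : Finset V, #I ≤ w ∧ Spread κ X' I ∧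
    ∀ x' ∈ X', ∀ u ∈ I, x' u = x u}

lemma mem_unstructured {κ w : ℕ} {X : Finset (V → C)} {x : V → C} :
    x ∈ unstructured κ w X ↔ x ∈ X ∧ ¬ ∃ X' ⊆ X, x ∈ X' ∧ ∃ I : Finset V, #I ≤ w ∧
      Spread κ X' I ∧ ∀ x' ∈ X', ∀ u ∈ I, x' u = x u := by
  simp only [unstructured, mem_filter]

theorem card_unstructured_mul_le {κ : ℕ} (hκ : 0 < κ) (hC : 4 * κ ≤ Fintype.card C) (w : ℕ)
    (X : Finset (V → C)) :
    #(unstructured κ w X) * 4 ^ (w + 1) ≤ Fintype.card C ^ Fintype.card V := by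
  set Z := unstructured κ w X with hZ
  rcases Z.eq_empty_or_nonempty with h0 | h0
  · rw [h0]; simp
  have hZX : Z ⊆ X := by
    intro x hx; rw [hZ, mem_unstructured] at hx; exact hx.1
  obtain ⟨x₀, -⟩ := id h0
  obtain ⟨⟨I, a⟩, -, hmax⟩ := exists_max_image (univ : Finset (Finset V × (V → C)))
    (fun p => κ ^ #p.1 * #{x ∈ Z | ∀ u ∈ p.1, x u = p.2 u}) ⟨(∅, x₀), mem_univ _⟩
  simp only [mem_univ, forall_const, Prod.forall] at hmax
  have hZle : #Z ≤ κ ^ #I * #{x ∈ Z | ∀ u ∈ I, x u = a u} := by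
    have := hmax ∅ x₀
    simpa using this
  have hspread : Spread κ {x ∈ Z | ∀ u ∈ I, x u = a u} I := by
    intro J hJ a'
    have h1 := hmax (I ∪ J) (fun u => if u ∈ I then a u else a' u)
    rw [card_union_of_disjoint hJ.symm, pow_add, mul_assoc] at h1
    have h2 := le_of_mul_le_mul_left h1 (pow_pos hκ _)
    rw [mul_comm] at h2
    refine le_trans (Nat.mul_le_mul_right _ (card_le_card ?_)) h2
    intro x hx
    simp only [mem_filter, mem_union] at hx ⊢
    refine ⟨hx.1.1, fun u hu => ?_⟩
    split_ifs with h
    · exact hx.1.2 u h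
    · exact hx.2 u (hu.resolve_left h)
  have hlt : w < #I := by
    by_contra hle
    push Not at hle
    have hpos : 0 < #{x ∈ Z | ∀ u ∈ I, x u = a u} := by
      refine Nat.pos_of_ne_zero fun h => ?_
      rw [h, mul_zero] at hZle
      have := h0.card_pos
      omega
    obtain ⟨x, hx⟩ := card_pos.1 hpos
    have hxZ := (mem_filter.1 hx).1
    have hxa := (mem_filter.1 hx).2
    rw [hZ, mem_unstructured] at hxZ
    refine hxZ.2 ⟨_, (filter_subset _ _).trans hZX, hx, I, hle, hspread, ?_⟩
    intro x' hx' u hu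
    rw [(mem_filter.1 hx').2 u hu, hxa u hu]
  refine le_of_mul_le_mul_left (a := κ ^ #I) ?_ (pow_pos hκ _)
  calc κ ^ #I * (#Z * 4 ^ (w + 1)) ≤ κ ^ #I * (#Z * 4 ^ #I) := by
        gcongr
        · norm_num
        · exact hlt
    _ = #Z * (4 * κ) ^ #I := by rw [mul_pow]; ring
    _ ≤ (κ ^ #I * #{x ∈ Z | ∀ u ∈ I, x u = a u}) * Fintype.card C ^ #I := by gcongr
    _ = κ ^ #I * (#{x ∈ Z | ∀ u ∈ I, x u = a u} * Fintype.card C ^ #I) := by ring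
    _ ≤ _ := by gcongr; exact card_fixed_mul_le Z I a

lemma card_filter_card_le_succ_pow {E : Type} [Fintype E] [DecidableEq E] (w : ℕ) :
    #{S : Finset E | #S ≤ w} ≤ (Fintype.card E + 1) ^ w := by
  induction w with
  | zero => simp [card_eq_zero, filter_eq']
  | succ w ih =>
    have hsub : ({S : Finset E | #S ≤ w + 1} : Finset (Finset E)) ⊆
        (({S : Finset E | #S ≤ w} : Finset (Finset E)) ×ˢ (univ : Finset (Option E))).image
          (fun p => p.2.elim p.1 fun e => insert e p.1) := by
      intro S hS
      simp only [mem_filter, mem_univ, true_and, mem_image, mem_product, and_true,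
        Prod.exists] at hS ⊢
      rcases S.eq_empty_or_nonempty with rfl | ⟨e, he⟩
      · exact ⟨∅, none, by simp, rfl⟩
      · refine ⟨S.erase e, some e, ?_, insert_erase he⟩
        rw [card_erase_of_mem he]; omega
    refine (card_le_card hsub).trans (card_image_le.trans ?_)
    rw [card_product, card_univ, Fintype.card_option, pow_succ]
    gcongr

end Errors

section LowerBound

open Finset

/-- Accumulated errors of a sequence of sets: each set loses the errors made so far, and then
contributes its own. -/
def accumulated {α : Type} [DecidableEq α] (err : Finset α → Finset α) (A : ℕ → Finset α) :
    ℕ → Finset α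
  | 0 => ∅
  | i + 1 => accumulated err A i ∪ err (A i \ accumulated err A i)

lemma accumulated_mono {α : Type} [DecidableEq α] (err : Finset α → Finset α)
    (A : ℕ → Finset α) : Monotone (accumulated err A) :=
  monotone_nat_of_le_succ fun _ => subset_union_left

lemma card_accumulated_mul_le {α : Type} [DecidableEq α] (err : Finset α → Finset α)
    (A : ℕ → Finset α) (q M : ℕ) (h : ∀ X, #(err X) * q ≤ M) (i : ℕ) :
    #(accumulated err A i) * q ≤ i * M := by
  induction i with
  | zero => simp [accumulated]
  | succ i ih =>
    calc #(accumulated err A (i + 1)) * q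
        ≤ (#(accumulated err A i) + #(err (A i \ accumulated err A i))) * q := by
          gcongr; exact card_union_le _ _
      _ = #(accumulated err A i) * q + #(err (A i \ accumulated err A i)) * q := by ring
      _ ≤ i * M + M := by gcongr; exact h _
      _ = _ := by ring

/-- A strategy for answering queries that remembers fewer than `q` answers and reveals no
violation during `R` rounds. -/
structure Adversary {V Sg : Type} [DecidableEq V] (Viol : V × Sg → V × Sg → V × Sg → Prop)
    (q R : ℕ) where
  P : ℕ → Finset V → (V → Sg) → Prop
  init : ∃ z, P 0 ∅ z
  mono : ∀ {r r' D D' z}, P r D z → D' ⊆ D → r ≤ r' → P r' D' z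
  step : ∀ {r D z u}, P r D z → #D < q → r < R → u ∉ D →
    ∃ σ, P (r + 1) (insert u D) (Function.update z u σ)
  noViol : ∀ {r D z}, P r D z → r ≤ R → ∀ u ∈ D, ∀ v ∈ D, ∀ w ∈ D,
    ¬ Viol (u, z u) (v, z v) (w, z w)

lemma Adversary.extend {V Sg : Type} [DecidableEq V] {Viol : V × Sg → V × Sg → V × Sg → Prop}
    {q R : ℕ} (S : Adversary Viol q R) {D : Finset V} (J : Finset V) :
    ∀ {r : ℕ} {z : V → Sg}, S.P r D z → #D + #J ≤ q → r + #J ≤ R →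
    ∃ z', (∀ u ∈ D, z' u = z u) ∧ S.P (r + #J) (D ∪ J) z' := by
  induction J using Finset.induction_on with
  | empty =>
    intro r z hP _ _
    exact ⟨z, fun _ _ => rfl, by simpa using hP⟩
  | insert u J hu ih =>
    intro r z hP hq hR
    rw [card_insert_of_notMem hu] at hq hR
    obtain ⟨z', hz', hP'⟩ := ih hP (by omega) (by omega)
    rw [card_insert_of_notMem hu]
    by_cases huD : u ∈ D
    · refine ⟨z', hz', S.mono hP' ?_ (by omega)⟩
      rw [union_insert, insert_eq_self.2 (mem_union_left _ huD)]
    · have hu' : u ∉ D ∪ J := by simp [huD, hu]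
      obtain ⟨σ, hσ⟩ := S.step hP' (by have := card_union_le D J; omega) (by omega) hu'
      refine ⟨Function.update z' u σ, fun v hv => ?_, ?_⟩
      · rw [Function.update_of_ne (by rintro rfl; exact huD hv), hz' v hv]
      · rw [union_insert, ← add_assoc]
        exact hσ

lemma Adversary.exists_common {V C Sg Ω : Type} [Fintype V] [DecidableEq V]
    [DecidableEq C] [Fintype Ω] {Viol : V × Sg → V × Sg → V × Sg → Prop}
    {w R κ t : ℕ} (S : Adversary Viol (3 * w) R) {y : Ω → V → C → Sg} (hy : Hits κ t y)
    {X : Finset (V → C)} {I : Finset V} {a : V → C} {z : V → Sg} {Y : Finset Ω} {r : ℕ}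
    (hX : X.Nonempty) (hsp : Spread κ X I) (hXa : ∀ x ∈ X, ∀ u ∈ I, x u = a u) (hI : #I ≤ w)
    (hYz : ∀ ω ∈ Y, ∀ u ∈ I, y ω u (a u) = z u) (hY : Fintype.card Ω < #Y * 2 ^ t)
    (hP : S.P r I z) (hr : r + 2 * w ≤ R) (J : (V → C) → Finset V) (hJ : ∀ x, #(J x) ≤ 2 * w) :
    ∃ x ∈ X, ∃ ω ∈ Y, ∃ z', S.P (r + 2 * w) (J x) z' ∧ ∀ u ∈ J x, y ω u (x u) = z' u := by
  choose z' hz' hP' using fun x => S.extend (J x) hP (by have := hJ x; omega)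
    (by have := hJ x; omega)
  obtain ⟨x, hx, ω, hω, h⟩ := hy X I a z Y hX hsp hXa hYz hY J z' (fun x _ => hz' x)
  exact ⟨x, hx, ω, hω, z' x, S.mono (hP' x) subset_union_right (by have := hJ x; omega),
    fun u hu => h u (mem_union_right _ hu)⟩

variable {V C Sg : Type} [Fintype V] [DecidableEq V] [Fintype C] [DecidableEq C]
  [Fintype Sg] [DecidableEq Sg]

open scoped Classical in
/-- The true inputs: the bits of the triples selected by a pointer vector. -/
noncomputable def yesInput {n : ℕ} (e : (V × C) × (V × C) × (V × C) ↪ Fin n) (x : V → C) :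
    Fin n → Bool :=
  fun i => decide (∃ u v w, e ((u, x u), (v, x v), (w, x w)) = i)

open scoped Classical in
/-- The false inputs: the bits of the triples that a table does not violate. -/
noncomputable def noInput {n : ℕ} (Viol : V × Sg → V × Sg → V × Sg → Prop)
    (e : (V × C) × (V × C) × (V × C) ↪ Fin n) (y : V → C → Sg) : Fin n → Bool :=
  fun i => decide (¬ ∃ p q r, e (p, q, r) = i ∧
    Viol (p.1, y p.1 p.2) (q.1, y q.1 q.2) (r.1, y r.1 r.2))

open scoped Classical in
/-- The tables of `Y` agreeing with some `w` entries that few tables of `Y` agree with. -/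
noncomputable def untypical {Ω : Type} [Fintype Ω] (y : Ω → V → C → Sg) (w t : ℕ)
    (Y : Finset Ω) : Finset Ω :=
  {S : Finset (V × C × Sg) | #S ≤ w ∧
    #{ω ∈ Y | ∀ e ∈ S, y ω e.1 e.2.1 = e.2.2} * 2 ^ t ≤ Fintype.card Ω}.toFinset.biUnion
      fun S => {ω ∈ Y | ∀ e ∈ S, y ω e.1 e.2.1 = e.2.2}

lemma card_untypical_mul_le {Ω : Type} [Fintype Ω] (y : Ω → V → C → Sg) (w t : ℕ)
    (Y : Finset Ω) :
    #(untypical y w t Y) * 2 ^ t ≤ (Fintype.card (V × C × Sg) + 1) ^ w * Fintype.card Ω := by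
  classical
  refine le_trans (Nat.mul_le_mul_right _ card_biUnion_le) ?_
  rw [sum_mul]
  refine le_trans (sum_le_card_nsmul _ _ (Fintype.card Ω) fun S hS => ?_) ?_
  · rw [Set.mem_toFinset] at hS
    convert hS.2
  · rw [smul_eq_mul]
    gcongr
    refine le_trans (card_le_card ?_) (card_filter_card_le_succ_pow (E := V × C × Sg) w)
    intro S hS
    rw [Set.mem_toFinset] at hS
    rw [mem_filter]
    exact ⟨mem_univ _, hS.1⟩

lemma lt_card_of_notMem_untypical {Ω : Type} [Fintype Ω] {y : Ω → V → C → Sg} {w t : ℕ}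
    {Y : Finset Ω} {ω : Ω} (hω : ω ∈ Y) (h : ω ∉ untypical y w t Y) {I : Finset V}
    (hI : #I ≤ w) {a : V → C} {z : V → Sg} (hz : ∀ u ∈ I, y ω u (a u) = z u) :
    Fintype.card Ω < #{ω ∈ Y | ∀ u ∈ I, y ω u (a u) = z u} * 2 ^ t := by
  classical
  by_contra hle
  refine h (mem_biUnion.2 ⟨I.image fun u => (u, a u, z u), ?_, ?_⟩)
  · rw [Set.mem_toFinset]
    refine ⟨card_image_le.trans hI, ?_⟩
    push Not at hle
    refine le_trans (Nat.mul_le_mul_right _ (card_le_card fun ω' h' => ?_)) hle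
    rw [mem_filter] at h' ⊢
    exact ⟨h'.1, fun u hu => h'.2 _ (mem_image_of_mem _ hu)⟩
  · rw [mem_filter]
    refine ⟨hω, fun e he => ?_⟩
    obtain ⟨u, hu, rfl⟩ := mem_image.1 he
    exact hz u hu

theorem no_small_shallow_circuit {n : ℕ} {Ω : Type} [Fintype Ω] [Nonempty Ω]
    {Viol : V × Sg → V × Sg → V × Sg → Prop} {w R κ t d : ℕ} (S : Adversary Viol (3 * w) R)
    (e : (V × C) × (V × C) × (V × C) ↪ Fin n) {y : Ω → V → C → Sg} (hy : Hits κ t y)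
    (hκ : 2 ≤ κ) (hC : 4 * κ ≤ Fintype.card C) (hR : 2 * w + 2 * w * d ≤ R) (ht : 2 ≤ t)
    {f : (Fin n → Bool) → Bool} (hyes : ∀ x, f (yesInput e x) = true)
    (hno : ∀ y, f (noInput Viol e y) = false) (T : MonCircuit n) (hT : Computes T f)
    (hd : CDepthLE T d) (hs1 : 2 * T.size ≤ 4 ^ (w + 1))
    (hs2 : 2 * (T.size * (Fintype.card (V × C × Sg) + 1) ^ w) ≤ 2 ^ t) : False := by
  classical
  obtain ⟨v, hv, hfv⟩ := hT
  obtain ⟨h, hhd, hh⟩ := hd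
  let A : ℕ → Finset (V → C) := fun i =>
    {x | ∃ j : Fin T.size, (j : ℕ) = i ∧ v j (yesInput e x) = true}
  let B : ℕ → Finset Ω := fun i =>
    {ω | ∃ j : Fin T.size, (j : ℕ) = i ∧ v j (noInput Viol e (y ω)) = false}
  have hA : ∀ (j : Fin T.size) x, x ∈ A j ↔ v j (yesInput e x) = true := by
    intro j x
    simp only [A, mem_filter, mem_univ, true_and]
    exact ⟨fun ⟨k, hk, hx⟩ => by rwa [← Fin.ext hk], fun hx => ⟨j, rfl, hx⟩⟩
  have hB : ∀ (j : Fin T.size) ω, ω ∈ B j ↔ v j (noInput Viol e (y ω)) = false := by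
    intro j x
    simp only [B, mem_filter, mem_univ, true_and]
    exact ⟨fun ⟨k, hk, hx⟩ => by rwa [← Fin.ext hk], fun hx => ⟨j, rfl, hx⟩⟩
  set EX := accumulated (unstructured κ w) A with hEX
  set EY := accumulated (untypical y w t) B with hEY
  have hstr : ∀ (j : Fin T.size) (x : V → C), ∃ (I : Finset V) (X' : Finset (V → C)), #I ≤ w ∧
      (x ∈ A j → x ∉ EX (j + 1) → X' ⊆ A j \ EX j ∧ x ∈ X' ∧ Spread κ X' I ∧
        ∀ x' ∈ X', ∀ u ∈ I, x' u = x u) := by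
    intro j x
    by_cases hx : x ∈ A j ∧ x ∉ EX (j + 1)
    · obtain ⟨h1, h2⟩ := hx
      have h3 : x ∉ EX j := fun h => h2 (accumulated_mono _ _ (Nat.le_succ _) h)
      have h4 : x ∉ unstructured κ w (A j \ EX j) := fun h => h2 (mem_union_right _ h)
      rw [mem_unstructured] at h4
      push Not at h4
      have h5 := h4 (mem_sdiff.2 ⟨h1, h3⟩)
      obtain ⟨X', hX', hx', I, hI, hsp, hfix⟩ := h5
      exact ⟨I, X', hI, fun _ _ => ⟨hX', hx', hsp, hfix⟩⟩
    · exact ⟨∅, ∅, by simp, fun h1 h2 => absurd ⟨h1, h2⟩ hx⟩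
  choose cI cX hcI hcX using hstr
  have hstep : ∀ (m : ℕ) (j k : Fin T.size), (j : ℕ) < m → (k : ℕ) < m →
      ∀ (X : Finset (V → C)) (I : Finset V) (a : V → C) (z : V → Sg) (Y : Finset Ω) (r : ℕ),
      X.Nonempty → Spread κ X I → (∀ x ∈ X, ∀ u ∈ I, x u = a u) → #I ≤ w →
      (∀ ω ∈ Y, ∀ u ∈ I, y ω u (a u) = z u) → Fintype.card Ω < #Y * 2 ^ t → S.P r I z →
      r + 2 * w ≤ R → (∀ x ∈ X, x ∉ EX m) → (∀ ω ∈ Y, ω ∉ EY m) →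
      (∀ x ∈ X, ∀ ω ∈ Y, (x ∈ A j ∧ ω ∈ B j) ∨ (x ∈ A k ∧ ω ∈ B k)) →
      ∃ c : Fin T.size, (c = j ∨ c = k) ∧ ∃ (X' : Finset (V → C)) (I' : Finset V) (a' : V → C)
        (z' : V → Sg), X' ⊆ A c \ EX c ∧ X'.Nonempty ∧ Spread κ X' I' ∧
        (∀ x ∈ X', ∀ u ∈ I', x u = a' u) ∧ #I' ≤ w ∧ S.P (r + 2 * w) I' z' ∧
        Fintype.card Ω < #{ω ∈ B c \ EY c | ∀ u ∈ I', y ω u (a' u) = z' u} * 2 ^ t := by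
    intro m j k hj hk X I a z Y r hXne hsp hXa hI hYz hY hP hr hXE hYE hcross
    obtain ⟨x, hx, ω, hω, z', hP', hz'⟩ := S.exists_common hy hXne hsp hXa hI hYz hY hP hr
      (fun x => cI j x ∪ cI k x) (fun x => by
        have h1 := card_union_le (cI j x) (cI k x)
        have h2 := hcI j x
        have h3 := hcI k x
        omega)
    have key : ∀ c : Fin T.size, (c = j ∨ c = k) → (c : ℕ) < m → x ∈ A c → ω ∈ B c →
        cI c x ⊆ cI j x ∪ cI k x → ∃ c : Fin T.size, (c = j ∨ c = k) ∧
        ∃ (X' : Finset (V → C)) (I' : Finset V) (a' : V → C)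
        (z' : V → Sg), X' ⊆ A c \ EX c ∧ X'.Nonempty ∧ Spread κ X' I' ∧
        (∀ x ∈ X', ∀ u ∈ I', x u = a' u) ∧ #I' ≤ w ∧ S.P (r + 2 * w) I' z' ∧
        Fintype.card Ω < #{ω ∈ B c \ EY c | ∀ u ∈ I', y ω u (a' u) = z' u} * 2 ^ t := by
      intro c hc hcm hxc hωc hsub
      have hx1 : x ∉ EX (c + 1) := fun h' => hXE x hx (accumulated_mono _ _ hcm h')
      have hω1 : ω ∉ EY (c + 1) := fun h' => hYE ω hω (accumulated_mono _ _ hcm h')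
      have hω2 : ω ∉ EY c := fun h' => hω1 (accumulated_mono _ _ (Nat.le_succ _) h')
      obtain ⟨g1, g2, g3, g4⟩ := hcX c x hxc hx1
      exact ⟨c, hc, cX c x, cI c x, x, z', g1, ⟨x, g2⟩, g3, g4, hcI c x,
        S.mono hP' hsub le_rfl, lt_card_of_notMem_untypical (mem_sdiff.2 ⟨hωc, hω2⟩)
        (fun h' => hω1 (mem_union_right _ h')) (hcI c x) fun u hu => hz' u (hsub hu)⟩
    rcases hcross x hx ω hω with ⟨h1, h2⟩ | ⟨h1, h2⟩
    · exact key j (Or.inl rfl) hj h1 h2 subset_union_left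
    · exact key k (Or.inr rfl) hk h1 h2 subset_union_right
  have hmain : ∀ (i : ℕ) (i' : Fin T.size), (i' : ℕ) = i →
      ∀ (X : Finset (V → C)) (I : Finset V) (a : V → C) (z : V → Sg) (r : ℕ),
      X ⊆ A i' \ EX i' → X.Nonempty → Spread κ X I → (∀ x ∈ X, ∀ u ∈ I, x u = a u) →
      #I ≤ w → S.P r I z →
      Fintype.card Ω < #{ω ∈ B i' \ EY i' | ∀ u ∈ I, y ω u (a u) = z u} * 2 ^ t →
      r + 2 * w * h i' ≤ R → False := by
    intro i
    induction i using Nat.strong_induction_on with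
    | _ i ih =>
    rintro i' rfl X I a z r hXsub hXne hsp hXa hI hP hY hr
    have hcomp : ∀ j k : Fin T.size, j < i' → k < i' → h j < h i' → h k < h i' →
        (∀ x ∈ A i', ∀ ω ∈ B i', (x ∈ A j ∧ ω ∈ B j) ∨ (x ∈ A k ∧ ω ∈ B k)) → False := by
      intro j k hj hk hhj hhk hcross
      have hr2 : ∀ c : Fin T.size, h c < h i' → r + 2 * w + 2 * w * h c ≤ R := by
        intro c hc
        have : 2 * w * (h c + 1) ≤ 2 * w * h i' := Nat.mul_le_mul_left _ hc
        rw [mul_add, mul_one] at this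
        omega
      obtain ⟨c, hc, X', I', a', z', g1, g2, g3, g4, g5, g6, g7⟩ := hstep i' j k hj hk X I a z _ r
        hXne hsp hXa hI (fun ω hω => (mem_filter.1 hω).2) hY hP
        (by have := hr2 j hhj; omega)
        (fun x hx => (mem_sdiff.1 (hXsub hx)).2)
        (fun ω hω => (mem_sdiff.1 (mem_filter.1 hω).1).2)
        (fun x hx ω hω => hcross x (mem_sdiff.1 (hXsub hx)).1 ω
          (mem_sdiff.1 (mem_filter.1 hω).1).1)
      have hci : c < i' := by rcases hc with rfl | rfl <;> assumption
      have hhc : h c < h i' := by rcases hc with rfl | rfl <;> assumption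
      exact ih c hci c rfl X' I' a' z' _ g1 g2 g3 g4 g5 g6 g7 (hr2 c hhc)
    have hYne : ({ω ∈ B i' \ EY i' | ∀ u ∈ I, y ω u (a u) = z u} : Finset Ω).Nonempty := by
      rw [← card_pos]
      refine Nat.pos_of_ne_zero fun h0 => ?_
      rw [h0, zero_mul] at hY
      omega
    obtain ⟨x, hx⟩ := id hXne
    obtain ⟨ω, hω⟩ := hYne
    have hxA := (mem_sdiff.1 (hXsub hx)).1
    have hωB := (mem_sdiff.1 (mem_filter.1 hω).1).1
    have hwf := T.wf i'
    have hhi := hh i'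
    have hvi := hv i'
    cases hg : T.gate i' with
    | inp b =>
      rw [hg] at hvi
      simp only at hvi
      have hA' : ∀ x ∈ X, yesInput e x b = true := fun x hx => by
        have := (hA i' x).1 (mem_sdiff.1 (hXsub hx)).1
        rwa [hvi] at this
      have hx' := hA' x hx
      have hω' := (hB i' ω).1 hωB
      rw [hvi] at hω'
      simp only [noInput, decide_eq_false_iff_not, not_not] at hω'
      obtain ⟨p, q, r', hb, hviol⟩ := hω'
      have hfix : ∀ x ∈ X, x p.1 = p.2 ∧ x q.1 = q.2 ∧ x r'.1 = r'.2 := by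
        intro x hx
        have h1 := hA' x hx
        simp only [yesInput, decide_eq_true_eq] at h1
        obtain ⟨u1, u2, u3, hu⟩ := h1
        rw [← hb] at hu
        have h2 := e.injective hu
        simp only [Prod.mk.injEq] at h2
        obtain ⟨rfl, rfl, rfl⟩ := h2
        exact ⟨rfl, rfl, rfl⟩
      have hmem : ∀ p : V × C, (∀ x ∈ X, x p.1 = p.2) → p.1 ∈ I ∧ a p.1 = p.2 := by
        intro p hp
        have h1 : p.1 ∈ I := by
          by_contra hpI
          have h2 := hsp {p.1} (by simpa using hpI) (fun _ => p.2)
          rw [filter_true_of_mem (by simpa using hp)] at h2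
          rw [card_singleton, pow_one] at h2
          have h3 := hXne.card_pos
          have h4 : #X * 2 ≤ #X * κ := Nat.mul_le_mul_left _ hκ
          omega
        exact ⟨h1, by rw [← hXa x hx _ h1, hp x hx]⟩
      obtain ⟨p1, p2⟩ := hmem p fun x hx => (hfix x hx).1
      obtain ⟨q1, q2⟩ := hmem q fun x hx => (hfix x hx).2.1
      obtain ⟨r1, r2⟩ := hmem r' fun x hx => (hfix x hx).2.2
      have hωz := (mem_filter.1 hω).2
      have e1 := hωz _ p1
      have e2 := hωz _ q1
      have e3 := hωz _ r1
      rw [p2] at e1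
      rw [q2] at e2
      rw [r2] at e3
      rw [e1, e2, e3] at hviol
      exact S.noViol hP (le_trans (Nat.le_add_right _ _) hr) _ p1 _ q1 _ r1 hviol
    | const b =>
      rw [hg] at hvi
      simp only at hvi
      have h1 := (hA i' x).1 hxA
      have h2 := (hB i' ω).1 hωB
      rw [hvi] at h1 h2
      rw [h1] at h2
      cases h2
    | and j k =>
      rw [hg] at hvi hwf hhi
      simp only at hvi hwf hhi
      refine hcomp j k hwf.1 hwf.2 hhi.1 hhi.2 fun x hx ω hω => ?_
      rw [hA, hvi, Bool.and_eq_true] at hx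
      rw [hB, hvi, Bool.and_eq_false_iff] at hω
      rw [hA, hA, hB, hB]
      tauto
    | or j k =>
      rw [hg] at hvi hwf hhi
      simp only at hvi hwf hhi
      refine hcomp j k hwf.1 hwf.2 hhi.1 hhi.2 fun x hx ω hω => ?_
      rw [hA, hvi, Bool.or_eq_true] at hx
      rw [hB, hvi, Bool.or_eq_false_iff] at hω
      rw [hA, hA, hB, hB]
      tauto
  have hEXc : 2 * #(EX T.size) ≤ Fintype.card (V → C) := by
    have h1 := card_accumulated_mul_le (unstructured κ w) A (4 ^ (w + 1)) _
      (card_unstructured_mul_le (by omega) hC w) T.size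
    rw [Fintype.card_fun]
    refine le_of_mul_le_mul_left (a := 4 ^ (w + 1)) ?_ (by positivity)
    calc 4 ^ (w + 1) * (2 * #(EX T.size)) = 2 * (#(EX T.size) * 4 ^ (w + 1)) := by ring
      _ ≤ 2 * (T.size * Fintype.card C ^ Fintype.card V) := by gcongr
      _ = (2 * T.size) * Fintype.card C ^ Fintype.card V := by ring
      _ ≤ _ := by gcongr
  have hEYc : 2 * #(EY T.size) ≤ Fintype.card Ω := by
    have h1 := card_accumulated_mul_le (untypical y w t) B (2 ^ t) _
      (card_untypical_mul_le y w t) T.size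
    refine le_of_mul_le_mul_left (a := 2 ^ t) ?_ (by positivity)
    calc 2 ^ t * (2 * #(EY T.size)) = 2 * (#(EY T.size) * 2 ^ t) := by ring
      _ ≤ 2 * (T.size * ((Fintype.card (V × C × Sg) + 1) ^ w * Fintype.card Ω)) := by gcongr
      _ = (2 * (T.size * (Fintype.card (V × C × Sg) + 1) ^ w)) * Fintype.card Ω := by ring
      _ ≤ _ := by gcongr
  have hX0 : #((EX T.size)ᶜ) * 2 ≥ Fintype.card (V → C) := by
    rw [card_compl]; omega
  have hY0 : Fintype.card Ω < #((EY T.size)ᶜ) * 2 ^ t := by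
    have h1 : #((EY T.size)ᶜ) * 2 ≥ Fintype.card Ω := by rw [card_compl]; omega
    have h2 : 0 < Fintype.card Ω := Fintype.card_pos
    have h3 : 2 ^ 2 ≤ 2 ^ t := Nat.pow_le_pow_right two_pos ht
    have h4 : #((EY T.size)ᶜ) * 2 ^ 2 ≤ #((EY T.size)ᶜ) * 2 ^ t := Nat.mul_le_mul_left _ h3
    omega
  have hCne : Nonempty C := Fintype.card_pos_iff.1 (by omega)
  have hX0ne : ((EX T.size)ᶜ).Nonempty := by
    rw [← card_pos]
    have : 0 < Fintype.card (V → C) := Fintype.card_pos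
    omega
  have hX0sp : Spread κ (EX T.size)ᶜ ∅ := by
    intro J _ a
    rcases J.eq_empty_or_nonempty with rfl | hJ
    · simp
    refine le_of_mul_le_mul_left (a := 4 ^ #J) ?_ (by positivity)
    have h1 := card_fixed_mul_le (EX T.size)ᶜ J a
    have h4 : 2 ≤ 4 ^ #J := le_trans (by norm_num) (Nat.pow_le_pow_right (n := 4) (by norm_num)
      hJ.card_pos)
    calc 4 ^ #J * (#{x ∈ (EX T.size)ᶜ | ∀ u ∈ J, x u = a u} * κ ^ #J)
        = #{x ∈ (EX T.size)ᶜ | ∀ u ∈ J, x u = a u} * (4 * κ) ^ #J := by rw [mul_pow]; ring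
      _ ≤ #{x ∈ (EX T.size)ᶜ | ∀ u ∈ J, x u = a u} * Fintype.card C ^ #J := by gcongr
      _ ≤ Fintype.card (V → C) := by rw [Fintype.card_fun]; exact h1
      _ ≤ #(EX T.size)ᶜ * 2 := hX0
      _ ≤ #(EX T.size)ᶜ * 4 ^ #J := by gcongr
      _ = _ := mul_comm _ _
  obtain ⟨z, hz⟩ := S.init
  have hwd : ∀ c, 2 * w * h c ≤ 2 * w * d := fun c => Nat.mul_le_mul_left _ (hhd c)
  obtain ⟨c, -, X', I', a', z', g1, g2, g3, g4, g5, g6, g7⟩ := hstep T.size (outIdx T) (outIdx T)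
    (outIdx T).2 (outIdx T).2 (EX T.size)ᶜ ∅ (fun _ => Classical.arbitrary C) z (EY T.size)ᶜ 0
    hX0ne hX0sp (by simp) (by simp) (by simp) hY0 hz (by omega)
    (fun x hx => mem_compl.1 hx) (fun ω hω => mem_compl.1 hω)
    (fun x _ ω _ => Or.inl ⟨by rw [hA, ← hfv]; exact hyes x, by rw [hB, ← hfv]; exact hno _⟩)
  exact hmain c c rfl X' I' a' z' _ g1 g2 g3 g4 g5 g6 g7 (by have := hwd c; omega)

end LowerBound

section Stack

open Finset

/-- A node has a level, a position and a slot. -/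
abbrev Node (K B s : ℕ) : Type := Fin (K + 1) × Fin (B + 1) × Fin s

/-- A node is either idle, or it points to a parent and to a slot. -/
abbrev Sym_s0 (K B s : ℕ) : Type := Option (Node K B s × Fin s)

variable {K B s : ℕ}

def lev (u : Node K B s) : ℕ := u.1

def pos (u : Node K B s) : ℕ := u.2.1

def slot (u : Node K B s) : Fin s := u.2.2

lemma lev_le (u : Node K B s) : lev u ≤ K := Nat.le_of_lt_succ u.1.2

lemma pos_le (u : Node K B s) : pos u ≤ B := Nat.le_of_lt_succ u.2.1.2

lemma node_ext {u v : Node K B s} (h1 : lev u = lev v) (h2 : pos u = pos v)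
    (h3 : slot u = slot v) : u = v :=
  Prod.ext (Fin.ext h1) (Prod.ext (Fin.ext h2) h3)

lemma exists_node (i j : ℕ) (hi : i ≤ K) (hj : j ≤ B) (σ : Fin s) :
    ∃ u : Node K B s, lev u = i ∧ pos u = j ∧ slot u = σ :=
  ⟨(⟨i, Nat.lt_succ_of_le hi⟩, ⟨j, Nat.lt_succ_of_le hj⟩, σ), rfl, rfl, rfl⟩

def Done (u : Node K B s) : Prop := lev u = 0 ∨ pos u = B

instance (u : Node K B s) : Decidable (Done u) := inferInstanceAs (Decidable (_ ∨ _))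

/-- The node `w` that has to be active when `u` points to the parent `p` and the slot `σ`: the
first child of `u` if `u` is not done, and the successor of `p` otherwise. -/
def Target (u p : Node K B s) (σ : Fin s) (w : Node K B s) : Prop :=
  slot w = σ ∧ ((¬ Done u ∧ lev w + 1 = lev u ∧ pos w = 0) ∨
    (Done u ∧ lev u < K ∧ lev w = lev p ∧ pos w = pos p + 1))

lemma Target.unique {u p : Node K B s} {σ : Fin s} {w w' : Node K B s} (h : Target u p σ w)
    (h' : Target u p σ w') : w = w' := by
  obtain ⟨h1, h2⟩ := h
  obtain ⟨h1', h2'⟩ := h'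
  refine node_ext ?_ ?_ (h1.trans h1'.symm) <;> grind

/-- Local violations of the rules: the root is idle; the last node of the top level is active; the
target of an active node does not point to the right parent. -/
def Viol (f g h : Node K B s × Sym_s0 K B s) : Prop :=
  (lev f.1 = K ∧ pos f.1 = 0 ∧ (slot f.1 : ℕ) = 0 ∧ f.2 = none) ∨
  (lev f.1 = K ∧ pos f.1 = B ∧ f.2 ≠ none) ∨
  (∃ p σ, f.2 = some (p, σ) ∧ ¬ Done f.1 ∧ Target f.1 p σ g.1 ∧
    ∀ σ', g.2 ≠ some (f.1, σ')) ∨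
  (∃ p σ p' σ', f.2 = some (p, σ) ∧ Done f.1 ∧ g = (p, some (p', σ')) ∧ Target f.1 p σ h.1 ∧
    ∀ σ', h.2 ≠ some (p', σ'))

/-- The least delay between the activation of the parent of `u` and that of `u`. -/
def lag (u : Node K B s) : ℕ := if lev u = 0 then 1 else pos u * B ^ (lev u - 1)

/-- A set `H` of active nodes with their parents and activation times up to `r`. -/
structure History (root : Node K B s) (r : ℕ) (H : Finset (Node K B s))
    (par : Node K B s → Node K B s) (β : Node K B s → ℕ) : Prop where
  lev_root : lev root = K
  root_mem : root ∈ H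
  time_le : ∀ u ∈ H, β u ≤ r
  low : ∀ u ∈ H, lev u < K → par u ∈ H ∧ lev (par u) = lev u + 1 ∧ pos (par u) < B ∧
    β (par u) + lag u ≤ β u
  top : ∀ u ∈ H, lev u = K → par u = root ∧ lag u ≤ β u

/-- The answers `z` on `D` are explained by the history. -/
def Explains (H : Finset (Node K B s)) (par : Node K B s → Node K B s) (D : Finset (Node K B s))
    (z : Node K B s → Sym_s0 K B s) : Prop :=
  ∀ u ∈ D, (z u = none → u ∉ H) ∧ ∀ p σ, z u = some (p, σ) → u ∈ H ∧ p = par u ∧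
    ∀ w, Target u p σ w → w ∈ H ∧ par w = if Done u then par p else u

lemma History.iterate_mem {root : Node K B s} {r : ℕ} {H : Finset (Node K B s)}
    {par : Node K B s → Node K B s} {β : Node K B s → ℕ} (h : History root r H par β)
    (u : Node K B s) (hu : u ∈ H) (j : ℕ) :
    par^[j] u ∈ H ∧ (lev u + j ≤ lev (par^[j] u) ∨ lev (par^[j] u) = K) := by
  induction j with
  | zero => exact ⟨hu, Or.inl le_rfl⟩
  | succ j ih =>
    rw [Function.iterate_succ_apply']
    obtain ⟨h1, h2⟩ := ih
    rcases (lev_le (par^[j] u)).lt_or_eq with h3 | h3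
    · obtain ⟨g1, g2, -⟩ := h.low _ h1 h3
      exact ⟨g1, Or.inl (by omega)⟩
    · obtain ⟨g1, -⟩ := h.top _ h1 h3
      rw [g1]
      exact ⟨h.root_mem, Or.inr h.lev_root⟩

lemma History.prune {root : Node K B s} {r : ℕ} {H : Finset (Node K B s)}
    {par : Node K B s → Node K B s} {β : Node K B s → ℕ} (h : History root r H par β)
    {D : Finset (Node K B s)} {z : Node K B s → Sym_s0 K B s} (hE : Explains H par D z) :
    ∃ H', History root r H' par β ∧ Explains H' par D z ∧
      #H' ≤ 1 + #D * (K + 2) := by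
  classical
  let tgt : Node K B s → Finset (Node K B s) := fun u => {v | ∃ p σ, z u = some (p, σ) ∧
    Target u p σ v}
  let H' : Finset (Node K B s) := {v ∈ H | v = root ∨
    (∃ u ∈ D, u ∈ H ∧ ∃ j ≤ K, v = par^[j] u) ∨ ∃ u ∈ D, v ∈ tgt u}
  have htgt : ∀ u v, v ∈ tgt u ↔ ∃ p σ, z u = some (p, σ) ∧ Target u p σ v := by
    intro u v; simp only [tgt, mem_filter, mem_univ, true_and]
  have hmem : ∀ v, v ∈ H' ↔ v ∈ H ∧ (v = root ∨
      (∃ u ∈ D, u ∈ H ∧ ∃ j ≤ K, v = par^[j] u) ∨ ∃ u ∈ D, v ∈ tgt u) := by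
    intro v; simp only [H', mem_filter]
  have hself : ∀ u ∈ D, u ∈ H → u ∈ H' := fun u hu huH =>
    (hmem u).2 ⟨huH, Or.inr (Or.inl ⟨u, hu, huH, 0, Nat.zero_le _, rfl⟩)⟩
  refine ⟨H', ⟨h.lev_root, (hmem _).2 ⟨h.root_mem, Or.inl rfl⟩,
    fun v hv => h.time_le v ((hmem v).1 hv).1, ?_, fun v hv => h.top v ((hmem v).1 hv).1⟩, ?_, ?_⟩
  · intro v hv hlt
    obtain ⟨hvH, hv'⟩ := (hmem v).1 hv
    have hlow := h.low v hvH hlt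
    refine ⟨(hmem _).2 ⟨hlow.1, ?_⟩, hlow.2⟩
    rcases hv' with rfl | ⟨u, hu, huH, j, hj, rfl⟩ | ⟨u, hu, huv⟩
    · exact absurd h.lev_root hlt.ne
    · refine Or.inr (Or.inl ⟨u, hu, huH, j + 1, ?_, (Function.iterate_succ_apply' _ _ _).symm⟩)
      have := (h.iterate_mem u huH j).2
      omega
    · obtain ⟨p, σ, hz, ht⟩ := (htgt u v).1 huv
      obtain ⟨huH, rfl, hall⟩ := (hE u hu).2 p σ hz
      have hpar := (hall v ht).2
      refine Or.inr (Or.inl ⟨u, hu, huH, ?_⟩)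
      rw [hpar]
      split_ifs with hdone
      · refine ⟨2, ?_, rfl⟩
        obtain ⟨-, ⟨hnd, -⟩ | ⟨-, h1, h2, -⟩⟩ := ht
        · exact absurd hdone hnd
        · have := (h.low u huH h1).2.1
          omega
      · exact ⟨0, Nat.zero_le _, rfl⟩
  · intro u hu
    refine ⟨fun hz huH' => (hE u hu).1 hz ((hmem u).1 huH').1, fun p σ hz => ?_⟩
    obtain ⟨huH, hp, hall⟩ := (hE u hu).2 p σ hz
    refine ⟨hself u hu huH, hp, fun w hw => ?_⟩
    obtain ⟨g1, g2⟩ := hall w hw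
    exact ⟨(hmem w).2 ⟨g1, Or.inr (Or.inr ⟨u, hu, (htgt u w).2 ⟨p, σ, hz, hw⟩⟩)⟩, g2⟩
  · have hcov : H' ⊆ {root} ∪ (D.biUnion (fun u => (range (K + 1)).image
        fun j => par^[j] u) ∪ D.biUnion tgt) := by
      intro v hv
      obtain ⟨-, hv'⟩ := (hmem v).1 hv
      simp only [mem_union, mem_singleton, mem_biUnion, mem_image, mem_range]
      rcases hv' with h1 | ⟨u, hu, -, j, hj, rfl⟩ | ⟨u, hu, huv⟩
      · exact Or.inl h1
      · exact Or.inr (Or.inl ⟨u, hu, j, by omega, rfl⟩)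
      · exact Or.inr (Or.inr ⟨u, hu, huv⟩)
    have h1 : #(D.biUnion (fun u => (range (K + 1)).image fun j => par^[j] u)) ≤
        #D * (K + 1) := by
      refine card_biUnion_le_card_mul _ _ (K + 1) fun u _ => ?_
      exact card_image_le.trans (card_range _).le
    have h2 : #(D.biUnion tgt) ≤ #D * 1 := by
      refine card_biUnion_le_card_mul _ _ 1 fun u _ => card_le_one.2 fun v hv v' hv' => ?_
      obtain ⟨p, σ, hz, ht⟩ := (htgt u v).1 hv
      obtain ⟨p', σ', hz', ht'⟩ := (htgt u v').1 hv'
      rw [hz] at hz'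
      obtain ⟨rfl, rfl⟩ := Prod.mk.inj (Option.some.inj hz')
      exact ht.unique ht'
    have h3 := card_le_card hcov
    have h4 := card_union_le {root} (D.biUnion (fun u => (range (K + 1)).image
        fun j => par^[j] u) ∪ D.biUnion tgt)
    have h5 := card_union_le (D.biUnion (fun u => (range (K + 1)).image
        fun j => par^[j] u)) (D.biUnion tgt)
    rw [card_singleton] at h4
    have h6 : #D * (K + 2) = #D * (K + 1) + #D := by ring
    omega

/-- Activating a fresh node `w` with parent `q`. -/
lemma History.activate {root : Node K B s} {r : ℕ} {H : Finset (Node K B s)}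
    {par : Node K B s → Node K B s} {β : Node K B s → ℕ} (h : History root r H par β)
    {w q : Node K B s} (hw : w ∉ H)
    (hlow : lev w < K → q ∈ H ∧ lev q = lev w + 1 ∧ pos q < B ∧ β q + lag w ≤ r + 1)
    (htop : lev w = K → q = root ∧ lag w ≤ r + 1) :
    History root (r + 1) (insert w H) (Function.update par w q)
      (Function.update β w (r + 1)) := by
  have hne : ∀ v ∈ H, v ≠ w := by rintro v hv rfl; exact hw hv
  refine ⟨h.lev_root, mem_insert_of_mem h.root_mem, ?_, ?_, ?_⟩
  · intro u hu
    rcases mem_insert.1 hu with rfl | hu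
    · rw [Function.update_self]
    · rw [Function.update_of_ne (hne u hu)]
      exact (h.time_le u hu).trans (Nat.le_succ _)
  · intro u hu hlt
    rcases mem_insert.1 hu with rfl | hu
    · obtain ⟨g1, g2, g3, g4⟩ := hlow hlt
      rw [Function.update_self, Function.update_self, Function.update_of_ne (hne q g1)]
      exact ⟨mem_insert_of_mem g1, g2, g3, g4⟩
    · obtain ⟨g1, g2, g3, g4⟩ := h.low u hu hlt
      rw [Function.update_of_ne (hne u hu), Function.update_of_ne (hne u hu),
        Function.update_of_ne (hne _ g1)]
      exact ⟨mem_insert_of_mem g1, g2, g3, g4⟩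
  · intro u hu heq
    rcases mem_insert.1 hu with rfl | hu
    · obtain ⟨g1, g2⟩ := htop heq
      rw [Function.update_self, Function.update_self]
      exact ⟨g1, g2⟩
    · obtain ⟨g1, g2⟩ := h.top u hu heq
      rw [Function.update_of_ne (hne u hu), Function.update_of_ne (hne u hu)]
      exact ⟨g1, g2⟩

lemma Explains.activate {root : Node K B s} {r : ℕ} {H : Finset (Node K B s)}
    {par : Node K B s → Node K B s} {β : Node K B s → ℕ} (h : History root r H par β)
    {D : Finset (Node K B s)} {z : Node K B s → Sym_s0 K B s} (hE : Explains H par D z)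
    {w q : Node K B s} (hw : w ∉ H) (hwD : w ∉ D) :
    Explains (insert w H) (Function.update par w q) D z := by
  have hne : ∀ v ∈ H, v ≠ w := by rintro v hv rfl; exact hw hv
  intro u hu
  obtain ⟨h1, h2⟩ := hE u hu
  refine ⟨fun hz huH => ?_, fun p σ hz => ?_⟩
  · rcases mem_insert.1 huH with rfl | huH
    · exact hwD hu
    · exact h1 hz huH
  · obtain ⟨huH, hp, hall⟩ := h2 p σ hz
    refine ⟨mem_insert_of_mem huH, by rw [Function.update_of_ne (hne u huH), hp], ?_⟩
    intro v hv
    obtain ⟨g1, g2⟩ := hall v hv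
    refine ⟨mem_insert_of_mem g1, ?_⟩
    rw [Function.update_of_ne (hne v g1), g2]
    split_ifs with hdone
    · obtain ⟨-, ⟨hnd, -⟩ | ⟨-, hlt, -⟩⟩ := hv
      · exact absurd hdone hnd
      · rw [Function.update_of_ne]
        rw [hp]
        exact hne _ (h.low u huH hlt).1
    · rfl

/-- Adding one explained answer. -/
lemma Explains.insert {H : Finset (Node K B s)} {par : Node K B s → Node K B s}
    {D : Finset (Node K B s)} {z : Node K B s → Sym_s0 K B s} (hE : Explains H par D z)
    {u : Node K B s} (hu : u ∉ D) {σ : Sym_s0 K B s}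
    (h : Explains H par {u} (fun _ => σ)) :
    Explains H par (insert u D) (Function.update z u σ) := by
  intro v hv
  rcases mem_insert.1 hv with rfl | hvD
  · rw [Function.update_self]
    exact h v (mem_singleton_self v)
  · rw [Function.update_of_ne (by rintro rfl; exact hu hvD)]
    exact hE v hvD

lemma History.exists_answer {root : Node K B s} {r : ℕ} {H : Finset (Node K B s)}
    {par : Node K B s → Node K B s} {β : Node K B s → ℕ} (h : History root r H par β)
    {D : Finset (Node K B s)} {z : Node K B s → Sym_s0 K B s} (hE : Explains H par D z)
    {u : Node K B s} (hu : u ∉ D) (hs : #H + #D < s) :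
    ∃ (σ : Sym_s0 K B s) (H' : Finset (Node K B s)) (par' : Node K B s → Node K B s)
      (β' : Node K B s → ℕ), History root (r + 1) H' par' β' ∧
      Explains H' par' (insert u D) (Function.update z u σ) := by
  have hsucc : History root (r + 1) H par β :=
    ⟨h.lev_root, h.root_mem, fun v hv => (h.time_le v hv).trans (Nat.le_succ _), h.low, h.top⟩
  by_cases huH : u ∈ H
  swap
  · refine ⟨none, H, par, β, hsucc, hE.insert hu ?_⟩
    intro v hv
    rw [mem_singleton.1 hv]
    exact ⟨fun _ => huH, fun p σ hz => nomatch hz⟩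
  obtain ⟨σ, hσ⟩ : ∃ σ : Fin s, σ ∉ (H ∪ D).image slot := by
    by_contra hcon
    push Not at hcon
    have h1 : #(univ : Finset (Fin s)) ≤ #((H ∪ D).image slot) :=
      card_le_card fun σ _ => hcon σ
    rw [card_univ, Fintype.card_fin] at h1
    have h2 := card_image_le (s := H ∪ D) (f := slot)
    have h3 := card_union_le H D
    omega
  have hfresh : ∀ w : Node K B s, slot w = σ → w ∉ H ∧ w ∉ D := by
    rintro w rfl
    exact ⟨fun hw => hσ (mem_image_of_mem _ (mem_union_left _ hw)),
      fun hw => hσ (mem_image_of_mem _ (mem_union_right _ hw))⟩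
  by_cases hex : ∃ w, Target u (par u) σ w
  swap
  · refine ⟨some (par u, σ), H, par, β, hsucc, hE.insert hu ?_⟩
    intro v hv
    rw [mem_singleton.1 hv]
    refine ⟨fun hz => (nomatch hz), fun p σ' hz => ?_⟩
    obtain ⟨rfl, rfl⟩ := Prod.mk.inj (Option.some.inj hz)
    exact ⟨huH, rfl, fun w hw => absurd ⟨w, hw⟩ hex⟩
  obtain ⟨w, hw⟩ := hex
  obtain ⟨hwH, hwD⟩ := hfresh w hw.1
  have hne : ∀ v ∈ H, v ≠ w := by rintro v hv rfl; exact hwH hv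
  have hlevu := lev_le u
  have hposu := pos_le u
  have hact : History root (r + 1) (Insert.insert w H)
      (Function.update par w (if Done u then par (par u) else u))
      (Function.update β w (r + 1)) := by
    have hur := h.time_le u huH
    refine h.activate hwH ?_ ?_
    · intro hlt
      obtain ⟨-, ⟨hnd, h1, h2⟩ | ⟨hd, h1, h2, h3⟩⟩ := hw
      · rw [if_neg hnd]
        unfold Done at hnd
        refine ⟨huH, h1.symm, by omega, ?_⟩
        rw [lag, h2, zero_mul]
        split_ifs <;> omega
      · rw [if_pos hd]
        obtain ⟨g1, g2, g3, g4⟩ := h.low u huH h1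
        obtain ⟨k1, k2, k3, k4⟩ := h.low _ g1 (by omega)
        refine ⟨k1, by omega, k3, ?_⟩
        have hlagu : B ^ lev u ≤ lag u := by
          rw [lag]
          split_ifs with h0
          · rw [h0, pow_zero]
          · rw [hd.resolve_left h0, ← pow_succ', Nat.sub_add_cancel (by omega)]
        rw [lag, if_neg (by omega), g2, Nat.add_sub_cancel] at k4
        rw [lag, if_neg (by omega), h2, h3, g2, Nat.add_sub_cancel, add_mul, one_mul]
        omega
    · intro heq
      obtain ⟨-, ⟨hnd, h1, h2⟩ | ⟨hd, h1, h2, h3⟩⟩ := hw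
      · omega
      · rw [if_pos hd]
        obtain ⟨g1, g2, g3, g4⟩ := h.low u huH h1
        obtain ⟨k1, k4⟩ := h.top _ g1 (by omega)
        refine ⟨k1, ?_⟩
        have hlagu : B ^ lev u ≤ lag u := by
          rw [lag]
          split_ifs with h0
          · rw [h0, pow_zero]
          · rw [hd.resolve_left h0, ← pow_succ', Nat.sub_add_cancel (by omega)]
        rw [lag, if_neg (by omega), g2, Nat.add_sub_cancel] at k4
        rw [lag, if_neg (by omega), h2, h3, g2, Nat.add_sub_cancel, add_mul, one_mul]
        omega
  refine ⟨some (par u, σ), _, _, _, hact, (hE.activate h hwH hwD).insert hu ?_⟩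
  intro v hv
  rw [mem_singleton.1 hv]
  refine ⟨fun hz => (nomatch hz), fun p σ' hz => ?_⟩
  obtain ⟨rfl, rfl⟩ := Prod.mk.inj (Option.some.inj hz)
  refine ⟨mem_insert_of_mem huH, by rw [Function.update_of_ne (hne u huH)], fun w' hw' => ?_⟩
  rw [hw'.unique hw]
  refine ⟨mem_insert_self _ _, ?_⟩
  rw [Function.update_self]
  split_ifs with hd
  · obtain ⟨-, ⟨hnd, -⟩ | ⟨-, h1, -⟩⟩ := hw
    · exact absurd hd hnd
    · rw [Function.update_of_ne (hne _ (h.low u huH h1).1)]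
  · rfl

lemma History.not_viol {root : Node K B s} {r : ℕ} {H : Finset (Node K B s)}
    {par : Node K B s → Node K B s} {β : Node K B s → ℕ} (h : History root r H par β)
    {D : Finset (Node K B s)} {z : Node K B s → Sym_s0 K B s} (hE : Explains H par D z)
    (hroot : pos root = 0 ∧ (slot root : ℕ) = 0) (hK : 0 < K) (hr : r < B ^ K)
    {u v w : Node K B s} (hu : u ∈ D) (hv : v ∈ D) (hw : w ∈ D) :
    ¬ Viol (u, z u) (v, z v) (w, z w) := by
  have htarget : ∀ {x q : Node K B s}, x ∈ D → x ∈ H → par x = q → ∃ σ, z x = some (q, σ) := by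
    intro x q hx hxH hq
    cases hz : z x with
    | none => exact absurd hxH ((hE x hx).1 hz)
    | some pσ =>
      obtain ⟨-, hp, -⟩ := (hE x hx).2 pσ.1 pσ.2 hz
      exact ⟨pσ.2, by rw [← hq, ← hp]⟩
  rintro (⟨h1, h2, h3, h4⟩ | ⟨h1, h2, h3⟩ | ⟨p, σ, h1, h2, h3, h4⟩ |
    ⟨p, σ, p', σ', h1, h2, h3, h4, h5⟩)
  · have : u = root := node_ext (h1.trans h.lev_root.symm) (h2.trans hroot.1.symm)
      (Fin.ext (h3.trans hroot.2.symm))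
    rw [this] at hu h4
    exact (hE root hu).1 h4 h.root_mem
  · obtain ⟨⟨p, σ⟩, hz⟩ := Option.ne_none_iff_exists'.1 h3
    have huH := ((hE u hu).2 p σ hz).1
    have g1 := (h.top u huH h1).2
    have g2 := h.time_le u huH
    simp only at h1 h2
    rw [lag, if_neg (by omega), h2, h1, ← pow_succ', Nat.sub_add_cancel hK] at g1
    omega
  · obtain ⟨g1, rfl, g3⟩ := (hE u hu).2 p σ h1
    obtain ⟨k1, k2⟩ := g3 v h3
    rw [if_neg h2] at k2
    obtain ⟨σ', hσ'⟩ := htarget hv k1 k2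
    exact h4 σ' hσ'
  · obtain ⟨g1, rfl, g3⟩ := (hE u hu).2 p σ h1
    obtain ⟨k1, k2⟩ := g3 w h4
    rw [if_pos h2] at k2
    obtain ⟨hv1, hv2⟩ := Prod.mk.inj h3
    subst hv1
    obtain ⟨-, hp, -⟩ := (hE _ hv).2 p' σ' hv2
    rw [← hp] at k2
    obtain ⟨τ, hτ⟩ := htarget hw k1 k2
    exact h5 τ hτ

/-- An adversary with a bounded memory survives almost `B ^ K` rounds. -/
def stackAdversary (K B s q R : ℕ) (hK : 0 < K) (hs : 1 + q * (K + 3) < s) (hR : R < B ^ K) :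
    Adversary (Viol (K := K) (B := B) (s := s)) q R where
  P r D z := ∃ root : Node K B s, (pos root = 0 ∧ (slot root : ℕ) = 0) ∧
    ∃ H par β, History root r H par β ∧ Explains H par D z
  init := by
    obtain ⟨root, h1, h2, h3⟩ := exists_node (K := K) (B := B) K 0 le_rfl (Nat.zero_le _)
      (⟨0, by omega⟩ : Fin s)
    refine ⟨fun _ => none, root, ⟨h2, by rw [h3]⟩, {root}, fun _ => root, fun _ => 0, ?_, ?_⟩
    · refine ⟨h1, mem_singleton_self _, fun _ _ => le_rfl, ?_, ?_⟩
      · intro u hu hlt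
        rw [mem_singleton.1 hu] at hlt
        omega
      · intro u hu _
        rw [mem_singleton.1 hu, lag, h2, zero_mul, if_neg (by omega)]
        exact ⟨rfl, le_rfl⟩
    · intro u hu
      exact absurd hu (notMem_empty u)
  mono := by
    rintro r r' D D' z ⟨root, hroot, H, par, β, h, hE⟩ hD hr
    exact ⟨root, hroot, H, par, β, ⟨h.lev_root, h.root_mem, fun v hv => (h.time_le v hv).trans hr,
      h.low, h.top⟩, fun u hu => hE u (hD hu)⟩
  step := by
    rintro r D z u ⟨root, hroot, H, par, β, h, hE⟩ hq _ hu
    obtain ⟨H', h', hE', hcard⟩ := h.prune hE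
    have h1 : #D * (K + 2) ≤ q * (K + 2) := Nat.mul_le_mul_right _ hq.le
    have h2 : q * (K + 3) = q * (K + 2) + q := by ring
    obtain ⟨σ, H'', par'', β'', g1, g2⟩ := h'.exists_answer hE' hu (by omega)
    exact ⟨σ, root, hroot, H'', par'', β'', g1, g2⟩
  noViol := by
    rintro r D z ⟨root, hroot, H, par, β, h, hE⟩ hr u hu v hv w hw
    exact h.not_viol hE hroot hK (lt_of_le_of_lt hr hR) hu hv hw

end Stack

section Search

open Finset

/-- A violation can be found in `r` rounds by a decision procedure that may forget facts and
remembers at most `M` of them. -/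
def Win {V Sg : Type} [DecidableEq V] [DecidableEq Sg]
    (Viol : V × Sg → V × Sg → V × Sg → Prop) (M : ℕ) : ℕ → Finset (V × Sg) → Prop
  | 0, ρ => ∃ f ∈ ρ, ∃ g ∈ ρ, ∃ h ∈ ρ, Viol f g h
  | r + 1, ρ => Win Viol M r ρ ∨
      ∃ ρ' ⊆ ρ, #ρ' < M ∧ ∃ u, ∀ σ, Win Viol M r (insert (u, σ) ρ')

section Basic

variable {V Sg : Type} [DecidableEq V] [DecidableEq Sg]
  {Viol : V × Sg → V × Sg → V × Sg → Prop} {M : ℕ}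

lemma Win.of_subset {r : ℕ} {ρ ρ' : Finset (V × Sg)} (h : Win Viol M r ρ) (hsub : ρ ⊆ ρ') :
    Win Viol M r ρ' := by
  induction r generalizing ρ ρ' with
  | zero =>
    obtain ⟨f, hf, g, hg, k, hk, hv⟩ := h
    exact ⟨f, hsub hf, g, hsub hg, k, hsub hk, hv⟩
  | succ r ih =>
    rcases h with h | ⟨τ, hτ, h⟩
    · exact Or.inl (ih h hsub)
    · exact Or.inr ⟨τ, hτ.trans hsub, h⟩

lemma Win.of_le {r r' : ℕ} {ρ : Finset (V × Sg)} (h : Win Viol M r ρ) (hr : r ≤ r') :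
    Win Viol M r' ρ := by
  induction r', hr using Nat.le_induction with
  | base => exact h
  | succ r' _ ih => exact Or.inl ih

lemma Win.query {r : ℕ} {ρ : Finset (V × Sg)} (hρ : #ρ < M) (u : V)
    (h : ∀ σ, Win Viol M r (insert (u, σ) ρ)) : Win Viol M (r + 1) ρ :=
  Or.inr ⟨ρ, Subset.rfl, hρ, u, h⟩

lemma Win.of_viol {r : ℕ} {ρ : Finset (V × Sg)} {f g h : V × Sg} (hf : f ∈ ρ) (hg : g ∈ ρ)
    (hh : h ∈ ρ) (hv : Viol f g h) : Win Viol M r ρ :=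
  Win.of_le (r := 0) ⟨f, hf, g, hg, h, hh, hv⟩ (Nat.zero_le _)

end Basic

/-- The number of rounds needed to complete a node of level `i`. -/
def rounds (B : ℕ) : ℕ → ℕ
  | 0 => 0
  | i + 1 => B * (rounds B i + 1) + 1

lemma rounds_succ_le (B i : ℕ) : rounds B i + 1 ≤ (B + 2) ^ i := by
  induction i with
  | zero => simp [rounds]
  | succ i ih =>
    have h1 : 1 ≤ (B + 2) ^ i := Nat.one_le_pow _ _ (by omega)
    calc rounds B (i + 1) + 1 = B * (rounds B i + 1) + 2 := rfl
      _ ≤ B * (B + 2) ^ i + 2 * (B + 2) ^ i := by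
          have := Nat.mul_le_mul_left B ih
          omega
      _ = _ := by ring

variable {K B s : ℕ}

/-- Every active unfinished node of level `i` can be completed. -/
def Completes (K B s M i : ℕ) : Prop :=
  ∀ (r : ℕ) (ρ : Finset (Node K B s × Sym_s0 K B s)) (u p : Node K B s) (σ : Fin s),
    (u, some (p, σ)) ∈ ρ → lev u = i → pos u < B → #ρ + i + 1 < M →
    (∀ t τ, lev t + 1 = i → Done t → Win Viol M r (insert (t, some (u, τ)) ρ)) →
    Win Viol M (r + rounds B i) ρ

lemma win_of_completes {M i : ℕ} (hi : 0 < i) (hiK : i ≤ K) (hC : Completes K B s M i) {r : ℕ}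
    {ρ : Finset (Node K B s × Sym_s0 K B s)} {q : Node K B s} (hρ : #ρ + i + 2 < M)
    (hend : ∀ w τ, lev w = i → pos w = B → Win Viol M r (insert (w, some (q, τ)) ρ)) (k : ℕ) :
    ∀ w τ, lev w = i → B - pos w = k →
      Win Viol M (r + k * (rounds B i + 1)) (insert (w, some (q, τ)) ρ) := by
  induction k with
  | zero =>
    intro w τ hw hk
    have := pos_le w
    exact (hend w τ hw (by omega)).of_le (Nat.le_add_right _ _)
  | succ k ih =>
    intro w τ hw hk
    have hcard := card_insert_le (w, some (q, τ)) ρ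
    have := hC (r + k * (rounds B i + 1) + 1) (insert (w, some (q, τ)) ρ) w q τ
      (mem_insert_self _ _) hw (by omega) (by omega) ?_
    · refine this.of_le (le_of_eq ?_)
      ring
    intro t τ' ht hdone
    have hcard' := card_insert_le (t, some (w, τ')) (insert (w, some (q, τ)) ρ)
    obtain ⟨w', h1, h2, h3⟩ := exists_node (K := K) (B := B) i (pos w + 1) hiK (by omega) τ'
    refine Win.query (by omega) w' fun σ => ?_
    by_cases hσ : ∃ τ'', σ = some (q, τ'')
    · obtain ⟨τ'', rfl⟩ := hσ
      refine (ih w' τ'' h1 (by omega)).of_subset (insert_subset_insert _ ?_)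
      exact (subset_insert _ _).trans (subset_insert _ _)
    · refine Win.of_viol (f := (t, some (w, τ'))) (g := (w, some (q, τ))) (h := (w', σ))
        (by simp) (by simp) (by simp) (Or.inr (Or.inr (Or.inr ⟨w, τ', q, τ, rfl, hdone, rfl,
          ⟨h3, Or.inr ⟨hdone, by dsimp only; omega, by dsimp only; omega, h2⟩⟩,
          fun σ' h => hσ ⟨σ', h⟩⟩)))

lemma completes {M : ℕ} (i : ℕ) : i + 1 ≤ K → Completes K B s M (i + 1) := by
  induction i with
  | zero =>
    intro hK r ρ u p σ hu hlev hpos hρ hdone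
    obtain ⟨w, h1, h2, h3⟩ := exists_node (K := K) (B := B) 0 0 (by omega) (by omega) σ
    have hnd : ¬ Done u := by unfold Done; omega
    refine Win.of_le (r := r + 1) (Win.query (by omega) w fun τ => ?_) ?_
    · by_cases hτ : ∃ τ', τ = some (u, τ')
      · obtain ⟨τ', rfl⟩ := hτ
        exact hdone w τ' (by omega) (Or.inl h1)
      · exact Win.of_viol (f := (u, some (p, σ))) (g := (w, τ)) (h := (w, τ))
          (mem_insert_of_mem hu) (by simp) (by simp) (Or.inr (Or.inr (Or.inl ⟨p, σ, rfl, hnd,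
          ⟨h3, Or.inl ⟨hnd, by dsimp only; omega, h2⟩⟩, fun σ' h => hτ ⟨σ', h⟩⟩)))
    · simp only [rounds]; omega
  | succ i ih =>
    intro hK r ρ u p σ hu hlev hpos hρ hdone
    obtain ⟨w, h1, h2, h3⟩ := exists_node (K := K) (B := B) (i + 1) 0 (by omega) (by omega) σ
    have hnd : ¬ Done u := by unfold Done; omega
    refine Win.of_le (r := r + B * (rounds B (i + 1) + 1) + 1)
      (Win.query (by omega) w fun τ => ?_) (le_of_eq rfl)
    by_cases hτ : ∃ τ', τ = some (u, τ')
    · obtain ⟨τ', rfl⟩ := hτ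
      refine win_of_completes (Nat.succ_pos i) (by omega) (ih (by omega)) (by omega) ?_ B w τ' h1
        (by omega)
      intro w' τ'' hw' hpos'
      exact hdone w' τ'' (by omega) (Or.inr hpos')
    · exact Win.of_viol (f := (u, some (p, σ))) (g := (w, τ)) (h := (w, τ))
        (mem_insert_of_mem hu) (by simp) (by simp) (Or.inr (Or.inr (Or.inl ⟨p, σ, rfl, hnd,
        ⟨h3, Or.inl ⟨hnd, by dsimp only; omega, h2⟩⟩, fun σ' h => hτ ⟨σ', h⟩⟩)))

theorem win_empty (hK : 0 < K) (hs : 0 < s) :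
    Win (Viol (K := K) (B := B) (s := s)) (K + 3) (B * (rounds B K + 1) + 1) ∅ := by
  obtain ⟨root, h1, h2, h3⟩ := exists_node (K := K) (B := B) K 0 le_rfl (Nat.zero_le _)
    (⟨0, hs⟩ : Fin s)
  refine Win.query (by simp) root fun σ => ?_
  rcases σ with _ | ⟨p, σ⟩
  · exact Win.of_viol (f := (root, none)) (g := (root, none)) (h := (root, none)) (by simp)
      (by simp) (by simp) (Or.inl ⟨h1, h2, by rw [h3], rfl⟩)
  · have hC : Completes K B s (K + 3) K := by
      obtain ⟨i, rfl⟩ := Nat.exists_eq_succ_of_ne_zero hK.ne'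
      exact completes i le_rfl
    refine Win.of_le (win_of_completes (r := 0) hK le_rfl hC (by simp) ?_ B root σ h1 (by omega))
      (by omega)
    intro w τ hw hpos
    exact Win.of_viol (f := (w, some (p, τ))) (g := (w, some (p, τ))) (h := (w, some (p, τ)))
      (by simp) (by simp) (by simp) (Or.inr (Or.inl ⟨hw, hpos, by simp⟩))

end Search

section StraightLine

open Finset

variable {n : ℕ}

/-- The function `f` is an input, a constant, or a gate over functions satisfying `P`. -/
def IsGate (P : ((Fin n → Bool) → Bool) → Prop) (f : (Fin n → Bool) → Bool) : Prop :=
  (∃ v, f = fun x => x v) ∨ (∃ b, f = fun _ => b) ∨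
    (∃ g h, P g ∧ P h ∧ f = fun x => g x && h x) ∨ (∃ g h, P g ∧ P h ∧ f = fun x => g x || h x)

lemma IsGate.imp {P Q : ((Fin n → Bool) → Bool) → Prop} {f : (Fin n → Bool) → Bool}
    (h : IsGate P f) (hPQ : ∀ g, P g → Q g) : IsGate Q f := by
  rcases h with h | h | ⟨g, k, hg, hk, h⟩ | ⟨g, k, hg, hk, h⟩
  · exact Or.inl h
  · exact Or.inr (Or.inl h)
  · exact Or.inr (Or.inr (Or.inl ⟨g, k, hPQ g hg, hPQ k hk, h⟩))
  · exact Or.inr (Or.inr (Or.inr ⟨g, k, hPQ g hg, hPQ k hk, h⟩))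

/-- A straight-line program, as the list of the functions computed by its lines. -/
def Straight (L : List ((Fin n → Bool) → Bool)) : Prop :=
  ∀ (i : ℕ) (f : (Fin n → Bool) → Bool), L[i]? = some f →
    IsGate (fun g => ∃ j < i, L[j]? = some g) f

lemma Straight.append {L : List ((Fin n → Bool) → Bool)} (hL : Straight L)
    {f : (Fin n → Bool) → Bool} (hf : IsGate (· ∈ L) f) : Straight (L ++ [f]) := by
  intro i g hg
  rcases lt_or_ge i L.length with hi | hi
  · rw [List.getElem?_append_left hi] at hg
    refine (hL i g hg).imp ?_
    rintro k ⟨j, hj, hk⟩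
    exact ⟨j, hj, by rw [List.getElem?_append_left (hj.trans hi), hk]⟩
  · rw [List.getElem?_append_right hi] at hg
    have hi' : i - L.length = 0 := by
      by_contra h0
      rw [List.getElem?_eq_none (by simp; omega)] at hg
      exact nomatch hg
    rw [hi'] at hg
    obtain rfl : f = g := by simpa using hg
    refine hf.imp fun k hk => ?_
    obtain ⟨j, hj, hk⟩ := List.mem_iff_getElem.1 hk
    exact ⟨j, by omega, by rw [List.getElem?_append_left hj, List.getElem?_eq_getElem hj, hk]⟩

lemma Straight.exists_circuit {L : List ((Fin n → Bool) → Bool)} (hL : Straight L)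
    {f : (Fin n → Bool) → Bool} (hf : f ∈ L) :
    ∃ T : MonCircuit n, Computes T f ∧ T.size ≤ L.length := by
  obtain ⟨m, hm, hmf⟩ := List.mem_iff_getElem.1 hf
  have hlt : ∀ i : Fin (m + 1), (i : ℕ) < L.length := fun i => by omega
  have hgate : ∀ i : Fin (m + 1), ∃ g : GateD n (m + 1),
      (match g with
        | GateD.and j k => j < i ∧ k < i
        | GateD.or j k => j < i ∧ k < i
        | _ => True) ∧
      ∀ x, L.get ⟨i, hlt i⟩ x = match g with
        | GateD.inp a => x a
        | GateD.const b => b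
        | GateD.and j k => L.get ⟨j, hlt j⟩ x && L.get ⟨k, hlt k⟩ x
        | GateD.or j k => L.get ⟨j, hlt j⟩ x || L.get ⟨k, hlt k⟩ x := by
    intro i
    have hidx : ∀ g, (∃ j < (i : ℕ), L[j]? = some g) →
        ∃ j : Fin (m + 1), j < i ∧ L.get ⟨j, hlt j⟩ = g := by
      rintro g ⟨j, hj, hg⟩
      refine ⟨⟨j, hj.trans i.2⟩, hj, ?_⟩
      rw [List.getElem?_eq_getElem (by omega)] at hg
      exact Option.some.inj hg
    rcases hL i _ (List.getElem?_eq_getElem (hlt i)) with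
      ⟨v, h⟩ | ⟨b, h⟩ | ⟨g, k, hg, hk, h⟩ | ⟨g, k, hg, hk, h⟩
    · exact ⟨GateD.inp v, trivial, congrFun h⟩
    · exact ⟨GateD.const b, trivial, congrFun h⟩
    · obtain ⟨j, hj, rfl⟩ := hidx g hg
      obtain ⟨j', hj', rfl⟩ := hidx k hk
      exact ⟨GateD.and j j', ⟨hj, hj'⟩, congrFun h⟩
    · obtain ⟨j, hj, rfl⟩ := hidx g hg
      obtain ⟨j', hj', rfl⟩ := hidx k hk
      exact ⟨GateD.or j j', ⟨hj, hj'⟩, congrFun h⟩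
  choose g hwf hg using hgate
  refine ⟨⟨m + 1, Nat.succ_pos m, g, fun i => ?_⟩,
    ⟨fun i => L.get ⟨i, hlt i⟩, fun i x => ?_, fun x => ?_⟩, hm⟩
  · have := hwf i
    split <;> simp_all
  · refine (hg i x).trans ?_
    dsimp only
    cases g i <;> rfl
  · rw [← hmf]
    rfl

/-- Some straight-line program of length at most `k` computes all functions of `T`. -/
def Buildable (k : ℕ) (T : Set ((Fin n → Bool) → Bool)) : Prop :=
  ∃ L : List ((Fin n → Bool) → Bool), Straight L ∧ L.length ≤ k ∧ ∀ f ∈ T, f ∈ L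

lemma buildable_empty : Buildable 0 (∅ : Set ((Fin n → Bool) → Bool)) :=
  ⟨[], fun i f h => by simp at h, le_rfl, fun f h => absurd h (Set.notMem_empty f)⟩

lemma Buildable.mono {k k' : ℕ} {T T' : Set ((Fin n → Bool) → Bool)} (h : Buildable k T)
    (hk : k ≤ k') (hT : T' ⊆ T) : Buildable k' T' := by
  obtain ⟨L, h1, h2, h3⟩ := h
  exact ⟨L, h1, h2.trans hk, fun f hf => h3 f (hT hf)⟩

/-- Given programs for `T`, the function `f` can be computed with `c` more lines. -/
def CostLE (T : Set ((Fin n → Bool) → Bool)) (c : ℕ) (f : (Fin n → Bool) → Bool) : Prop :=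
  ∀ T' ⊇ T, ∀ k, Buildable k T' → Buildable (k + c) (insert f T')

variable {T : Set ((Fin n → Bool) → Bool)}

lemma CostLE.mono {c c' : ℕ} {f : (Fin n → Bool) → Bool} (h : CostLE T c f) (hc : c ≤ c') :
    CostLE T c' f :=
  fun T' hT' k hk => (h T' hT' k hk).mono (by omega) Set.Subset.rfl

lemma costLE_of_mem {f : (Fin n → Bool) → Bool} (hf : f ∈ T) : CostLE T 0 f :=
  fun T' hT' k hk => by rwa [Set.insert_eq_self.2 (hT' hf)]

lemma costLE_of_isGate {f : (Fin n → Bool) → Bool} (hf : IsGate (· ∈ T) f) : CostLE T 1 f := by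
  rintro T' hT' k ⟨L, h1, h2, h3⟩
  refine ⟨L ++ [f], h1.append (hf.imp fun g hg => h3 g (hT' hg)), by simpa using h2, ?_⟩
  intro g hg
  rcases hg with rfl | hg
  · simp
  · exact List.mem_append_left _ (h3 g hg)

lemma costLE_inp (v : Fin n) : CostLE T 1 (fun x => x v) :=
  costLE_of_isGate (Or.inl ⟨v, rfl⟩)

lemma costLE_const (b : Bool) : CostLE T 1 (fun _ => b) :=
  costLE_of_isGate (Or.inr (Or.inl ⟨b, rfl⟩))

lemma CostLE.gate {c c' : ℕ} {f g h : (Fin n → Bool) → Bool} (hf : CostLE T c f)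
    (hg : CostLE T c' g) (hh : IsGate (fun k => k = f ∨ k = g) h) :
    CostLE T (c + c' + 1) h := by
  intro T' hT' k hk
  have h1 := hg _ (hT'.trans (Set.subset_insert f T')) _ (hf T' hT' k hk)
  have h2 : CostLE (insert g (insert f T')) 1 h := by
    refine costLE_of_isGate (hh.imp ?_)
    rintro k (rfl | rfl)
    · exact Set.mem_insert_of_mem _ (Set.mem_insert _ _)
    · exact Set.mem_insert _ _
  refine (h2 _ Set.Subset.rfl _ h1).mono (by omega) ?_
  exact Set.insert_subset_insert ((Set.subset_insert _ _).trans (Set.subset_insert _ _))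

lemma CostLE.and {c c' : ℕ} {f g : (Fin n → Bool) → Bool} (hf : CostLE T c f)
    (hg : CostLE T c' g) : CostLE T (c + c' + 1) (fun x => f x && g x) :=
  hf.gate hg (Or.inr (Or.inr (Or.inl ⟨f, g, Or.inl rfl, Or.inr rfl, rfl⟩)))

lemma CostLE.or {c c' : ℕ} {f g : (Fin n → Bool) → Bool} (hf : CostLE T c f)
    (hg : CostLE T c' g) : CostLE T (c + c' + 1) (fun x => f x || g x) :=
  hf.gate hg (Or.inr (Or.inr (Or.inr ⟨f, g, Or.inl rfl, Or.inr rfl, rfl⟩)))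

open scoped Classical in
lemma CostLE.exists {ι : Type*} (s : Finset ι) {c : ℕ} {F : ι → (Fin n → Bool) → Bool}
    (h : ∀ i ∈ s, CostLE T c (F i)) :
    CostLE T (#s * (c + 1) + 1) (fun x => decide (∃ i ∈ s, F i x = true)) := by
  induction s using Finset.induction_on with
  | empty => simpa using costLE_const (T := T) false
  | insert i s hi ih =>
    have h1 := (h i (mem_insert_self _ _)).or (ih fun j hj => h j (mem_insert_of_mem hj))
    convert h1 using 1
    · rw [card_insert_of_notMem hi]; ring
    · funext x
      rw [Bool.eq_iff_iff]
      simp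

open scoped Classical in
lemma CostLE.forall {ι : Type*} (s : Finset ι) {c : ℕ} {F : ι → (Fin n → Bool) → Bool}
    (h : ∀ i ∈ s, CostLE T c (F i)) :
    CostLE T (#s * (c + 1) + 1) (fun x => decide (∀ i ∈ s, F i x = true)) := by
  induction s using Finset.induction_on with
  | empty => simpa using costLE_const (T := T) true
  | insert i s hi ih =>
    have h1 := (h i (mem_insert_self _ _)).and (ih fun j hj => h j (mem_insert_of_mem hj))
    convert h1 using 1
    · rw [card_insert_of_notMem hi]; ring
    · funext x
      rw [Bool.eq_iff_iff]
      simp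

lemma Buildable.family {ι : Type*} (s : Finset ι) {c k : ℕ} {F : ι → (Fin n → Bool) → Bool}
    (h : ∀ i ∈ s, CostLE T c (F i)) (hT : Buildable k T) :
    Buildable (k + #s * c) (T ∪ F '' s) := by
  classical
  induction s using Finset.induction_on with
  | empty => simpa using hT
  | insert i s hi ih =>
    have h1 := ih fun j hj => h j (mem_insert_of_mem hj)
    have h2 := h i (mem_insert_self _ _) _ Set.subset_union_left _ h1
    refine h2.mono (le_of_eq ?_) ?_
    · rw [card_insert_of_notMem hi]; ring
    · rw [coe_insert, Set.image_insert_eq, Set.union_insert]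

end StraightLine

section Game

open Finset

variable {V C Sg : Type} [Fintype V] [DecidableEq V] [Fintype C] [DecidableEq C]
  [Fintype Sg] [DecidableEq Sg] {n : ℕ}

open scoped Classical in
/-- The search for a violation, played on the truth table of a set of triples. -/
noncomputable def game (Viol : V × Sg → V × Sg → V × Sg → Prop)
    (e : (V × C) × (V × C) × (V × C) ↪ Fin n) (M : ℕ) :
    ℕ → Finset (V × C × Sg) → (Fin n → Bool) → Bool
  | 0, S, a => decide (∃ f ∈ S, ∃ g ∈ S, ∃ h ∈ S,
      Viol (f.1, f.2.2) (g.1, g.2.2) (h.1, h.2.2) ∧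
        a (e ((f.1, f.2.1), (g.1, g.2.1), (h.1, h.2.1))) = true)
  | r + 1, S, a => game Viol e M r S a || decide (∃ S' ⊆ S, #S' < M ∧
      ∃ u c, ∀ σ, game Viol e M r (insert (u, c, σ) S') a = true)

variable {Viol : V × Sg → V × Sg → V × Sg → Prop} {e : (V × C) × (V × C) × (V × C) ↪ Fin n}
  {M : ℕ}

lemma game_mono {r : ℕ} {S : Finset (V × C × Sg)} {a b : Fin n → Bool} (hab : ∀ i, a i ≤ b i)
    (h : game Viol e M r S a = true) : game Viol e M r S b = true := by
  induction r generalizing S with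
  | zero =>
    simp only [game, decide_eq_true_eq] at h ⊢
    obtain ⟨f, hf, g, hg, k, hk, hv, ha⟩ := h
    exact ⟨f, hf, g, hg, k, hk, hv, Bool.eq_true_of_true_le (ha ▸ hab _)⟩
  | succ r ih =>
    simp only [game, Bool.or_eq_true, decide_eq_true_eq] at h ⊢
    rcases h with h | ⟨S', h1, h2, u, c, h3⟩
    · exact Or.inl (ih h)
    · exact Or.inr ⟨S', h1, h2, u, c, fun σ => ih (h3 σ)⟩

lemma game_yesInput {r : ℕ} {ρ : Finset (V × Sg)} (h : Win Viol M r ρ) (x : V → C) :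
    game Viol e M r (ρ.image fun f => (f.1, x f.1, f.2)) (yesInput e x) = true := by
  induction r generalizing ρ with
  | zero =>
    obtain ⟨f, hf, g, hg, k, hk, hv⟩ := h
    simp only [game, decide_eq_true_eq]
    refine ⟨_, mem_image_of_mem _ hf, _, mem_image_of_mem _ hg, _, mem_image_of_mem _ hk, hv, ?_⟩
    simp only [yesInput, decide_eq_true_eq]
    exact ⟨f.1, g.1, k.1, rfl⟩
  | succ r ih =>
    simp only [game, Bool.or_eq_true, decide_eq_true_eq]
    rcases h with h | ⟨ρ', h1, h2, u, h3⟩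
    · exact Or.inl (ih h)
    · refine Or.inr ⟨_, image_subset_image h1, lt_of_le_of_lt card_image_le h2, u, x u,
        fun σ => ?_⟩
      have := ih (h3 σ)
      rwa [image_insert] at this

lemma game_noInput {r : ℕ} {S : Finset (V × C × Sg)} {y : V → C → Sg}
    (hS : ∀ f ∈ S, y f.1 f.2.1 = f.2.2) : game Viol e M r S (noInput Viol e y) = false := by
  induction r generalizing S with
  | zero =>
    simp only [game, decide_eq_false_iff_not]
    rintro ⟨f, hf, g, hg, k, hk, hv, ha⟩
    simp only [noInput, decide_eq_true_eq] at ha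
    refine ha ⟨_, _, _, rfl, ?_⟩
    rw [hS f hf, hS g hg, hS k hk]
    exact hv
  | succ r ih =>
    simp only [game, Bool.or_eq_false_iff, decide_eq_false_iff_not]
    refine ⟨ih hS, ?_⟩
    rintro ⟨S', h1, -, u, c, h3⟩
    have h4 := ih (S := insert (u, c, y u c) S') fun f hf => by
      rcases mem_insert.1 hf with rfl | hf
      · rfl
      · exact hS f (h1 hf)
    rw [h3] at h4
    exact nomatch h4

lemma costLE_game_zero {T : Set ((Fin n → Bool) → Bool)} {S : Finset (V × C × Sg)}
    (hS : #S ≤ M) : CostLE T (M ^ 3 * 2 + 1) (game Viol e M 0 S) := by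
  classical
  have h1 := CostLE.exists (T := T) (c := 1) ({p ∈ S ×ˢ S ×ˢ S | Viol (p.1.1, p.1.2.2)
    (p.2.1.1, p.2.1.2.2) (p.2.2.1, p.2.2.2.2)} : Finset _)
    (F := fun p x => x (e ((p.1.1, p.1.2.1), (p.2.1.1, p.2.1.2.1), (p.2.2.1, p.2.2.2.1))))
    (fun p _ => costLE_inp _)
  convert h1.mono ?_ using 1
  · funext a
    rw [game, Bool.eq_iff_iff, decide_eq_true_eq, decide_eq_true_eq]
    simp only [mem_filter, mem_product]
    constructor
    · rintro ⟨f, hf, g, hg, h, hh, hv, ha⟩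
      exact ⟨(f, g, h), ⟨⟨hf, hg, hh⟩, hv⟩, ha⟩
    · rintro ⟨⟨f, g, h⟩, ⟨⟨hf, hg, hh⟩, hv⟩, ha⟩
      exact ⟨f, hf, g, hg, h, hh, hv, ha⟩
  · gcongr
    · refine (card_filter_le _ _).trans ?_
      rw [card_product, card_product, pow_succ, sq, mul_comm]
      gcongr

lemma costLE_game_succ {r : ℕ} {S : Finset (V × C × Sg)} (hS : #S ≤ M) :
    CostLE (game Viol e M r '' ({S | #S ≤ M} : Finset (Finset (V × C × Sg))))
      (#({S | #S ≤ M} : Finset (Finset (V × C × Sg))) * (Fintype.card V * Fintype.card C) *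
        (Fintype.card Sg + 2) + 2) (game Viol e M (r + 1) S) := by
  classical
  set 𝒮 : Finset (Finset (V × C × Sg)) := {S | #S ≤ M} with h𝒮
  have hmem : ∀ S, S ∈ 𝒮 ↔ #S ≤ M := fun S => by simp [h𝒮]
  have h1 : ∀ p ∈ ({p ∈ 𝒮 ×ˢ (univ : Finset V) ×ˢ (univ : Finset C) | p.1 ⊆ S ∧ #p.1 < M} :
      Finset (Finset (V × C × Sg) × V × C)), CostLE (game Viol e M r '' 𝒮) (Fintype.card Sg + 1)
      (fun a => decide (∀ σ ∈ (univ : Finset Sg),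
        game Viol e M r (insert (p.2.1, p.2.2, σ) p.1) a = true)) := by
    intro p hp
    have h2 := CostLE.forall (T := game Viol e M r '' 𝒮) (univ : Finset Sg) (c := 0)
      (F := fun σ => game Viol e M r (insert (p.2.1, p.2.2, σ) p.1)) fun σ _ => by
        refine costLE_of_mem ⟨_, ?_, rfl⟩
        rw [mem_coe, hmem]
        rw [mem_filter] at hp
        exact (card_insert_le _ _).trans hp.2.2
    simpa using h2
  have h2 := (costLE_of_mem (T := game Viol e M r '' 𝒮) (f := game Viol e M r S)
    ⟨S, (hmem S).2 hS, rfl⟩).or (CostLE.exists _ h1)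
  convert h2.mono ?_ using 1
  · funext a
    rw [game]
    congr 1
    rw [Bool.eq_iff_iff, decide_eq_true_eq, decide_eq_true_eq]
    simp only [mem_filter, mem_product, mem_univ, and_true, decide_eq_true_eq, true_imp_iff]
    constructor
    · rintro ⟨S', h1, h2, u, c, h3⟩
      exact ⟨(S', u, c), ⟨(hmem _).2 h2.le, h1, h2⟩, h3⟩
    · rintro ⟨⟨S', u, c⟩, ⟨-, h1, h2⟩, h3⟩
      exact ⟨S', h1, h2, u, c, h3⟩
  · have h3 : #({p ∈ 𝒮 ×ˢ (univ : Finset V) ×ˢ (univ : Finset C) | p.1 ⊆ S ∧ #p.1 < M} :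
        Finset (Finset (V × C × Sg) × V × C)) ≤ #𝒮 * (Fintype.card V * Fintype.card C) := by
      refine (card_filter_le _ _).trans ?_
      rw [card_product, card_product, card_univ, card_univ]
    have h4 := Nat.mul_le_mul_right (Fintype.card Sg + 2) h3
    rw [show Fintype.card Sg + 1 + 1 = Fintype.card Sg + 2 from rfl]
    omega

lemma buildable_game (r : ℕ) :
    Buildable (#({S | #S ≤ M} : Finset (Finset (V × C × Sg))) * (M ^ 3 * 2 + 1) +
      r * (#({S | #S ≤ M} : Finset (Finset (V × C × Sg))) *
        (#({S | #S ≤ M} : Finset (Finset (V × C × Sg))) * (Fintype.card V * Fintype.card C) *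
        (Fintype.card Sg + 2) + 2)))
      (game Viol e M r '' ({S | #S ≤ M} : Finset (Finset (V × C × Sg)))) := by
  induction r with
  | zero =>
    refine (Buildable.family _ (fun S hS => costLE_game_zero ?_) buildable_empty).mono
      (by omega) Set.subset_union_right
    simpa using hS
  | succ r ih =>
    refine (Buildable.family _ (fun S hS => costLE_game_succ ?_) ih).mono ?_
      Set.subset_union_right
    · simpa using hS
    · rw [Nat.succ_mul, add_assoc]

theorem exists_circuit_game (r : ℕ) :
    ∃ T : MonCircuit n, Computes T (game Viol e M r ∅) ∧
      T.size ≤ (r + 1) * (((Fintype.card (V × C × Sg) + 1) ^ M) ^ 2 *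
        (2 * M ^ 3 + 2 * Fintype.card V * Fintype.card C * (Fintype.card Sg + 2) + 3)) := by
  obtain ⟨L, h1, h2, h3⟩ := buildable_game (Viol := Viol) (e := e) (M := M) r
  obtain ⟨T, hT, hTL⟩ := h1.exists_circuit (h3 _ ⟨∅, by simp, rfl⟩)
  refine ⟨T, hT, hTL.trans (h2.trans ?_)⟩
  have hN := card_filter_card_le_succ_pow (E := V × C × Sg) M
  have hN1 : 1 ≤ #({S | #S ≤ M} : Finset (Finset (V × C × Sg))) :=
    card_pos.2 ⟨∅, by simp⟩
  set N := #({S | #S ≤ M} : Finset (Finset (V × C × Sg)))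
  have hNN : N ≤ N ^ 2 := Nat.le_self_pow (by norm_num) N
  set X := Fintype.card V * Fintype.card C * (Fintype.card Sg + 2) with hX
  calc N * (M ^ 3 * 2 + 1) + r * (N * (N * (Fintype.card V * Fintype.card C) *
        (Fintype.card Sg + 2) + 2))
      = N * (M ^ 3 * 2 + 1) + r * (N ^ 2 * X + 2 * N) := by rw [hX]; ring
    _ ≤ N ^ 2 * (M ^ 3 * 2 + 1) + r * (N ^ 2 * X + 2 * N ^ 2) := by gcongr
    _ ≤ (r + 1) * (N ^ 2 * (2 * M ^ 3 + 2 * X + 3)) := by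
        have h5 : 0 ≤ N ^ 2 * (2 * X + 2) + r * (N ^ 2 * (2 * M ^ 3 + X + 1)) := Nat.zero_le _
        nlinarith
    _ ≤ (r + 1) * (((Fintype.card (V × C × Sg) + 1) ^ M) ^ 2 * (2 * M ^ 3 + 2 * X + 3)) := by
        gcongr
    _ = _ := by rw [hX]; ring

end Game

section Parameters

open Finset

/-- The nodes at scale `K`. -/
abbrev ScaleNode (K : ℕ) : Type := Node K (2 ^ K - 1) (2 ^ (2 * K))

/-- The symbols at scale `K`. -/
abbrev ScaleSym (K : ℕ) : Type := Sym_s0 K (2 ^ K - 1) (2 ^ (2 * K))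

/-- The names under which the copies of a node at scale `K` are known. -/
abbrev ScaleName (K : ℕ) : Type := Fin (2 ^ (13 * K)) × Fin (2 ^ (7 * K))

/-- The triples of named nodes at scale `K`. -/
abbrev ScaleTriple (K : ℕ) : Type :=
  (ScaleNode K × ScaleName K) × (ScaleNode K × ScaleName K) × (ScaleNode K × ScaleName K)

lemma card_scaleNode_le (K : ℕ) : Fintype.card (ScaleNode K) ≤ 2 ^ (4 * K) := by
  have h1 : K + 1 ≤ 2 ^ K := Nat.lt_two_pow_self
  simp only [ScaleNode, Node, Fintype.card_prod, Fintype.card_fin]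
  rw [Nat.sub_add_cancel Nat.one_le_two_pow]
  calc (K + 1) * (2 ^ K * 2 ^ (2 * K)) ≤ 2 ^ K * (2 ^ K * 2 ^ (2 * K)) := by gcongr
    _ = 2 ^ (4 * K) := by ring

lemma card_scaleSym_le {K : ℕ} (hK : 0 < K) : Fintype.card (ScaleSym K) ≤ 2 ^ (7 * K) := by
  have h1 := card_scaleNode_le K
  simp only [ScaleSym, Sym_s0, Fintype.card_option, Fintype.card_prod (ScaleNode K), Fintype.card_fin]
  calc Fintype.card (ScaleNode K) * 2 ^ (2 * K) + 1 ≤ 2 ^ (4 * K) * 2 ^ (2 * K) + 1 := by gcongr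
    _ = 2 ^ (6 * K) + 1 := by ring
    _ ≤ 2 ^ (6 * K) + 2 ^ (6 * K) := by gcongr; exact Nat.one_le_two_pow
    _ = 2 ^ (6 * K + 1) := by ring
    _ ≤ 2 ^ (7 * K) := Nat.pow_le_pow_right (by norm_num) (by omega)

lemma card_scaleName (K : ℕ) : Fintype.card (ScaleName K) = 2 ^ (20 * K) := by
  simp only [ScaleName, Fintype.card_prod, Fintype.card_fin]
  ring

lemma card_scaleTriple_le (K : ℕ) : Fintype.card (ScaleTriple K) ≤ 2 ^ (72 * K) := by
  have h1 := card_scaleNode_le K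
  simp only [ScaleTriple, Fintype.card_prod (ScaleNode K × ScaleName K),
    Fintype.card_prod (ScaleNode K) (ScaleName K),
    card_scaleName]
  calc _ ≤ 2 ^ (4 * K) * 2 ^ (20 * K) * (2 ^ (4 * K) * 2 ^ (20 * K) *
        (2 ^ (4 * K) * 2 ^ (20 * K))) := by gcongr
    _ = 2 ^ (72 * K) := by ring

lemma card_scaleEntry_succ_le {K : ℕ} (hK : 0 < K) :
    Fintype.card (ScaleNode K × ScaleName K × ScaleSym K) + 1 ≤ 2 ^ (32 * K) := by
  have h1 := card_scaleNode_le K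
  have h2 := card_scaleSym_le hK
  rw [Fintype.card_prod, Fintype.card_prod (ScaleName K), card_scaleName]
  calc _ ≤ 2 ^ (4 * K) * (2 ^ (20 * K) * 2 ^ (7 * K)) + 1 := by gcongr
    _ = 2 ^ (31 * K) + 1 := by ring
    _ ≤ 2 ^ (31 * K) + 2 ^ (31 * K) := by gcongr; exact Nat.one_le_two_pow
    _ = 2 ^ (31 * K + 1) := by ring
    _ ≤ 2 ^ (32 * K) := Nat.pow_le_pow_right (by norm_num) (by omega)

/-- The hard function at scale `K`: the search wins against the truth table. -/
noncomputable def scaleGame (K : ℕ) {n : ℕ} (e : ScaleTriple K ↪ Fin n) : (Fin n → Bool) → Bool :=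
  game (Viol (K := K) (B := 2 ^ K - 1) (s := 2 ^ (2 * K))) e (K + 3)
    ((2 ^ K - 1) * (rounds (2 ^ K - 1) K + 1) + 1) ∅

lemma linear_le_two_pow {K : ℕ} (hK : 9 ≤ K) : 32 * K + 2 ≤ 2 ^ K := by
  induction K, hK using Nat.le_induction with
  | base => norm_num
  | succ K hK ih => rw [pow_succ]; omega

theorem two_pow_le_size {K n d : ℕ} (hK : 9 ≤ K) (e : ScaleTriple K ↪ Fin n) (T : MonCircuit n)
    (hT : Computes T (scaleGame K e)) (hd : CDepthLE T d)
    (hdK : 2 * 2 ^ K + 2 * 2 ^ K * d < (2 ^ K - 1) ^ K) : 2 ^ 2 ^ K ≤ T.size := by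
  by_contra! hlt
  have hlin := linear_le_two_pow hK
  have hV := card_scaleNode_le K
  have hSg := card_scaleSym_le (K := K) (by omega)
  obtain ⟨Ω, _, _, y, hy⟩ := exists_hits (ScaleNode K) (Fin (2 ^ (13 * K))) (Fin (2 ^ (7 * K)))
    (ScaleSym K) (2 ^ (19 * K)) (by
      rw [Fintype.card_fin]
      calc _ ≤ 2 * 2 ^ (4 * K) * (2 ^ (7 * K) * 2 ^ (7 * K)) := by gcongr
        _ = 2 ^ (18 * K + 1) := by ring
        _ ≤ 2 ^ (19 * K) := Nat.pow_le_pow_right (by norm_num) (by omega))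
    (by positivity) (2 ^ (2 * K)) (by
      rw [Fintype.card_fin]
      calc _ ≤ 2 ^ (2 * K) * (2 ^ (4 * K) * 2 ^ (13 * K)) := by gcongr
        _ = 2 ^ (19 * K) := by ring)
  have hsq : (2 : ℕ) ^ (2 * K) = 2 ^ K * 2 ^ K := by ring
  refine no_small_shallow_circuit
    (stackAdversary K (2 ^ K - 1) (2 ^ (2 * K)) (3 * 2 ^ K) _ (by omega) ?_ hdK) e hy
    ?_ ?_ le_rfl ?_ (fun x => ?_) (fun y => ?_) T hT hd ?_ ?_
  · rw [hsq]
    nlinarith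
  · exact Nat.le_mul_of_pos_right 2 (by positivity)
  · rw [card_scaleName]
    calc 4 * (2 * 2 ^ (19 * K)) = 2 ^ (19 * K + 3) := by ring
      _ ≤ 2 ^ (20 * K) := Nat.pow_le_pow_right (by norm_num) (by omega)
  · rw [hsq]
    nlinarith
  · have := game_yesInput (e := e) (win_empty (K := K) (B := 2 ^ K - 1) (s := 2 ^ (2 * K))
      (by omega) (by positivity)) x
    rwa [image_empty] at this
  · exact game_noInput (by simp)
  · have h4 : (4 : ℕ) ^ (2 ^ K + 1) = 2 ^ (2 ^ K) * 2 ^ (2 ^ K) * 4 := by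
      rw [pow_succ, ← mul_pow]; norm_num
    have h1 : 1 ≤ (2 : ℕ) ^ (2 ^ K) := Nat.one_le_two_pow
    rw [h4]
    nlinarith
  · calc _ ≤ 2 * (2 ^ 2 ^ K * (2 ^ (32 * K)) ^ 2 ^ K) := by
          gcongr
          exact card_scaleEntry_succ_le (by omega)
      _ = 2 ^ (1 + (2 ^ K + 32 * K * 2 ^ K)) := by
          rw [pow_add, pow_add, ← pow_mul, pow_one]
      _ ≤ 2 ^ 2 ^ (2 * K) := by
          refine Nat.pow_le_pow_right (by norm_num) ?_
          rw [hsq]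
          nlinarith

theorem exists_circuit_scaleGame {K n : ℕ} (hK : 9 ≤ K) (e : ScaleTriple K ↪ Fin n) :
    ∃ T : MonCircuit n, Computes T (scaleGame K e) ∧ T.size ≤ 2 ^ (300 * K ^ 2) := by
  obtain ⟨T, hT, hs⟩ := exists_circuit_game (Viol := Viol (K := K) (B := 2 ^ K - 1)
    (s := 2 ^ (2 * K))) (e := e) (M := K + 3) ((2 ^ K - 1) * (rounds (2 ^ K - 1) K + 1) + 1)
  refine ⟨T, hT, hs.trans ?_⟩
  have hlin := linear_le_two_pow hK
  have hV := card_scaleNode_le K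
  have hSg := card_scaleSym_le (K := K) (by omega)
  have hE := card_scaleEntry_succ_le (K := K) (by omega)
  have hr : (2 ^ K - 1) * (rounds (2 ^ K - 1) K + 1) + 1 + 1 ≤ 2 ^ ((K + 1) * (K + 1)) := by
    have h1 := rounds_succ_le (2 ^ K - 1) K
    have h2 : 2 ^ K - 1 + 2 ≤ 2 ^ (K + 1) := by rw [pow_succ]; omega
    calc _ ≤ (2 ^ K - 1 + 2) * (rounds (2 ^ K - 1) K + 1) := by
          rw [add_mul]; omega
      _ ≤ (2 ^ K - 1 + 2) * (2 ^ K - 1 + 2) ^ K := by gcongr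
      _ ≤ 2 ^ (K + 1) * (2 ^ (K + 1)) ^ K := by gcongr
      _ = 2 ^ ((K + 1) * (K + 1)) := by ring
  have hM : 2 * (K + 3) ^ 3 + 2 * Fintype.card (ScaleNode K) * Fintype.card (ScaleName K) *
      (Fintype.card (ScaleSym K) + 2) + 3 ≤ 2 ^ (40 * K) := by
    rw [card_scaleName]
    have h8 : (2 : ℕ) ^ 9 ≤ 2 ^ K := Nat.pow_le_pow_right (by norm_num) hK
    have hle : ∀ {i j : ℕ}, i ≤ j → (2 : ℕ) ^ i ≤ 2 ^ j := Nat.pow_le_pow_right (by norm_num)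
    have h3 : 2 * (K + 3) ^ 3 ≤ 2 ^ (39 * K) := by
      calc 2 * (K + 3) ^ 3 ≤ 2 * (2 ^ K) ^ 3 := by gcongr; omega
        _ = 2 ^ (3 * K + 1) := by ring
        _ ≤ _ := hle (by omega)
    have h4 : 2 * Fintype.card (ScaleNode K) * 2 ^ (20 * K) * (Fintype.card (ScaleSym K) + 2) ≤
        2 ^ (39 * K) := by
      calc _ ≤ 2 * 2 ^ (4 * K) * 2 ^ (20 * K) * (2 ^ (7 * K) + 2 ^ (7 * K)) := by
            gcongr
            exact Nat.le_self_pow (by omega) 2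
        _ = 2 ^ (31 * K + 2) := by ring
        _ ≤ _ := hle (by omega)
    have h5 : 3 ≤ 2 ^ (39 * K) := le_trans (by norm_num) (hle (show 2 ≤ 39 * K by omega))
    have h6 : (2 : ℕ) ^ (40 * K) = 2 ^ K * 2 ^ (39 * K) := by ring
    rw [h6]
    nlinarith
  calc _ ≤ 2 ^ ((K + 1) * (K + 1)) * (((2 ^ (32 * K)) ^ (K + 3)) ^ 2 * 2 ^ (40 * K)) := by
        gcongr
    _ = 2 ^ ((K + 1) * (K + 1) + (32 * K * ((K + 3) * 2) + 40 * K)) := by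
        rw [← pow_mul, ← pow_mul, ← pow_add, ← pow_add]
    _ ≤ 2 ^ (300 * K ^ 2) := by
        refine Nat.pow_le_pow_right (by norm_num) ?_
        nlinarith

open scoped Classical in
/-- The hard function on `n` bits: that of the largest scale that fits. -/
noncomputable def hardFun (n : ℕ) : (Fin n → Bool) → Bool :=
  if h : Nonempty (ScaleTriple (Nat.log 2 n / 72) ↪ Fin n) then
    scaleGame (Nat.log 2 n / 72) h.some
  else fun _ => false

lemma monotoneFun_hardFun (n : ℕ) : MonotoneFun (hardFun n) := by
  intro x y hxy
  rw [hardFun]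
  split_ifs
  · rw [Bool.le_iff_imp]
    exact game_mono hxy
  · exact le_rfl

lemma exists_hardFun_eq {n : ℕ} (hn : n ≠ 0) : ∃ e : ScaleTriple (Nat.log 2 n / 72) ↪ Fin n,
    hardFun n = scaleGame (Nat.log 2 n / 72) e := by
  have h : Nonempty (ScaleTriple (Nat.log 2 n / 72) ↪ Fin n) := by
    refine Function.Embedding.nonempty_of_card_le ?_
    rw [Fintype.card_fin]
    calc _ ≤ 2 ^ (72 * (Nat.log 2 n / 72)) := card_scaleTriple_le _
      _ ≤ 2 ^ Nat.log 2 n := Nat.pow_le_pow_right (by norm_num) (Nat.mul_div_le _ _)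
      _ ≤ n := Nat.pow_log_le_self 2 hn
  exact ⟨h.some, by rw [hardFun, dif_pos h]⟩

lemma le_log_div {n k : ℕ} (hn : 2 ^ (72 * k) ≤ n) : k ≤ Nat.log 2 n / 72 := by
  rw [Nat.le_div_iff_mul_le (by norm_num), mul_comm]
  exact Nat.le_log_of_pow_le (by norm_num) hn

lemma two_pow_log_div_le {n : ℕ} (hn : n ≠ 0) : 2 ^ (72 * (Nat.log 2 n / 72)) ≤ n :=
  (Nat.pow_le_pow_right (by norm_num) (Nat.mul_div_le _ _)).trans (Nat.pow_log_le_self 2 hn)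

lemma le_two_pow_log_div {n : ℕ} (hn : 1 ≤ Nat.log 2 n / 72) :
    n ≤ 2 ^ (144 * (Nat.log 2 n / 72)) :=
  (Nat.lt_pow_succ_log_self (by norm_num) n).le.trans
    (Nat.pow_le_pow_right (by norm_num) (by omega))

lemma two_pow_le_rpow_log {n K : ℕ} (hn : 2 ^ (72 * K) ≤ n) :
    (2 : ℝ) ^ (300 * K ^ 2) ≤ (n : ℝ) ^ (1 * Real.log n) := by
  have hn' : (2 : ℝ) ^ (72 * K) ≤ n := by exact_mod_cast hn
  have hpos : (0 : ℝ) < n := lt_of_lt_of_le (by positivity) hn'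
  have hlog : 72 * K * Real.log 2 ≤ Real.log n := by
    have := Real.log_le_log (by positivity) hn'
    rwa [Real.log_pow, Nat.cast_mul, Nat.cast_ofNat] at this
  rw [one_mul, Real.rpow_def_of_pos hpos, ← Real.rpow_natCast, Real.rpow_def_of_pos (by norm_num)]
  refine Real.exp_le_exp.2 ?_
  have h2 : (0.6931471803 : ℝ) < Real.log 2 := Real.log_two_gt_d9
  have h3 : (0 : ℝ) ≤ 72 * K * Real.log 2 := by positivity
  have h4 : (72 * K * Real.log 2) * (72 * K * Real.log 2) ≤ Real.log n * Real.log n :=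
    mul_le_mul hlog hlog h3 (h3.trans hlog)
  refine le_trans ?_ h4
  push_cast
  have h5 : (0 : ℝ) ≤ K ^ 2 * Real.log 2 * (5184 * Real.log 2 - 300) :=
    mul_nonneg (by positivity) (by linarith)
  nlinarith

lemma two_pow_mul_lt_pred_pow {K D d : ℕ} (hK : D + 4 ≤ K) (hd : d ≤ 2 ^ (D * K)) :
    2 * 2 ^ K + 2 * 2 ^ K * d < (2 ^ K - 1) ^ K := by
  have h1 : 1 ≤ (2 : ℕ) ^ (D * K) := Nat.one_le_two_pow
  obtain ⟨k, rfl⟩ : ∃ k, K = k + 1 := ⟨K - 1, by omega⟩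
  have h2 : 2 ^ k ≤ 2 ^ (k + 1) - 1 := by
    have : 1 ≤ (2 : ℕ) ^ k := Nat.one_le_two_pow
    rw [pow_succ]; omega
  calc 2 * 2 ^ (k + 1) + 2 * 2 ^ (k + 1) * d
      ≤ 2 * 2 ^ (k + 1) * 2 ^ (D * (k + 1)) + 2 * 2 ^ (k + 1) * 2 ^ (D * (k + 1)) := by
        exact add_le_add (Nat.le_mul_of_pos_right _ h1) (Nat.mul_le_mul_left _ hd)
    _ = 2 ^ ((D + 1) * (k + 1) + 2) := by ring
    _ < 2 ^ (k * (k + 1)) := by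
        refine Nat.pow_lt_pow_right (by norm_num) ?_
        have : (D + 3) * (k + 1) ≤ k * (k + 1) := Nat.mul_le_mul_right _ (by omega)
        nlinarith
    _ = (2 ^ k) ^ (k + 1) := by rw [pow_mul]
    _ ≤ (2 ^ (k + 1) - 1) ^ (k + 1) := by gcongr

lemma natCast_rpow_le_two_pow {n m : ℕ} (hn : n ≤ 2 ^ m) {c : ℝ} (hc : 0 ≤ c) {k : ℕ}
    (hk : m * c ≤ k) : (n : ℝ) ^ c ≤ 2 ^ k := by
  have hn' : (n : ℝ) ≤ 2 ^ m := by exact_mod_cast hn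
  calc (n : ℝ) ^ c ≤ ((2 : ℝ) ^ m) ^ c := by gcongr
    _ = (2 : ℝ) ^ ((m : ℝ) * c) := by rw [← Real.rpow_natCast, ← Real.rpow_mul (by norm_num)]
    _ ≤ (2 : ℝ) ^ (k : ℝ) := Real.rpow_le_rpow_of_exponent_le (by norm_num) hk
    _ = 2 ^ k := Real.rpow_natCast 2 k

end Parameters

/-- Supercritical size-depth tradeoff for monotone circuits. -/
theorem monotone_circuit_supercritical_tradeoff :
    ∃ a : ℝ, 0 < a ∧
    ∃ f : (N : ℕ) → (Fin N → Bool) → Bool,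
      (∀ N, MonotoneFun (f N)) ∧
      (∃ N₀ : ℕ, ∀ n ≥ N₀, ∃ C : MonCircuit n, Computes C (f n) ∧
        (C.size : ℝ) ≤ (n : ℝ) ^ (a * Real.log n)) ∧
      (∀ c : ℝ, 0 < c → ∃ ε : ℝ, 0 < ε ∧ ∃ n₀ : ℕ, ∀ n ≥ n₀,
        ∀ C : MonCircuit n, Computes C (f n) →
          ∀ d : ℕ, CDepthLE C d → (d : ℝ) ≤ (n : ℝ) ^ c →
            (2 : ℝ) ^ ((n : ℝ) ^ ε) ≤ (C.size : ℝ)) := by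
  have hne : ∀ {n k : ℕ}, 2 ^ k ≤ n → n ≠ 0 := fun h =>
    (lt_of_lt_of_le (by positivity) h).ne'
  refine ⟨1, one_pos, hardFun, monotoneFun_hardFun, ⟨2 ^ (72 * 9), fun n hn => ?_⟩,
    fun c hc => ⟨1 / 144, by norm_num, 2 ^ (72 * (⌈144 * c⌉₊ + 9)), ?_⟩⟩
  · obtain ⟨e, he⟩ := exists_hardFun_eq (hne hn)
    obtain ⟨T, hT, hs⟩ := exists_circuit_scaleGame (le_log_div hn) e
    refine ⟨T, by rwa [he], le_trans ?_ (two_pow_le_rpow_log (two_pow_log_div_le (hne hn)))⟩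
    exact_mod_cast hs
  · intro n hn T hT d hd hdn
    obtain ⟨e, he⟩ := exists_hardFun_eq (hne hn)
    rw [he] at hT
    have hK := le_log_div hn
    have hnK := le_two_pow_log_div (n := n) (by omega)
    generalize Nat.log 2 n / 72 = K at *
    have hdK : d ≤ 2 ^ (⌈144 * c⌉₊ * K) := by
      have h1 : (n : ℝ) ^ c ≤ 2 ^ (⌈144 * c⌉₊ * K) := by
        refine natCast_rpow_le_two_pow hnK hc.le ?_
        push_cast
        have h2 := mul_le_mul_of_nonneg_right (Nat.le_ceil (144 * c)) (Nat.cast_nonneg (α := ℝ) K)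
        linarith
      exact_mod_cast hdn.trans h1
    have hsize := two_pow_le_size (by omega) e T hT hd
      (two_pow_mul_lt_pred_pow (by omega) hdK)
    have hnw : (n : ℝ) ^ (1 / 144 : ℝ) ≤ 2 ^ K :=
      natCast_rpow_le_two_pow hnK (by norm_num) (by push_cast; linarith)
    calc (2 : ℝ) ^ ((n : ℝ) ^ (1 / 144 : ℝ)) ≤ (2 : ℝ) ^ ((2 ^ K : ℕ) : ℝ) := by
          refine Real.rpow_le_rpow_of_exponent_le (by norm_num) ?_
          exact_mod_cast hnw
      _ = ((2 ^ 2 ^ K : ℕ) : ℝ) := by rw [Real.rpow_natCast]; push_cast; rfl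
      _ ≤ T.size := by exact_mod_cast hsize

end Paper
end

section
/- There is a constant a > 0 such that for every sufficiently large n, the 3-CNF formula ExBracket_n admits a resolution refutation of width at most a·log n. -/
namespace Paper


/-! ### Bracket symbols, partial states, and the bracket axioms (A1)-(A4) -/

inductive BType : Type
  | trivR | trivB | openR | openB | closeR | closeB
  deriving DecidableEq

structure Sym (n : ℕ) where
  b : BType
  p : Fin n
  deriving DecidableEq

/-- Partial assignment of bracket symbols to positions (`none` = `*`). -/
abbrev PState (n : ℕ) := Fin n → Option (Sym n)

/-- Positions `i` and `j` are paired (pointers point at each other). -/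
def Paired {n : ℕ} (ρ : PState n) (i j : Fin n) : Prop :=
  ∃ σ τ : Sym n, ρ i = some σ ∧ ρ j = some τ ∧ σ.p = j ∧ τ.p = i

/-- Axiom (A1) is falsified: start/end of string condition fails on assigned entries. -/
def ViolA1 {n : ℕ} (ρ : PState n) : Prop :=
  (∃ i : Fin n, (i : ℕ) = 0 ∧ ∃ σ, ρ i = some σ ∧ ¬(σ.b = BType.trivR ∨ σ.b = BType.openR)) ∨
  (∃ i : Fin n, (i : ℕ) = n - 1 ∧ ∃ σ, ρ i = some σ ∧ ¬(σ.b = BType.trivB ∨ σ.b = BType.closeB))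

/-- Axiom (A2) is falsified: pointers fail to define colour-matched bracket pairs. -/
def ViolA2 {n : ℕ} (ρ : PState n) : Prop :=
  (∃ i j : Fin n, ∃ σ τ : Sym n, ρ i = some σ ∧ ρ j = some τ ∧ σ.p = j ∧ τ.p ≠ i) ∨
  (∃ i : Fin n, ∃ σ : Sym n, ρ i = some σ ∧ σ.p = i ∧
    ¬(σ.b = BType.trivR ∨ σ.b = BType.trivB)) ∨
  (∃ i j : Fin n, ∃ σ τ : Sym n, i < j ∧ ρ i = some σ ∧ ρ j = some τ ∧ σ.p = j ∧ τ.p = i ∧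
    ¬((σ.b = BType.openR ∧ τ.b = BType.closeR) ∨ (σ.b = BType.openB ∧ τ.b = BType.closeB)))

/-- Axiom (A3) is falsified: two pairs are incorrectly nested. -/
def ViolA3 {n : ℕ} (ρ : PState n) : Prop :=
  ∃ i i' j j' : Fin n, Paired ρ i j ∧ Paired ρ i' j' ∧ i < i' ∧ i' < j ∧ j < j'

/-- Axiom (A4) is falsified: a red-to-blue transition occurs at consecutive indices. -/
def ViolA4 {n : ℕ} (ρ : PState n) : Prop :=
  ∃ i j : Fin n, (j : ℕ) = (i : ℕ) + 1 ∧ ∃ σ τ : Sym n, ρ i = some σ ∧ ρ j = some τ ∧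
    (σ.b = BType.closeR ∨ σ.b = BType.trivR) ∧ (τ.b = BType.openB ∨ τ.b = BType.trivB)

/-- The partial state falsifies one of the axioms (A1)-(A4). -/
def Falsifies {n : ℕ} (ρ : PState n) : Prop := ViolA1 ρ ∨ ViolA2 ρ ∨ ViolA3 ρ ∨ ViolA4 ρ

/-- A partial assignment is consistent if it falsifies no axiom. -/
def ConsistentPS {n : ℕ} (ρ : PState n) : Prop := ¬ Falsifies ρ


/-! ### Clauses, CNFs and resolution refutations -/

/-- A clause: a finite set of literals (variable, polarity), read as a disjunction. -/
abbrev Clause (V : Type) := Finset (V × Bool)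

/-- An assignment satisfies a clause if it satisfies some literal of it. -/
def SatC {V : Type} (α : V → Bool) (C : Clause V) : Prop := ∃ l ∈ C, α l.1 = l.2

/-- A set of clauses is unsatisfiable. -/
def Unsat {V : Type} (F : Set (Clause V)) : Prop := ∀ α : V → Bool, ∃ C ∈ F, ¬ SatC α C

/-- A resolution refutation of `F`: a sequence of clauses ending in the empty clause,
each clause either in `F` or obtained from two earlier clauses by the resolution rule
(the premises being recorded in `prem`). -/
structure Refutation (V : Type) [DecidableEq V] (F : Set (Clause V)) where
  size : ℕ
  size_pos : 0 < size
  clause : Fin size → Clause V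
  prem : Fin size → Option (Fin size × Fin size × V)
  ok : ∀ i : Fin size,
    match prem i with
    | none => clause i ∈ F
    | some (j, k, x) =>
        j < i ∧ k < i ∧ (x, true) ∈ clause j ∧ (x, false) ∈ clause k ∧
          clause i = (clause j).erase (x, true) ∪ (clause k).erase (x, false)
  last_empty : clause ⟨size - 1, Nat.sub_lt size_pos Nat.one_pos⟩ = ∅

/-- The refutation has width at most `w`. -/
def WidthLE {V : Type} [DecidableEq V] {F : Set (Clause V)}
    (R : Refutation V F) (w : ℕ) : Prop :=
  ∀ i, (R.clause i).card ≤ w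

/-- The refutation has depth (longest path in the derivation DAG) at most `d`,
witnessed by a height function. -/
def DepthLE {V : Type} [DecidableEq V] {F : Set (Clause V)}
    (R : Refutation V F) (d : ℕ) : Prop :=
  ∃ h : Fin R.size → ℕ, (∀ i, h i ≤ d) ∧
    ∀ i j k x, R.prem i = some (j, k, x) → h j < h i ∧ h k < h i


/-! ### Index-width and the extension-variable 3-CNF encoding -/

/-- Index-width of a clause: number of blocks (w.r.t. the block map `blk`) it mentions. -/
def iw {V : Type} {nB : ℕ} [DecidableEq V] (blk : V → Fin nB) (C : Clause V) : ℕ :=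
  (C.image fun l => blk l.1).card

/-- The refutation has index-width at most `w`. -/
def IndexWidthLE {V : Type} [DecidableEq V] {nB : ℕ} {F : Set (Clause V)}
    (blk : V → Fin nB) (R : Refutation V F) (w : ℕ) : Prop :=
  ∀ i, iw blk (R.clause i) ≤ w

theorem iw_mono {V : Type} {nB : ℕ} [DecidableEq V] (blk : V → Fin nB)
    {A B : Clause V} (h : A ⊆ B) : iw blk A ≤ iw blk B :=
  Finset.card_le_card (Finset.image_subset_image h)

/-- Extension variables: one variable `y_D` for every clause `D` of index-width at most `k`. -/
abbrev ExtVar {V : Type} {nB : ℕ} [DecidableEq V] (blk : V → Fin nB) (k : ℕ) : Type :=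
  {D : Clause V // iw blk D ≤ k}

/-- The extension-variable 3-CNF encoding `F'` of a CNF `F` of index-width `k`:
unit clauses `y_D` for `D ∈ F`; clauses forcing `y_{¬x} = ¬ y_x`; and clauses forcing
`y_{A ∨ B} ↔ (y_A ∨ y_B)` for all clauses of index-width at most `k`. -/
def ExtEnc {V : Type} {nB : ℕ} [DecidableEq V] (blk : V → Fin nB) (k : ℕ)
    (F : Set (Clause V)) : Set (Clause (ExtVar blk k)) :=
  { C | (∃ D ∈ F, ∃ h : iw blk D ≤ k, C = {((⟨D, h⟩ : ExtVar blk k), true)}) ∨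
        (∃ x : V, ∃ hp : iw blk ({(x, true)} : Clause V) ≤ k,
            ∃ hn : iw blk ({(x, false)} : Clause V) ≤ k,
          C = {((⟨{(x, true)}, hp⟩ : ExtVar blk k), true), (⟨{(x, false)}, hn⟩, true)} ∨
          C = {((⟨{(x, true)}, hp⟩ : ExtVar blk k), false), (⟨{(x, false)}, hn⟩, false)}) ∨
        (∃ A B : Clause V, ∃ hA : iw blk A ≤ k, ∃ hB : iw blk B ≤ k,
            ∃ hD : iw blk (A ∪ B) ≤ k,
          C = {((⟨A ∪ B, hD⟩ : ExtVar blk k), false), (⟨A, hA⟩, true), (⟨B, hB⟩, true)} ∨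
          C = {((⟨A ∪ B, hD⟩ : ExtVar blk k), true), (⟨A, hA⟩, false)} ∨
          C = {((⟨A ∪ B, hD⟩ : ExtVar blk k), true), (⟨B, hB⟩, false)}) }


/-! ### The bracket formula and its 3-CNF version -/

/-- Number of bits per block: `⌈log₂ |Σ|⌉` with `|Σ| = 6n`. -/
def mBits (n : ℕ) : ℕ := Nat.clog 2 (6 * n)

/-- Boolean variables of the bracket formula: `mBits n` variables per index. -/
abbrev BVar (n : ℕ) := Fin n × Fin (mBits n)

/-- The partial assignment equal to `s` on `S` and `*` elsewhere. -/
def partialOn {n : ℕ} (S : Finset (Fin n)) (s : Fin n → Sym n) : PState n :=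
  fun i => if i ∈ S then some (s i) else none

/-- The CNF formula `Bracket_n` (w.r.t. an encoding `π` of symbols by `mBits n` bits):
all clauses mentioning at most 4 blocks that are implied by the bracket constraint on
those blocks. -/
def BracketCNF (n : ℕ) (π : Sym n → Fin (mBits n) → Bool) : Set (Clause (BVar n)) :=
  { C | ∃ S : Finset (Fin n), S.card ≤ 4 ∧ (∀ l ∈ C, l.1.1 ∈ S) ∧
      ∀ α : BVar n → Bool,
        (∃ s : Fin n → Sym n, (∀ i ∈ S, ∀ j, α (i, j) = π (s i) j) ∧
          ConsistentPS (partialOn S s)) →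
        SatC α C }

/-- The 3-CNF formula `ExBracket_n`: the extension-variable encoding of `Bracket_n`
(whose index-width is 4). -/
def ExBracketCNF (n : ℕ) (π : Sym n → Fin (mBits n) → Bool) :
    Set (Clause (ExtVar (Prod.fst : BVar n → Fin n) 4)) :=
  ExtEnc Prod.fst 4 (BracketCNF n π)


/-! ### Width-bounded resolution derivations -/

/-- Clauses derivable from `F` by a resolution derivation of width at most `w`. -/
inductive WidthDer {V : Type} [DecidableEq V] (F : Set (Clause V)) (w : ℕ) : Clause V → Prop
  | ax {C : Clause V} (hC : C ∈ F) (hw : C.card ≤ w) : WidthDer F w C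
  | res {A B : Clause V} {x : V} (hA : WidthDer F w A) (hB : WidthDer F w B)
      (hxA : (x, true) ∈ A) (hxB : (x, false) ∈ B)
      (hw : (A.erase (x, true) ∪ B.erase (x, false)).card ≤ w) :
      WidthDer F w (A.erase (x, true) ∪ B.erase (x, false))

/-- Lists of clauses, each of which is in `F` or a resolvent of two earlier ones. -/
inductive DerivList {V : Type} [DecidableEq V] (F : Set (Clause V)) : List (Clause V) → Prop
  | nil : DerivList F []
  | ax {l : List (Clause V)} {C : Clause V} (hl : DerivList F l) (hC : C ∈ F) :
      DerivList F (l ++ [C])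
  | res {l : List (Clause V)} {A B : Clause V} {x : V} (hl : DerivList F l)
      (hA : A ∈ l) (hB : B ∈ l) (hxA : (x, true) ∈ A) (hxB : (x, false) ∈ B) :
      DerivList F (l ++ [A.erase (x, true) ∪ B.erase (x, false)])

section Derivations

variable {V : Type} [DecidableEq V] {F : Set (Clause V)} {w : ℕ}

theorem DerivList.append {l₁ l₂ : List (Clause V)} (h₁ : DerivList F l₁)
    (h₂ : DerivList F l₂) : DerivList F (l₁ ++ l₂) := by
  induction h₂ with
  | nil => simpa using h₁
  | ax _ hC ih => rw [← List.append_assoc]; exact ih.ax hC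
  | res _ hA hB hxA hxB ih =>
    rw [← List.append_assoc]
    exact ih.res (List.mem_append_right _ hA) (List.mem_append_right _ hB) hxA hxB

theorem WidthDer.exists_derivList {C : Clause V} (h : WidthDer F w C) :
    ∃ l : List (Clause V), DerivList F (l ++ [C]) ∧ ∀ D ∈ l ++ [C], D.card ≤ w := by
  induction h with
  | ax hC hw => exact ⟨[], DerivList.nil.ax hC, by simpa using hw⟩
  | @res A B x _ _ hxA hxB hw ihA ihB =>
    obtain ⟨lA, hA, wA⟩ := ihA
    obtain ⟨lB, hB, wB⟩ := ihB
    refine ⟨(lA ++ [A]) ++ (lB ++ [B]), (hA.append hB).res (by simp) (by simp) hxA hxB, ?_⟩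
    intro D hD
    rcases List.mem_append.1 hD with hD | hD
    · rcases List.mem_append.1 hD with hD | hD
      · exact wA D hD
      · exact wB D hD
    · rw [List.mem_singleton.1 hD]; exact hw

theorem DerivList.exists_prem {l : List (Clause V)} (h : DerivList F l) :
    ∀ (i : ℕ) (hi : i < l.length), l[i] ∈ F ∨
      ∃ (j k : ℕ) (hj : j < i) (hk : k < i) (x : V),
        (x, true) ∈ l[j] ∧ (x, false) ∈ l[k] ∧
          l[i] = l[j].erase (x, true) ∪ l[k].erase (x, false) := by
  have step : ∀ (l : List (Clause V)) (C : Clause V),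
      (∀ (i : ℕ) (hi : i < l.length), l[i] ∈ F ∨
        ∃ (j k : ℕ) (hj : j < i) (hk : k < i) (x : V),
          (x, true) ∈ l[j] ∧ (x, false) ∈ l[k] ∧
            l[i] = l[j].erase (x, true) ∪ l[k].erase (x, false)) →
      (C ∈ F ∨ ∃ A ∈ l, ∃ B ∈ l, ∃ x : V, (x, true) ∈ A ∧ (x, false) ∈ B ∧
        C = A.erase (x, true) ∪ B.erase (x, false)) →
      ∀ (i : ℕ) (hi : i < (l ++ [C]).length), (l ++ [C])[i] ∈ F ∨
        ∃ (j k : ℕ) (hj : j < i) (hk : k < i) (x : V),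
          (x, true) ∈ (l ++ [C])[j] ∧ (x, false) ∈ (l ++ [C])[k] ∧
            (l ++ [C])[i] = (l ++ [C])[j].erase (x, true) ∪ (l ++ [C])[k].erase (x, false) := by
    intro l C ih hC i hi
    by_cases hil : i < l.length
    · rcases ih i hil with h | ⟨j, k, hj, hk, x, h₁, h₂, h₃⟩
      · left; rwa [List.getElem_append_left hil]
      · right
        refine ⟨j, k, hj, hk, x, ?_⟩
        rw [List.getElem_append_left hil, List.getElem_append_left (hj.trans hil),
          List.getElem_append_left (hk.trans hil)]
        exact ⟨h₁, h₂, h₃⟩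
    · obtain rfl : i = l.length := by simp at hi; omega
      rcases hC with h | ⟨A, hA, B, hB, x, h₁, h₂, h₃⟩
      · left; simpa using h
      · obtain ⟨j, hj, rfl⟩ := List.mem_iff_getElem.1 hA
        obtain ⟨k, hk, rfl⟩ := List.mem_iff_getElem.1 hB
        right
        refine ⟨j, k, hj, hk, x, ?_⟩
        rw [List.getElem_append_left hj, List.getElem_append_left hk]
        exact ⟨h₁, h₂, by simpa using h₃⟩
  induction h with
  | nil => intro i hi; simp at hi
  | ax _ hC ih => exact step _ _ ih (Or.inl hC)
  | res _ hA hB hxA hxB ih => exact step _ _ ih (Or.inr ⟨_, hA, _, hB, _, hxA, hxB, rfl⟩)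

theorem WidthDer.exists_refutation (h : WidthDer F w ∅) :
    ∃ R : Refutation V F, WidthLE R w := by
  classical
  obtain ⟨l, hl, hw⟩ := h.exists_derivList
  set L := l ++ [(∅ : Clause V)] with hL
  have hlen : L.length = l.length + 1 := by simp [hL]
  have key : ∀ i : Fin L.length, ∃ p : Option (Fin L.length × Fin L.length × V),
      match p with
      | none => L[i] ∈ F
      | some (j, k, x) =>
          j < i ∧ k < i ∧ (x, true) ∈ L[j] ∧ (x, false) ∈ L[k] ∧
            L[i] = (L[j]).erase (x, true) ∪ (L[k]).erase (x, false) := by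
    intro i
    rcases hl.exists_prem i i.2 with h | ⟨j, k, hj, hk, x, h₁, h₂, h₃⟩
    · exact ⟨none, h⟩
    · exact ⟨some (⟨j, hj.trans i.2⟩, ⟨k, hk.trans i.2⟩, x), hj, hk, h₁, h₂, h₃⟩
  choose prem hprem using key
  refine ⟨⟨L.length, by omega, fun i => L[i], prem, fun i => ?_, ?_⟩, fun i => ?_⟩
  · have := hprem i
    cases hp : prem i <;> rw [hp] at this <;> exact this
  · simp [hL]
  · exact hw _ (List.getElem_mem _)

/-- Some subclause of `C` is derivable from `F` in width `w`. -/
def WeakDer (F : Set (Clause V)) (w : ℕ) (C : Clause V) : Prop :=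
  ∃ C' ⊆ C, WidthDer F w C'

theorem WeakDer.mono {C D : Clause V} (h : WeakDer F w C) (hCD : C ⊆ D) : WeakDer F w D :=
  let ⟨C', hC', h'⟩ := h
  ⟨C', hC'.trans hCD, h'⟩

theorem WeakDer.of_mem {A C : Clause V} (hA : A ∈ F) (hAC : A ⊆ C) (hw : A.card ≤ w) :
    WeakDer F w C :=
  ⟨A, hAC, .ax hA hw⟩

theorem WeakDer.query (x : V) {C : Clause V} (hw : C.card ≤ w)
    (ht : WeakDer F w (insert (x, true) C)) (hf : WeakDer F w (insert (x, false) C)) :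
    WeakDer F w C := by
  obtain ⟨A, hA, dA⟩ := ht
  obtain ⟨B, hB, dB⟩ := hf
  by_cases hxA : (x, true) ∈ A
  · by_cases hxB : (x, false) ∈ B
    · have hsub : A.erase (x, true) ∪ B.erase (x, false) ⊆ C :=
        Finset.union_subset (Finset.subset_insert_iff.1 hA) (Finset.subset_insert_iff.1 hB)
      exact ⟨_, hsub, .res dA dB hxA hxB ((Finset.card_le_card hsub).trans hw)⟩
    · exact ⟨B, (Finset.subset_insert_iff_of_notMem hxB).1 hB, dB⟩
  · exact ⟨A, (Finset.subset_insert_iff_of_notMem hxA).1 hA, dA⟩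

theorem WeakDer.exists_refutation (h : WeakDer F w ∅) : ∃ R : Refutation V F, WidthLE R w := by
  obtain ⟨C, hC, d⟩ := h
  rw [Finset.subset_empty.1 hC] at d
  exact d.exists_refutation

end Derivations

/-! ### Reasoning with extension variables -/

section Extension

variable {V : Type} [DecidableEq V] {nB : ℕ} {blk : V → Fin nB} {k : ℕ} {F : Set (Clause V)}
  {w : ℕ}

theorem iw_singleton_le (hk : 1 ≤ k) (l : V × Bool) : iw blk {l} ≤ k := by
  simpa [iw] using hk

theorem iw_empty_le : iw blk ∅ ≤ k := by simp [iw]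

/-- The literals `y_x` and `y_{¬x}` cannot both hold. -/
theorem WeakDer.literal_conflict (hk : 1 ≤ k) (hw : 3 ≤ w) (x : V)
    {C : Clause (ExtVar blk k)}
    (ht : ((⟨{(x, true)}, iw_singleton_le hk _⟩ : ExtVar blk k), false) ∈ C)
    (hf : ((⟨{(x, false)}, iw_singleton_le hk _⟩ : ExtVar blk k), false) ∈ C) :
    WeakDer (ExtEnc blk k F) w C := by
  refine .of_mem (A := {((⟨{(x, true)}, iw_singleton_le hk _⟩ : ExtVar blk k), false),
    (⟨{(x, false)}, iw_singleton_le hk _⟩, false)}) ?_ ?_ ?_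
  · exact Or.inr (Or.inl ⟨x, _, _, Or.inr rfl⟩)
  · simp [Finset.insert_subset_iff, ht, hf]
  · exact Finset.card_le_two.trans (by omega)

theorem WeakDer.query_literal (hk : 1 ≤ k) (x : V) {C : Clause (ExtVar blk k)}
    (hw : C.card + 3 ≤ w)
    (h : ∀ b : Bool, WeakDer (ExtEnc blk k F) w
      (insert ((⟨{(x, b)}, iw_singleton_le hk _⟩ : ExtVar blk k), true) C)) :
    WeakDer (ExtEnc blk k F) w C := by
  refine .query ⟨{(x, true)}, iw_singleton_le hk _⟩ (by omega) (h true) ?_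
  refine .query ⟨{(x, false)}, iw_singleton_le hk _⟩
    ((Finset.card_insert_le _ _).trans (by omega)) ?_ ?_
  · exact (h false).mono (Finset.insert_subset_insert _ (Finset.subset_insert _ _))
  · exact .literal_conflict hk (by omega) x (by simp) (by simp)

/-- The variable `y_∅` is false. -/
theorem WeakDer.of_empty (hk : 1 ≤ k) (x : V) {C : Clause (ExtVar blk k)}
    (hw : C.card + 3 ≤ w) (hC : ((⟨∅, iw_empty_le⟩ : ExtVar blk k), false) ∈ C) :
    WeakDer (ExtEnc blk k F) w C := by
  refine .query_literal hk x hw fun b => ?_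
  refine .of_mem (A := {((⟨{(x, b)}, iw_singleton_le hk _⟩ : ExtVar blk k), true),
    (⟨∅, iw_empty_le⟩, false)}) ?_ ?_ ?_
  · refine Or.inr (Or.inr ⟨∅, {(x, b)}, iw_empty_le, iw_singleton_le hk _, ?_,
      Or.inr (Or.inl ?_)⟩)
    · rw [Finset.empty_union]; exact iw_singleton_le hk _
    · simp only [Finset.empty_union]
  · refine Finset.insert_subset_insert _ ?_
    simpa using hC
  · exact Finset.card_le_two.trans (by omega)

/-- If `y_{f i}` is false for all `i ∈ T`, then so is `y_D` for `D` the union of the `f i`. -/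
theorem WeakDer.of_biUnion (hk : 1 ≤ k) (x : V) {ι : Type} [DecidableEq ι] (f : ι → Clause V)
    (hf : ∀ i, iw blk (f i) ≤ k) {C : Clause (ExtVar blk k)} (hw : C.card + 4 ≤ w)
    (T : Finset ι) (hC : ∀ i ∈ T, ((⟨f i, hf i⟩ : ExtVar blk k), true) ∈ C)
    (hT : iw blk (T.biUnion f) ≤ k) :
    WeakDer (ExtEnc blk k F) w (insert ((⟨T.biUnion f, hT⟩ : ExtVar blk k), false) C) := by
  induction T using Finset.induction_on with
  | empty =>
    refine .of_empty hk x ?_ (Finset.mem_insert_self _ _)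
    have := Finset.card_insert_le ((⟨(∅ : Finset ι).biUnion f, hT⟩ : ExtVar blk k), false) C
    omega
  | insert i T _ ih =>
    have hT' : iw blk (T.biUnion f) ≤ k :=
      (iw_mono blk (Finset.biUnion_subset_biUnion_of_subset_left f
        (Finset.subset_insert i T))).trans hT
    refine .query ⟨T.biUnion f, hT'⟩ ((Finset.card_insert_le _ _).trans (by omega)) ?_ ?_
    · refine .of_mem (A := {((⟨(insert i T).biUnion f, hT⟩ : ExtVar blk k), false),
        (⟨f i, hf i⟩, true), (⟨T.biUnion f, hT'⟩, true)}) ?_ ?_ ?_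
      · refine Or.inr (Or.inr ⟨f i, T.biUnion f, hf i, hT', ?_, Or.inl ?_⟩)
        · rwa [← Finset.biUnion_insert]
        · simp only [Finset.biUnion_insert]
      · have := hC i (Finset.mem_insert_self _ _)
        simp [Finset.insert_subset_iff, this]
      · exact Finset.card_le_three.trans (by omega)
    · exact (ih (fun j hj => hC j (Finset.mem_insert_of_mem hj)) hT').mono
        (Finset.insert_subset_insert _ (Finset.subset_insert _ _))

/-- A clause of `F` which is a union of clauses `f i` with all `y_{f i}` false is a conflict. -/
theorem WeakDer.of_biUnion_mem (hk : 1 ≤ k) (x : V) {ι : Type} [DecidableEq ι]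
    (f : ι → Clause V) (hf : ∀ i, iw blk (f i) ≤ k) {C : Clause (ExtVar blk k)}
    (hw : C.card + 4 ≤ w) (T : Finset ι)
    (hC : ∀ i ∈ T, ((⟨f i, hf i⟩ : ExtVar blk k), true) ∈ C)
    (hT : iw blk (T.biUnion f) ≤ k) (hF : T.biUnion f ∈ F) :
    WeakDer (ExtEnc blk k F) w C := by
  refine .query ⟨T.biUnion f, hT⟩ (by omega) ?_ (.of_biUnion hk x f hf hw T hC hT)
  refine .of_mem (A := {((⟨T.biUnion f, hT⟩ : ExtVar blk k), true)}) ?_ (by simp) ?_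
  · exact Or.inl ⟨_, hF, hT, rfl⟩
  · rw [Finset.card_singleton]; omega

/-- Query all the variables `v j` with `j ∈ J`. -/
theorem WeakDer.query_literals (hk : 1 ≤ k) {ι : Type} [DecidableEq ι] (v : ι → V)
    {C : Clause (ExtVar blk k)} (J : Finset ι) (hw : C.card + J.card + 3 ≤ w)
    (h : ∀ β : ι → Bool, WeakDer (ExtEnc blk k F) w
      (C ∪ J.image fun j => ((⟨{(v j, β j)}, iw_singleton_le hk _⟩ : ExtVar blk k), true))) :
    WeakDer (ExtEnc blk k F) w C := by
  induction J using Finset.induction_on with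
  | empty => simpa using h fun _ => true
  | insert j J hj ih =>
    rw [Finset.card_insert_of_notMem hj] at hw
    refine ih (by omega) fun β => ?_
    refine .query_literal hk (v j) ?_ fun b => ?_
    · have h₁ := Finset.card_union_le C (J.image fun j =>
        ((⟨{(v j, β j)}, iw_singleton_le hk _⟩ : ExtVar blk k), true))
      have h₂ := Finset.card_image_le (s := J) (f := fun j =>
        ((⟨{(v j, β j)}, iw_singleton_le hk _⟩ : ExtVar blk k), true))
      omega
    · refine (h (Function.update β j b)).mono ?_
      intro y hy
      rcases Finset.mem_union.1 hy with hy | hy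
      · exact Finset.mem_insert_of_mem (Finset.mem_union_left _ hy)
      · obtain ⟨i, hi, rfl⟩ := Finset.mem_image.1 hy
        by_cases hij : i = j
        · subst hij; simp
        · have hiJ := (Finset.mem_insert.1 hi).resolve_left hij
          refine Finset.mem_insert_of_mem (Finset.mem_union_right _ ?_)
          exact Finset.mem_image.2 ⟨i, hiJ, by simp [hij]⟩

end Extension

/-! ### The refutation of the bracket formula -/

section Bracket

variable {n : ℕ} {π : Sym n → Fin (mBits n) → Bool} {w : ℕ}

/-- The clause over block `i` excluding exactly the value `β`. -/
def blockClause (i : Fin n) (β : Fin (mBits n) → Bool) : Clause (BVar n) :=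
  Finset.univ.biUnion fun j => {((i, j), !β j)}

theorem mem_blockClause {i : Fin n} {β : Fin (mBits n) → Bool} {l : BVar n × Bool} :
    l ∈ blockClause i β ↔ ∃ j, l = ((i, j), !β j) := by
  simp [blockClause]

theorem iw_le_of_blocks {C : Clause (BVar n)} (S : Finset (Fin n)) (hS : S.card ≤ 4)
    (h : ∀ l ∈ C, l.1.1 ∈ S) : iw (Prod.fst : BVar n → Fin n) C ≤ 4 :=
  (Finset.card_le_card (Finset.image_subset_iff.2 h)).trans hS

theorem iw_blockClause_le (i : Fin n) (β : Fin (mBits n) → Bool) :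
    iw (Prod.fst : BVar n → Fin n) (blockClause i β) ≤ 4 := by
  refine iw_le_of_blocks {i} (by simp) fun l hl => ?_
  obtain ⟨j, rfl⟩ := mem_blockClause.1 hl
  simp

/-- The literal of the extended formula stating that the block of `i` is not `β`. -/
def blockLit (i : Fin n) (β : Fin (mBits n) → Bool) :
    ExtVar (Prod.fst : BVar n → Fin n) 4 × Bool :=
  (⟨blockClause i β, iw_blockClause_le i β⟩, true)

theorem eq_of_not_satC_blockClause {α : BVar n → Bool} {i : Fin n} {β : Fin (mBits n) → Bool}
    (h : ¬ SatC α (blockClause i β)) (j : Fin (mBits n)) : α (i, j) = β j := by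
  by_contra hne
  exact h ⟨((i, j), !β j), mem_blockClause.2 ⟨j, rfl⟩, by simpa [Bool.eq_not] using hne⟩

theorem mBits_pos (hn : 0 < n) : 0 < mBits n := Nat.clog_pos (by norm_num) (by omega)

/-- A clause recording symbols that falsify one of the bracket axioms is derivable. -/
theorem WeakDer.of_falsifies (hn : 0 < n) (hπ : Function.Injective π)
    {C : Clause (ExtVar (Prod.fst : BVar n → Fin n) 4)} (hw : C.card + 4 ≤ w)
    (S : Finset (Fin n)) (hS : S.card ≤ 4) (s : Fin n → Sym n)
    (hfal : Falsifies (partialOn S s)) (hC : ∀ i ∈ S, blockLit i (π (s i)) ∈ C) :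
    WeakDer (ExBracketCNF n π) w C := by
  have hblocks : ∀ l ∈ S.biUnion fun i => blockClause i (π (s i)), l.1.1 ∈ S := by
    intro l hl
    obtain ⟨i, hi, hl⟩ := Finset.mem_biUnion.1 hl
    obtain ⟨j, rfl⟩ := mem_blockClause.1 hl
    exact hi
  refine .of_biUnion_mem (by norm_num) (⟨0, hn⟩, ⟨0, mBits_pos hn⟩)
    (fun i => blockClause i (π (s i))) (fun i => iw_blockClause_le i _) hw S hC
    (iw_le_of_blocks S hS hblocks) ⟨S, hS, hblocks, ?_⟩
  rintro α ⟨s', hα, hcons⟩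
  by_contra hsat
  refine hcons ?_
  have : partialOn S s' = partialOn S s := by
    funext i
    unfold partialOn
    split_ifs with hi
    · have : π (s' i) = π (s i) := by
        funext j
        rw [← hα i hi j]
        refine eq_of_not_satC_blockClause (fun ⟨l, hl, h⟩ => hsat ⟨l, ?_, h⟩) j
        exact Finset.mem_biUnion.2 ⟨i, hi, hl⟩
      rw [hπ this]
    · rfl
  rwa [this]

/-- Query the symbol at position `i`. -/
theorem WeakDer.query_block (hn : 0 < n) (i : Fin n)
    {C : Clause (ExtVar (Prod.fst : BVar n → Fin n) 4)} (hw : C.card + mBits n + 4 ≤ w)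
    (h : ∀ σ : Sym n, WeakDer (ExBracketCNF n π) w (insert (blockLit i (π σ)) C)) :
    WeakDer (ExBracketCNF n π) w C := by
  refine .query_literals (by norm_num) (fun j : Fin (mBits n) => (i, j)) Finset.univ
    (by simp; omega) fun γ => ?_
  obtain ⟨β, rfl⟩ : ∃ β : Fin (mBits n) → Bool, γ = fun j => !β j :=
    ⟨fun j => !γ j, by simp⟩
  have hcard : (C ∪ Finset.univ.image fun j : Fin (mBits n) =>
      ((⟨{((i, j), !β j)}, iw_singleton_le (by norm_num) _⟩ :
        ExtVar (Prod.fst : BVar n → Fin n) 4), true)).card ≤ C.card + mBits n := by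
    refine (Finset.card_union_le _ _).trans (Nat.add_le_add_left ?_ _)
    exact Finset.card_image_le.trans (by simp)
  refine .query ⟨blockClause i β, iw_blockClause_le i β⟩ (hcard.trans (by omega)) ?_ ?_
  · by_cases hβ : ∃ σ, π σ = β
    · obtain ⟨σ, rfl⟩ := hβ
      exact (h σ).mono (Finset.insert_subset_insert _ Finset.subset_union_left)
    · refine .of_mem (A := {blockLit i β}) ?_ (by simp [blockLit]) (by simp; omega)
      refine Or.inl ⟨blockClause i β, ⟨{i}, by simp, ?_, ?_⟩, iw_blockClause_le i β, rfl⟩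
      · intro l hl
        obtain ⟨j, rfl⟩ := mem_blockClause.1 hl
        simp
      · rintro α ⟨s, hα, -⟩
        by_contra hsat
        refine hβ ⟨s i, ?_⟩
        funext j
        rw [← hα i (Finset.mem_singleton_self i) j, eq_of_not_satC_blockClause hsat]
  · refine .of_biUnion (by norm_num) (⟨0, hn⟩, ⟨0, mBits_pos hn⟩)
      (fun j : Fin (mBits n) => {((i, j), !β j)}) (fun j => iw_singleton_le (by norm_num) _)
      ((Nat.add_le_add_right hcard 4).trans (by omega)) Finset.univ ?_ (iw_blockClause_le i β)
    intro j _
    exact Finset.mem_union_right _ (Finset.mem_image.2 ⟨j, Finset.mem_univ _, rfl⟩)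

theorem WeakDer.of_falsifies_one (hn : 0 < n) (hπ : Function.Injective π)
    {C : Clause (ExtVar (Prod.fst : BVar n → Fin n) 4)} (hw : C.card + 4 ≤ w)
    {i : Fin n} {σ : Sym n} (hi : blockLit i (π σ) ∈ C)
    (h : ∀ ρ : PState n, ρ i = some σ → Falsifies ρ) :
    WeakDer (ExBracketCNF n π) w C := by
  refine .of_falsifies hn hπ hw {i} (by simp) (fun _ => σ) (h _ (by simp [partialOn])) ?_
  intro x hx
  rw [Finset.mem_singleton.1 hx]
  exact hi

theorem WeakDer.of_falsifies_two (hn : 0 < n) (hπ : Function.Injective π)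
    {C : Clause (ExtVar (Prod.fst : BVar n → Fin n) 4)} (hw : C.card + 4 ≤ w)
    {i j : Fin n} {σ τ : Sym n} (hij : i ≠ j) (hi : blockLit i (π σ) ∈ C)
    (hj : blockLit j (π τ) ∈ C)
    (h : ∀ ρ : PState n, ρ i = some σ → ρ j = some τ → Falsifies ρ) :
    WeakDer (ExBracketCNF n π) w C := by
  refine .of_falsifies hn hπ hw {i, j} (Finset.card_le_two.trans (by norm_num))
    (fun x => if x = i then σ else τ)
    (h _ (by simp [partialOn]) (by simp [partialOn, hij.symm])) ?_
  intro x hx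
  rcases Finset.mem_insert.1 hx with rfl | hx
  · simpa using hi
  · rw [Finset.mem_singleton.1 hx]
    simpa [hij.symm] using hj

/-- Two crossing pairs are contradictory. -/
theorem WeakDer.of_crossing (hn : 0 < n) (hπ : Function.Injective π)
    {C : Clause (ExtVar (Prod.fst : BVar n → Fin n) 4)} (hw : C.card + 4 ≤ w)
    {i i' j j' : Fin n} {σ σ' τ τ' : Sym n} (h₁ : i < i') (h₂ : i' < j) (h₃ : j < j')
    (hi : blockLit i (π σ) ∈ C) (hi' : blockLit i' (π σ') ∈ C)
    (hj : blockLit j (π τ) ∈ C) (hj' : blockLit j' (π τ') ∈ C)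
    (hσ : σ.p = j) (hτ : τ.p = i) (hσ' : σ'.p = j') (hτ' : τ'.p = i') :
    WeakDer (ExBracketCNF n π) w C := by
  have e₁ : i' ≠ i := h₁.ne'
  have e₂ : j ≠ i := (h₁.trans h₂).ne'
  have e₃ : j' ≠ i := (h₁.trans (h₂.trans h₃)).ne'
  have e₄ : j ≠ i' := h₂.ne'
  have e₅ : j' ≠ i' := (h₂.trans h₃).ne'
  have e₆ : j' ≠ j := h₃.ne'
  refine .of_falsifies hn hπ hw {i, i', j, j'} Finset.card_le_four
    (fun x => if x = i then σ else if x = i' then σ' else if x = j then τ else τ') ?_ ?_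
  · refine Or.inr (Or.inr (Or.inl ⟨i, i', j, j', ⟨σ, τ, ?_, ?_, hσ, hτ⟩,
      ⟨σ', τ', ?_, ?_, hσ', hτ'⟩, h₁, h₂, h₃⟩)) <;> simp [partialOn, *]
  · intro x hx
    simp only [Finset.mem_insert, Finset.mem_singleton] at hx
    rcases hx with rfl | rfl | rfl | rfl <;> simp [*]

/-- If `i` points to `j ≠ i`, but `j` does not point to `i`, we have a contradiction. -/
theorem WeakDer.of_pointer_ne (hn : 0 < n) (hπ : Function.Injective π)
    {C : Clause (ExtVar (Prod.fst : BVar n → Fin n) 4)} (hw : C.card + 4 ≤ w)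
    {i j : Fin n} {σ τ : Sym n} (hij : i ≠ j) (hi : blockLit i (π σ) ∈ C)
    (hj : blockLit j (π τ) ∈ C) (hσ : σ.p = j) (hτ : τ.p ≠ i) :
    WeakDer (ExBracketCNF n π) w C :=
  .of_falsifies_two hn hπ hw hij hi hj fun _ h₁ h₂ =>
    Or.inr (Or.inl (Or.inl ⟨i, j, σ, τ, h₁, h₂, hσ, hτ⟩))

/-- The two endpoints of a pair have matching colours. -/
theorem WeakDer.of_pair (hn : 0 < n) (hπ : Function.Injective π)
    {C : Clause (ExtVar (Prod.fst : BVar n → Fin n) 4)} (hw : C.card + 4 ≤ w)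
    {a b : Fin n} {σ τ : Sym n} (hab : a ≤ b) (ha : blockLit a (π σ) ∈ C)
    (hb : blockLit b (π τ) ∈ C) (hσ : σ.p = b) (hτ : τ.p = a) (heq : a = b → σ = τ)
    (hred : τ.b = BType.closeR ∨ τ.b = BType.trivR → WeakDer (ExBracketCNF n π) w C)
    (hblue : σ.b = BType.openB ∨ σ.b = BType.trivB → WeakDer (ExBracketCNF n π) w C) :
    WeakDer (ExBracketCNF n π) w C := by
  rcases hab.eq_or_lt with h | h
  · obtain rfl := heq h
    by_cases hR : σ.b = BType.trivR
    · exact hred (Or.inr hR)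
    by_cases hB : σ.b = BType.trivB
    · exact hblue (Or.inr hB)
    exact .of_falsifies_one hn hπ hw ha fun _ h₁ =>
      Or.inr (Or.inl (Or.inr (Or.inl ⟨a, σ, h₁, hτ, by tauto⟩)))
  · by_cases hR : τ.b = BType.closeR
    · exact hred (Or.inl hR)
    by_cases hB : σ.b = BType.openB
    · exact hblue (Or.inl hB)
    exact .of_falsifies_two hn hπ hw h.ne ha hb fun _ h₁ h₂ =>
      Or.inr (Or.inl (Or.inr (Or.inr ⟨a, b, σ, τ, h, h₁, h₂, hσ, hτ, by tauto⟩)))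

/-- The clause stating that `i` and `j` do not have symbols `σ` and `τ`, added to `K`. -/
def addPair (π : Sym n → Fin (mBits n) → Bool)
    (K : Clause (ExtVar (Prod.fst : BVar n → Fin n) 4)) (i j : Fin n) (σ τ : Sym n) :
    Clause (ExtVar (Prod.fst : BVar n → Fin n) 4) :=
  insert (blockLit i (π σ)) (insert (blockLit j (π τ)) K)

section addPair

variable {K L : Clause (ExtVar (Prod.fst : BVar n → Fin n) 4)} {i j : Fin n} {σ τ : Sym n}

theorem card_addPair_le : (addPair π K i j σ τ).card ≤ K.card + 2 :=
  (Finset.card_insert_le _ _).trans (Nat.add_le_add_right (Finset.card_insert_le _ _) 1)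

theorem left_mem_addPair : blockLit i (π σ) ∈ addPair π K i j σ τ := by simp [addPair]

theorem right_mem_addPair : blockLit j (π τ) ∈ addPair π K i j σ τ := by simp [addPair]

theorem subset_addPair : K ⊆ addPair π K i j σ τ :=
  (Finset.subset_insert _ _).trans (Finset.subset_insert _ _)

theorem addPair_subset_addPair (h : K ⊆ L) : addPair π K i j σ τ ⊆ addPair π L i j σ τ :=
  Finset.insert_subset_insert _ (Finset.insert_subset_insert _ h)

theorem addPair_comm : addPair π K i j σ τ = addPair π K j i τ σ := Finset.insert_comm _ _ _

end addPair

/-- An empty gap between a red item (or the start) and a blue item (or the end) is impossible. -/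
theorem WeakDer.of_empty_gap (hn : 0 < n) (hπ : Function.Injective π)
    {K : Clause (ExtVar (Prod.fst : BVar n → Fin n) 4)} (hw : K.card + 4 ≤ w) {g : ℕ}
    (hL : g = 0 ∨ ∃ (q : Fin n) (τ : Sym n), (q : ℕ) + 1 = g ∧ blockLit q (π τ) ∈ K ∧
      (τ.b = BType.closeR ∨ τ.b = BType.trivR))
    (hR : g = n ∨ ∃ (q : Fin n) (σ : Sym n), (q : ℕ) = g ∧ blockLit q (π σ) ∈ K ∧
      (σ.b = BType.openB ∨ σ.b = BType.trivB)) :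
    WeakDer (ExBracketCNF n π) w K := by
  rcases hL with hL | ⟨q, τ, hq, hqK, hτ⟩ <;> rcases hR with hR | ⟨r, σ, hr, hrK, hσ⟩
  · omega
  · refine .of_falsifies_one hn hπ hw hrK fun _ h => Or.inl (Or.inl ⟨r, by omega, σ, h, ?_⟩)
    rcases hσ with hσ | hσ <;> simp [hσ]
  · refine .of_falsifies_one hn hπ hw hqK fun _ h => Or.inl (Or.inr ⟨q, by omega, τ, h, ?_⟩)
    rcases hτ with hτ | hτ <;> simp [hτ]
  · have hne : q ≠ r := by rintro rfl; omega
    exact .of_falsifies_two hn hπ hw hne hqK hrK fun _ h₁ h₂ =>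
      Or.inr (Or.inr (Or.inr ⟨q, r, by omega, τ, σ, h₁, h₂, hτ, hσ⟩))

/-- Binary search in the gap `[lo, hi)`, which lies between a red item (or the start) and a blue
item (or the end); `hesc` takes care of the pairs that leave the gap. -/
theorem WeakDer.of_gap (hn : 0 < n) (hπ : Function.Injective π) (d : ℕ) :
    ∀ (K : Clause (ExtVar (Prod.fst : BVar n → Fin n) 4)) (lo hi : ℕ),
    lo ≤ hi → hi ≤ n → hi - lo < 2 ^ d → K.card + 2 * d + mBits n + 8 ≤ w →
    (lo = 0 ∨ ∃ (q : Fin n) (τ : Sym n), (q : ℕ) + 1 = lo ∧ blockLit q (π τ) ∈ K ∧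
      (τ.b = BType.closeR ∨ τ.b = BType.trivR)) →
    (hi = n ∨ ∃ (q : Fin n) (σ : Sym n), (q : ℕ) = hi ∧ blockLit q (π σ) ∈ K ∧
      (σ.b = BType.openB ∨ σ.b = BType.trivB)) →
    (∀ (u v : Fin n) (σ τ : Sym n), lo ≤ (u : ℕ) → (u : ℕ) < hi →
      ((v : ℕ) < lo ∨ hi ≤ (v : ℕ)) → σ.p = v → τ.p = u →
      WeakDer (ExBracketCNF n π) w (addPair π K u v σ τ)) →
    WeakDer (ExBracketCNF n π) w K := by
  induction d with
  | zero =>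
    intro K lo hi hlohi hhin hgap hw hL hR _
    obtain rfl : lo = hi := by simp at hgap; omega
    exact .of_empty_gap hn hπ (by omega) hL hR
  | succ d ih =>
    intro K lo hi hlohi hhin hgap hw hL hR hesc
    rcases hlohi.eq_or_lt with rfl | hlt
    · exact .of_empty_gap hn hπ (by omega) hL hR
    have hlt_n : lo + (hi - lo) / 2 < n := by clear hL hR; omega
    obtain ⟨m, hm⟩ : ∃ m : Fin n, (m : ℕ) = lo + (hi - lo) / 2 := ⟨⟨_, hlt_n⟩, rfl⟩
    rw [pow_succ] at hgap
    have item : ∀ (r : ℕ) (a b : Fin n) (σ τ : Sym n), n - ((b : ℕ) - a) ≤ r →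
        lo ≤ (a : ℕ) → (a : ℕ) ≤ m → (m : ℕ) ≤ b → (b : ℕ) < hi → σ.p = b → τ.p = a →
        (a = b → σ = τ) → WeakDer (ExBracketCNF n π) w (addPair π K a b σ τ) := by
      intro r
      induction r with
      | zero => intro a b _ _ hr; clear hL hR; omega
      | succ r ihr =>
        intro a b σ τ hr hlo ham hmb hhi hσ hτ heq
        have hcard := card_addPair_le (π := π) (K := K) (i := a) (j := b) (σ := σ) (τ := τ)
        have escape : ∀ (u v : Fin n) (σ' τ' : Sym n), lo ≤ (u : ℕ) → (u : ℕ) < hi →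
            ((u : ℕ) < a ∧ ((v : ℕ) < lo ∨ (a : ℕ) ≤ v) ∨
              (b : ℕ) < u ∧ ((v : ℕ) ≤ b ∨ hi ≤ (v : ℕ))) →
            σ'.p = v → τ'.p = u →
            WeakDer (ExBracketCNF n π) w (addPair π (addPair π K a b σ τ) u v σ' τ') := by
          intro u v σ' τ' hu₁ hu₂ huv hσ' hτ'
          have hw' : (addPair π (addPair π K a b σ τ) u v σ' τ').card + 4 ≤ w := by
            have := card_addPair_le (π := π) (K := addPair π K a b σ τ) (i := u) (j := v)
              (σ := σ') (τ := τ')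
            clear hL hR; omega
          have mem_a : blockLit a (π σ) ∈ addPair π (addPair π K a b σ τ) u v σ' τ' :=
            subset_addPair left_mem_addPair
          have mem_b : blockLit b (π τ) ∈ addPair π (addPair π K a b σ τ) u v σ' τ' :=
            subset_addPair right_mem_addPair
          by_cases hv : (v : ℕ) < lo ∨ hi ≤ (v : ℕ)
          · exact (hesc u v σ' τ' hu₁ hu₂ hv hσ' hτ').mono
              (addPair_subset_addPair subset_addPair)
          have hua : u ≠ a := by rintro rfl; clear hL hR; omega
          have hub : u ≠ b := by rintro rfl; clear hL hR; omega
          by_cases hva : v = a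
          · subst hva
            exact .of_pointer_ne hn hπ hw' hua left_mem_addPair mem_a hσ' (hσ ▸ hub.symm)
          by_cases hvb : v = b
          · subst hvb
            exact .of_pointer_ne hn hπ hw' hub left_mem_addPair mem_b hσ' (hτ ▸ hua.symm)
          have hva' : (v : ℕ) ≠ a := fun h => hva (Fin.ext h)
          have hvb' : (v : ℕ) ≠ b := fun h => hvb (Fin.ext h)
          clear hL hR
          by_cases hin : a < v ∧ v < b
          · rcases huv with ⟨hu, -⟩ | ⟨hu, -⟩
            · exact .of_crossing hn hπ hw' (Fin.lt_def.2 hu) hin.1 hin.2 left_mem_addPair mem_a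
                right_mem_addPair mem_b hσ' hτ' hσ hτ
            · exact .of_crossing hn hπ hw' hin.1 hin.2 (Fin.lt_def.2 hu) mem_a
                right_mem_addPair mem_b left_mem_addPair hσ hτ hτ' hσ'
          · rw [Fin.lt_def, Fin.lt_def] at hin
            have hmono := addPair_subset_addPair (π := π) (i := u) (j := v) (σ := σ') (τ := τ')
              (subset_addPair (π := π) (K := K) (i := a) (j := b) (σ := σ) (τ := τ))
            rcases huv with ⟨hu, hv'⟩ | ⟨hu, hv'⟩
            · refine (ihr u v σ' τ' ?_ ?_ ?_ ?_ ?_ hσ' hτ' ?_).mono hmono <;> omega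
            · rw [addPair_comm (K := K)] at hmono
              refine (ihr v u τ' σ' ?_ ?_ ?_ ?_ ?_ hτ' hσ' ?_).mono hmono <;> omega
        refine .of_pair hn hπ (C := addPair π K a b σ τ) (by clear hL hR; omega)
          (Fin.le_def.2 (ham.trans hmb))
          left_mem_addPair right_mem_addPair hσ hτ heq (fun hred => ?_) (fun hblue => ?_)
        · refine ih (addPair π K a b σ τ) (b + 1) hi hhi hhin (by clear hL hR; omega)
            (by clear hL hR; omega) (Or.inr ⟨b, τ, rfl, right_mem_addPair, hred⟩) ?_ ?_
          · exact hR.imp_right fun ⟨q, σ', h₁, h₂, h₃⟩ => ⟨q, σ', h₁, subset_addPair h₂, h₃⟩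
          · intro u v σ' τ' hu₁ hu₂ hv
            refine escape u v σ' τ' ?_ hu₂ (Or.inr ⟨?_, ?_⟩) <;>
              clear hL hR <;> omega
        · refine ih (addPair π K a b σ τ) lo a hlo (by clear hL hR; omega)
            (by clear hL hR; omega) (by clear hL hR; omega) ?_
            (Or.inr ⟨a, σ, rfl, left_mem_addPair, hblue⟩) ?_
          · exact hL.imp_right fun ⟨q, σ', h₁, h₂, h₃⟩ => ⟨q, σ', h₁, subset_addPair h₂, h₃⟩
          · intro u v σ' τ' hu₁ hu₂ hv
            refine escape u v σ' τ' hu₁ ?_ (Or.inl ⟨hu₂, ?_⟩) <;>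
              clear hL hR <;> omega
    clear hL hR
    refine .query_block hn m (by omega) fun σ => ?_
    by_cases hself : σ.p = m
    · refine (item n m m σ σ (by omega) ?_ le_rfl le_rfl ?_ hself hself fun _ => rfl).mono ?_
      · omega
      · omega
      · simp [addPair]
    refine .query_block hn σ.p ?_ fun τ => ?_
    · have := Finset.card_insert_le (blockLit m (π σ)) K
      omega
    rw [Finset.insert_comm]
    change WeakDer _ _ (addPair π K m σ.p σ τ)
    by_cases hback : τ.p = m
    swap
    · refine .of_pointer_ne hn hπ ?_ (Ne.symm hself) left_mem_addPair right_mem_addPair rfl hback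
      have := card_addPair_le (π := π) (K := K) (i := m) (j := σ.p) (σ := σ) (τ := τ)
      omega
    by_cases hout : (σ.p : ℕ) < lo ∨ hi ≤ (σ.p : ℕ)
    · exact hesc m σ.p σ τ (by omega) (by omega) hout rfl hback
    rcases lt_or_gt_of_ne (Fin.val_ne_of_ne hself) with h | h
    · rw [addPair_comm]
      exact item n _ _ _ _ (by omega) (by omega) h.le le_rfl (by omega) hback rfl
        fun h' => absurd h' hself
    · exact item n _ _ _ _ (by omega) (by omega) le_rfl h.le (by omega) rfl hback
        fun h' => absurd h'.symm hself

theorem exists_refutation_widthLE (hn : 0 < n) (hπ : Function.Injective π) :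
    ∃ R : Refutation (ExtVar (Prod.fst : BVar n → Fin n) 4) (ExBracketCNF n π),
      WidthLE R (3 * mBits n + 8) := by
  have hpow : 6 * n ≤ 2 ^ mBits n := Nat.le_pow_clog (by norm_num) _
  refine WeakDer.exists_refutation (.of_gap hn hπ (mBits n) ∅ 0 n (Nat.zero_le _) le_rfl
    (by omega) (by simp; omega) (Or.inl rfl) (Or.inl rfl) ?_)
  intro u v _ _ _ _ hv
  omega

end Bracket

theorem mBits_le_log {n : ℕ} (hn : 6 ≤ n) : (mBits n : ℝ) ≤ 4 * Real.log n + 1 := by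
  have hlt : 2 ^ (mBits n - 1) < 6 * n := Nat.pow_pred_clog_lt_self (by norm_num) (by omega)
  have hsq : (2 : ℝ) ^ (mBits n - 1) ≤ (n : ℝ) ^ 2 := by
    have : 2 ^ (mBits n - 1) ≤ n ^ 2 := hlt.le.trans (by nlinarith)
    exact_mod_cast this
  have hlog := Real.log_le_log (by positivity) hsq
  rw [Real.log_pow, Real.log_pow] at hlog
  have hcast : (mBits n : ℝ) ≤ ((mBits n - 1 : ℕ) : ℝ) + 1 := by
    exact_mod_cast (by omega : mBits n ≤ mBits n - 1 + 1)
  have h2 := Real.log_two_gt_d9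
  push_cast at hlog
  nlinarith [Nat.cast_nonneg (α := ℝ) (mBits n - 1)]

/-- The bracket formula `ExBracket_n` admits a resolution refutation
of width `O(log n)`. -/
theorem exbracket_width_upper_bound :
    ∃ a : ℝ, 0 < a ∧ ∃ N : ℕ, ∀ n ≥ N,
      ∀ π : Sym n → Fin (mBits n) → Bool, Function.Injective π →
        ∃ R : Refutation (ExtVar (Prod.fst : BVar n → Fin n) 4) (ExBracketCNF n π),
          ∀ i, ((R.clause i).card : ℝ) ≤ a * Real.log n := by
  refine ⟨32, by norm_num, 6, fun n hn π hπ => ?_⟩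
  obtain ⟨R, hR⟩ := exists_refutation_widthLE (n := n) (by omega) hπ
  refine ⟨R, fun i => ?_⟩
  have hcard : ((R.clause i).card : ℝ) ≤ 3 * mBits n + 8 := by exact_mod_cast hR i
  have hlog : 1 ≤ Real.log n := by
    rw [Real.le_log_iff_exp_le (by positivity)]
    have : (6 : ℝ) ≤ n := by exact_mod_cast hn
    linarith [Real.exp_one_lt_d9]
  linarith [mBits_le_log hn]

end Paper
end
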